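/- arXiv:2006.11230 — 6 statements merged into one kernel-verified Lean document; each statement's English description precedes it below -/
import Mathlib

section
/- Let m be a squarefree rational integer with m ∉ {0, 1, -1}, let α be a complex root of the irreducible polynomial f(x) = x^12 − m, and let K = ℚ(α) with ring of integers Z_K. If m ≡ 2 or 3 (mod 4) and m ≢ 1 (mod 9) and m ≢ −1 (mod 9), then Z_K = ℤ[α]; in particular (1, α, α^2, …, α^11) is a power integral basis of Z_K and K is monogenic. -/
open Polynomial NumberField

/-- If `β ^ q ≡ β` modulo an ideal containing `p`, with `q = p ^ r`, then `x ^ q ≡ x` for every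
`x ∈ ℤ[β]`. -/
theorem duo_frob {O : Type*} [CommRing O] (β : O) (p r : ℕ) (hp : p.Prime)
    (I : Ideal (Algebra.adjoin ℤ {β}))
    (hpI : (p : Algebra.adjoin ℤ {β}) ∈ I)
    (b : Algebra.adjoin ℤ {β}) (hb : (b : O) = β) (hbI : b ^ p ^ r - b ∈ I)
    (x : Algebra.adjoin ℤ {β}) : x ^ p ^ r - x ∈ I := by
  obtain ⟨x, hx⟩ := x
  induction hx using Algebra.adjoin_induction with
  | mem y hy =>
    have : y = β := hy
    subst this
    have h : b = ⟨y, Algebra.subset_adjoin hy⟩ := Subtype.ext hb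
    rw [← h]; exact hbI
  | algebraMap n =>
    have : ((p : ℤ) : ℤ) ∣ n ^ p ^ r - n := by
      have : Fact p.Prime := ⟨hp⟩
      rw [← ZMod.intCast_zmod_eq_zero_iff_dvd _ p]
      push_cast
      rw [ZMod.pow_card_pow, sub_self]
    obtain ⟨c, hc⟩ := this
    have h : (⟨algebraMap ℤ O n, Subalgebra.algebraMap_mem _ n⟩ : Algebra.adjoin ℤ {β})
        = ((n : ℤ) : Algebra.adjoin ℤ {β}) := by
      apply Subtype.ext; simp
    rw [h]
    have h2 : ((n : ℤ) : Algebra.adjoin ℤ {β}) ^ p ^ r - n = (c : Algebra.adjoin ℤ {β}) * p := by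
      have := congrArg (Int.cast : ℤ → Algebra.adjoin ℤ {β}) hc
      push_cast at this
      rw [this, mul_comm]
    rw [h2]
    exact I.mul_mem_left _ hpI
  | add y z hy hz h1 h2 =>
    set y' : Algebra.adjoin ℤ {β} := ⟨y, hy⟩
    set z' : Algebra.adjoin ℤ {β} := ⟨z, hz⟩
    change (y' + z') ^ p ^ r - (y' + z') ∈ I
    obtain ⟨s, hs⟩ := exists_add_pow_prime_pow_eq hp y' z' r
    have : (y' + z') ^ p ^ r - (y' + z')
        = (y' ^ p ^ r - y') + (z' ^ p ^ r - z') + (y' * z' * s) * p := by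
      rw [hs]; ring
    rw [this]
    exact I.add_mem (I.add_mem h1 h2) (I.mul_mem_left _ hpI)
  | mul y z hy hz h1 h2 =>
    set y' : Algebra.adjoin ℤ {β} := ⟨y, hy⟩
    set z' : Algebra.adjoin ℤ {β} := ⟨z, hz⟩
    change (y' * z') ^ p ^ r - (y' * z') ∈ I
    have : (y' * z') ^ p ^ r - (y' * z')
        = z' ^ p ^ r * (y' ^ p ^ r - y') + y' * (z' ^ p ^ r - z') := by
      ring
    rw [this]
    exact I.add_mem (I.mul_mem_left _ h1) (I.mul_mem_left _ h2)

theorem duo_rad {R : Type*} [CommRing R] (I : Ideal R) (q : ℕ) (hq : 2 ≤ q)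
    (h : ∀ x : R, x ^ q - x ∈ I) (x : R) (n : ℕ) (hx : x ^ n ∈ I) : x ∈ I := by
  have key : ∀ k : ℕ, x ^ q ^ k - x ∈ I := by
    intro k
    induction k with
    | zero => simp
    | succ k ih =>
      have : x ^ q ^ (k + 1) - x = ((x ^ q ^ k) ^ q - x ^ q ^ k) + (x ^ q ^ k - x) := by
        rw [pow_succ, pow_mul]; ring
      rw [this]
      exact I.add_mem (h _) ih
  have h1 : x ^ q ^ n ∈ I := by
    have hle : n ≤ q ^ n := (Nat.lt_pow_self (by omega)).le
    exact I.pow_mem_of_pow_mem hx hle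
  have := I.sub_mem h1 (key n)
  simpa using this

/-- The local criterion at `p`. -/
theorem duo_local {O : Type*} [CommRing O] [IsDomain O] [Algebra.IsIntegral ℤ O] [CharZero O]
    (β : O) (A : Subalgebra ℤ O) (hA : A = Algebra.adjoin ℤ {β}) (p r e : ℕ) (hp : p.Prime) (hr : r ≠ 0)
    (b : A) (hb : (b : O) = β)
    (π u v : A)
    (hbI : b ^ p ^ r - b ∈ Ideal.span {(p : A), π})
    (hπ : π ^ e = p * u)
    (huv : u * v - 1 ∈ Ideal.span {(p : A), π})
    (z : O) (hz : (p : O) * z ∈ A) : z ∈ A := by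
  set I : Ideal A := Ideal.span {(p : A), π} with hI
  have hpI : (p : A) ∈ I := Ideal.subset_span (by simp)
  have hp0 : (p : O) ≠ 0 := by exact_mod_cast hp.ne_zero
  have hq : 2 ≤ p ^ r := hp.two_le.trans (Nat.le_self_pow hr p)
  have hfrob : ∀ x : A, x ^ p ^ r - x ∈ I := by
    clear_value I
    subst hA
    exact duo_frob β p r hp I hpI b hb hbI
  have hrad := duo_rad I (p ^ r) hq hfrob
  have hinj : Function.Injective (algebraMap A O) := Subtype.val_injective
  -- elements of `A ∩ pO` lie in `I`
  have hmem : ∀ (x : A) (w : O), (p : O) * w = x → x ∈ I := by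
    intro x w hw
    obtain ⟨P, hP, hPw⟩ := Algebra.IsIntegral.isIntegral (R := ℤ) w
    have hdvd : (p : A) ∣ x ^ (P.map (algebraMap ℤ A)).natDegree := by
      refine dvd_pow_natDegree_of_eval₂_eq_zero hinj (hP.map _) (p : A) x w ?_ ?_
      · rw [eval₂_map, ← IsScalarTower.algebraMap_eq]; exact hPw
      · rw [map_natCast]; exact hw
    exact hrad x _ (I.mem_of_dvd hdvd hpI)
  have hstep : ∀ (k : ℕ), k < e → ∀ (x : A) (w : O), (p : O) * w = (π : O) ^ k * x → x ∈ I := by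
    intro k hk x w hw
    have hπO : (π : O) ^ e = p * (u : O) := by
      have := congrArg (algebraMap A O) hπ
      simpa using this
    have h1 : (u : O) * x = (π : O) ^ (e - k) * w := by
      apply mul_left_cancel₀ hp0
      rw [← mul_assoc, ← hπO]
      have : (π : O) ^ e = π ^ (e - k) * π ^ k := by rw [← pow_add]; congr 1; omega
      rw [this, mul_assoc, ← hw]; ring
    have h2 : u * x ∈ I := by
      apply hrad _ e
      apply hmem _ ((u : O) * (π : O) ^ (e * (e - k - 1)) * w ^ e)
      push_cast
      rw [h1, mul_pow, ← pow_mul]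
      have : (e - k) * e = e + e * (e - k - 1) := by
        obtain ⟨d, hd⟩ : ∃ d, e - k = d + 1 := ⟨e - k - 1, by omega⟩
        rw [hd]; simp; ring
      rw [this, pow_add, hπO]; ring
    have : x = v * (u * x) - x * (u * v - 1) := by ring
    rw [this]
    exact I.sub_mem (I.mul_mem_left _ h2) (I.mul_mem_left _ huv)
  obtain ⟨a, ha⟩ : ∃ a : A, (a : O) = p * z := ⟨⟨_, hz⟩, rfl⟩
  have hind : ∀ k ≤ e, ∃ c d : A, a = p * c + π ^ k * d := by
    intro k
    induction k with
    | zero => intro _; exact ⟨0, a, by simp⟩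
    | succ k ih =>
      intro hk
      obtain ⟨c, d, hcd⟩ := ih (by omega)
      have hcdO : (a : O) = p * c + π ^ k * d := by
        have := congrArg (algebraMap A O) hcd
        simpa using this
      have hd : d ∈ I := hstep k (by omega) d (z - c) (by
        rw [mul_sub, ← ha, hcdO]; ring)
      obtain ⟨s, t, hst⟩ := Ideal.mem_span_pair.mp hd
      refine ⟨c + π ^ k * s, t, ?_⟩
      rw [hcd, ← hst]; ring
  obtain ⟨c, d, hcd⟩ := hind e le_rfl
  have hfin : z = ((c + u * d : A) : O) := by
    apply mul_left_cancel₀ hp0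
    rw [← ha, hcd, hπ]
    push_cast; ring
  rw [hfin]
  exact (c + u * d : A).2

/-- Peeling off primes. -/
theorem duo_peel {O : Type*} [CommRing O] (A : Subalgebra ℤ O) (n : ℕ) (hn : n ≠ 0)
    (h : ∀ p : ℕ, p.Prime → p ∣ n → ∀ z : O, (p : O) * z ∈ A → z ∈ A) :
    ∀ z : O, (n : O) * z ∈ A → z ∈ A := by
  induction n using Nat.recOnMul with
  | zero => exact absurd rfl hn
  | one => intro z hz; simpa using hz
  | prime p hp => exact h p hp dvd_rfl
  | mul a b iha ihb =>
    intro z hz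
    have ha : a ≠ 0 := by rintro rfl; simp at hn
    have hb : b ≠ 0 := by rintro rfl; simp at hn
    refine ihb hb (fun p hp hpb => h p hp (hpb.mul_left _)) z ?_
    refine iha ha (fun p hp hpb => h p hp (hpb.mul_right _)) _ ?_
    push_cast at hz
    rwa [← mul_assoc]

/-- The derivative of `X ^ 12 - m` at `β` lies in the conductor. -/
theorem duo_conductor (m : ℤ) (K : Type*) [Field K] [NumberField K] (α : K)
    (hgen : IntermediateField.adjoin ℚ {α} = ⊤)
    (β : 𝓞 K) (hβ : (β : K) = α) (hb : β ^ 12 = (m : 𝓞 K)) (z : 𝓞 K) :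
    (12 * (m : 𝓞 K)) * z ∈ Algebra.adjoin ℤ {β} := by
  have hx : Algebra.adjoin ℚ {algebraMap (𝓞 K) K β} = ⊤ := by
    have : algebraMap (𝓞 K) K β = α := hβ
    rw [this, ← IntermediateField.adjoin_simple_toSubalgebra_of_isAlgebraic
      (IsAlgebraic.of_finite ℚ _), hgen, IntermediateField.top_toSubalgebra]
  have h := conductor_mul_differentIdeal ℤ ℚ K β hx
  have h1 : aeval β (derivative (minpoly ℤ β)) ∈ conductor ℤ β := by
    have : aeval β (derivative (minpoly ℤ β)) ∈
        Ideal.span {aeval β (derivative (minpoly ℤ β))} := Ideal.mem_span_singleton_self _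
    have hle : conductor ℤ β * differentIdeal ℤ (𝓞 K) ≤ conductor ℤ β := Ideal.mul_le_left
    exact hle (h.symm ▸ this)
  have hint : IsIntegral ℤ β := Algebra.IsIntegral.isIntegral β
  have hroot : aeval β (X ^ 12 - C m : ℤ[X]) = 0 := by simp [hb]
  obtain ⟨g, hg⟩ := minpoly.isIntegrallyClosed_dvd hint hroot
  have h2 : 12 * β ^ 11 ∈ conductor ℤ β := by
    have := congrArg (fun P => aeval β (derivative P)) hg
    simp [derivative_mul] at this
    have h12 : (aeval β) (12 : ℤ[X]) = 12 := map_ofNat _ 12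
    rw [h12] at this
    rw [this]
    exact Ideal.mul_mem_right _ _ h1
  have h3 := mem_conductor_iff.mp h2 (β * z)
  rw [← hb]
  convert h3 using 1
  ring

/-- Let `m` be a squarefree rational integer with `m ∉ {0, 1, -1}`, `α` a root of the
irreducible polynomial `f(x) = x^12 − m`, and `K = ℚ(α)` with ring of integers `Z_K`.
If `m ≡ 2` or `3 (mod 4)` and `m ≢ ±1 (mod 9)`, then `Z_K = ℤ[α]`, i.e. `K` is monogenic
with power integral basis generated by `α`. -/
theorem pure_duodecic_monogenic (m : ℤ) (hsf : Squarefree m)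
    (h0 : m ≠ 0) (h1 : m ≠ 1) (h2 : m ≠ -1)
    (K : Type*) [Field K] [NumberField K] (α : K)
    (hroot : α ^ 12 = (m : K))
    (hgen : IntermediateField.adjoin ℚ {α} = ⊤)
    (β : 𝓞 K) (hβ : (β : K) = α)
    (hmod4 : m ≡ 2 [ZMOD 4] ∨ m ≡ 3 [ZMOD 4])
    (hmod9 : ¬ m ≡ 1 [ZMOD 9]) (hmod9' : ¬ m ≡ -1 [ZMOD 9]) :
    Algebra.adjoin ℤ {β} = ⊤ := by
  have hb : β ^ 12 = (m : 𝓞 K) := by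
    apply RingOfIntegers.coe_injective
    rw [map_pow, map_intCast]
    rw [← hroot, ← hβ]
  set A := Algebra.adjoin ℤ {β} with hA
  obtain ⟨b, hbb⟩ : ∃ b : A, (b : 𝓞 K) = β := ⟨⟨β, Algebra.subset_adjoin rfl⟩, rfl⟩
  have hb12 : b ^ 12 = (m : A) := by
    apply Subtype.ext
    push_cast
    rw [hbb, hb]
  have hloc : ∀ p : ℕ, p.Prime → p ∣ (12 * m).natAbs → ∀ z : 𝓞 K, (p : 𝓞 K) * z ∈ A → z ∈ A := by
    intro p hp hpm
    have hpp : Prime (p : ℤ) := Nat.prime_iff_prime_int.mp hp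
    by_cases hm : (p : ℤ) ∣ m
    · obtain ⟨t, ht⟩ := hm
      have hnt : ¬ (p : ℤ) ∣ t := by
        rintro ⟨s, hs⟩
        exact hpp.not_isUnit (hsf p ⟨s, by rw [ht, hs]; ring⟩)
      have hcop : IsCoprime (p : ℤ) t := (Prime.coprime_iff_not_dvd hpp).mpr hnt
      obtain ⟨c, d, hcd⟩ := hcop
      have hcd' : (c : A) * p + d * t = 1 := by exact_mod_cast congrArg (Int.cast : ℤ → A) hcd
      refine duo_local β A hA p 1 12 hp one_ne_zero b hbb b (t : A) (d : A) ?_ ?_ ?_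
      · rw [Ideal.mem_span_pair]
        refine ⟨0, b ^ (p - 1) - 1, ?_⟩
        have : b ^ p = b ^ (p - 1) * b := by
          rw [← pow_succ, Nat.sub_add_cancel hp.one_le]
        rw [pow_one, this]; ring
      · rw [hb12, ht]; push_cast; ring
      · rw [Ideal.mem_span_pair]
        refine ⟨-c, 0, ?_⟩
        linear_combination (-1 : A) * hcd'
    · have h12 : (p : ℤ) ∣ 12 := by
        have : (p : ℤ) ∣ 12 * m := Int.natCast_dvd.mpr hpm
        exact (hpp.dvd_or_dvd this).resolve_right hm
      have h23 : p = 2 ∨ p = 3 := by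
        have h : p ∣ 2 ^ 2 * 3 := by exact_mod_cast h12
        rcases (Nat.Prime.dvd_mul hp).mp h with h | h
        · exact Or.inl ((Nat.prime_dvd_prime_iff_eq hp Nat.prime_two).mp (hp.dvd_of_dvd_pow h))
        · exact Or.inr ((Nat.prime_dvd_prime_iff_eq hp Nat.prime_three).mp h)
      rcases h23 with rfl | rfl
      · have hm4 : m % 4 = 3 := by
          simp only [Int.ModEq] at hmod4
          push_cast at hm
          omega
        obtain ⟨k, hk⟩ : ∃ k, m = 4 * k + 3 := ⟨m / 4, by omega⟩
        have hkA : (m : A) = 4 * k + 3 := by exact_mod_cast congrArg (Int.cast : ℤ → A) hk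
        obtain ⟨s, hs⟩ : ∃ s : ℤ, m ^ 4 - m = 2 * (2 * s + 1) := by
          refine ⟨64*k^4 + 192*k^3 + 216*k^2 + 107*k + 19, ?_⟩
          rw [hk]; ring
        have hsA : (m : A) ^ 4 - m = 2 * (2 * s + 1) := by
          exact_mod_cast congrArg (Int.cast : ℤ → A) hs
        set y : A := b ^ 3 - m with hy
        refine duo_local β A hA 2 2 4 hp two_ne_zero b hbb y
          (-(2 * y ^ 3 * m + 3 * y ^ 2 * m ^ 2 + 2 * y * m ^ 3 + (2 * s + 1))) 1 ?_ ?_ ?_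
        · rw [Ideal.mem_span_pair]
          refine ⟨b * (2 * k + 1), b, ?_⟩
          rw [hy, hkA]; push_cast; ring
        · push_cast
          have h4 : (y + m) ^ 4 = m := by rw [hy, ← hb12]; ring
          linear_combination h4 - hsA
        · rw [Ideal.mem_span_pair]
          refine ⟨-(y ^ 3 * m + y * m ^ 3 + s + 1), -(3 * y * m ^ 2), ?_⟩
          push_cast; ring
      · have hm3 : ∃ t : ℤ, m ^ 3 - m = 3 * t ∧ ∃ s, t * t - 1 = 3 * s := by
          simp only [Int.ModEq] at hmod9 hmod9'
          push_cast at hm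
          have h9 : m % 9 = 2 ∨ m % 9 = 4 ∨ m % 9 = 5 ∨ m % 9 = 7 := by omega
          obtain ⟨k, hk⟩ : ∃ k, m = 9 * k + m % 9 := ⟨m / 9, by omega⟩
          have aux : ∀ t : ℤ, t % 3 = 1 ∨ t % 3 = 2 → ∃ s, t * t - 1 = 3 * s := by
            rintro t (h | h)
            · obtain ⟨j, hj⟩ : ∃ j, t = 3 * j + 1 := ⟨t / 3, by omega⟩
              exact ⟨3 * j ^ 2 + 2 * j, by rw [hj]; ring⟩
            · obtain ⟨j, hj⟩ : ∃ j, t = 3 * j + 2 := ⟨t / 3, by omega⟩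
              exact ⟨3 * j ^ 2 + 4 * j + 1, by rw [hj]; ring⟩
          rcases h9 with h | h | h | h <;> rw [h] at hk
          · refine ⟨3 * (81 * k ^ 3 + 54 * k ^ 2 + 11 * k) + 2, by rw [hk]; ring, aux _ (by omega)⟩
          · refine ⟨3 * (81 * k ^ 3 + 108 * k ^ 2 + 47 * k + 6) + 2, by rw [hk]; ring,
              aux _ (by omega)⟩
          · refine ⟨3 * (81 * k ^ 3 + 135 * k ^ 2 + 74 * k + 13) + 1, by rw [hk]; ring,
              aux _ (by omega)⟩
          · refine ⟨3 * (81 * k ^ 3 + 189 * k ^ 2 + 146 * k + 37) + 1, by rw [hk]; ring,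
              aux _ (by omega)⟩
        obtain ⟨t, ht, s, hs⟩ := hm3
        have htA : (m : A) ^ 3 - m = 3 * t := by exact_mod_cast congrArg (Int.cast : ℤ → A) ht
        have hsA : (t : A) * t - 1 = 3 * s := by exact_mod_cast congrArg (Int.cast : ℤ → A) hs
        obtain ⟨l, hl⟩ : ∃ l : ℤ, m ^ 2 - 1 = 3 * l := by
          push_cast at hm
          obtain h | h : m % 3 = 1 ∨ m % 3 = 2 := by omega
          · obtain ⟨j, hj⟩ : ∃ j, m = 3 * j + 1 := ⟨m / 3, by omega⟩
            exact ⟨3 * j ^ 2 + 2 * j, by rw [hj]; ring⟩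
          · obtain ⟨j, hj⟩ : ∃ j, m = 3 * j + 2 := ⟨m / 3, by omega⟩
            exact ⟨3 * j ^ 2 + 4 * j + 1, by rw [hj]; ring⟩
        have hlA : (m : A) ^ 2 - 1 = 3 * l := by exact_mod_cast congrArg (Int.cast : ℤ → A) hl
        set y : A := b ^ 4 - m with hy
        refine duo_local β A hA 3 2 3 hp two_ne_zero b hbb y
          (-(y ^ 2 * m + y * m ^ 2 + t)) (-t) ?_ ?_ ?_
        · rw [Ideal.mem_span_pair]
          refine ⟨b * l, b * (b ^ 4 + m), ?_⟩
          rw [hy]; push_cast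
          linear_combination (-b) * hlA
        · push_cast
          have h4 : (y + m) ^ 3 = m := by rw [hy, ← hb12]; ring
          linear_combination h4 - htA
        · rw [Ideal.mem_span_pair]
          refine ⟨(s : A), t * (y * m + m ^ 2), ?_⟩
          push_cast
          linear_combination -hsA
  rw [eq_top_iff]
  intro z _
  have hz := duo_conductor m K α hgen β hβ hb z
  refine duo_peel A (12 * m).natAbs (by simp [h0]) hloc z ?_
  have hn := Int.natAbs_eq (12 * m)
  generalize (12 * m).natAbs = n at hn
  rcases hn with h | h
  · have h' : (n : 𝓞 K) = 12 * m := by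
      have := congrArg (Int.cast : ℤ → 𝓞 K) h
      push_cast at this
      exact this.symm
    rw [h']; exact hz
  · have h' : (n : 𝓞 K) = -(12 * m) := by
      have := congrArg (Int.cast : ℤ → 𝓞 K) h
      push_cast at this
      rw [this, neg_neg]
    rw [h', neg_mul]; exact A.neg_mem hz
end

section
/- Let m be a squarefree rational integer with m ∉ {0, 1, -1}, let α be a complex root of the irreducible polynomial f(x) = x^12 − m, and let K = ℚ(α) with ring of integers Z_K. If m ≡ 1 (mod 4), or m ≡ 1 (mod 9), or m ≡ −1 (mod 9), then K is not monogenic, i.e., there is no θ ∈ Z_K with Z_K = ℤ[θ]. -/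
open Polynomial NumberField

lemma minpoly_alpha (m : ℤ) (hsf : Squarefree m)
    (h1 : m ≠ 1) (h2 : m ≠ -1)
    (K : Type*) [Field K] [NumberField K] (α : K)
    (hroot : α ^ 12 = (m : K)) : minpoly ℚ α = X ^ 12 - C (m : ℚ) := by
  have hnu : ¬ IsUnit m := by
    rw [Int.isUnit_iff]; tauto
  have h0 : m ≠ 0 := hsf.ne_zero
  obtain ⟨q, hq, hqm⟩ := WfDvdMonoid.exists_irreducible_factor hnu h0
  have hqp : Prime q := hq.prime
  have hmon : (X ^ 12 - C m : ℤ[X]).Monic := monic_X_pow_sub_C m (by norm_num)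
  have hdeg : (X ^ 12 - C m : ℤ[X]).natDegree = 12 := natDegree_X_pow_sub_C
  have hirr : Irreducible (X ^ 12 - C m : ℤ[X]) := by
    refine IsEisensteinAt.irreducible (𝓟 := Ideal.span {q}) ?_
      ((Ideal.span_singleton_prime hqp.ne_zero).2 hqp) hmon.isPrimitive (by rw [hdeg]; norm_num)
    refine ⟨?_, ?_, ?_⟩
    · rw [hmon.leadingCoeff, Ideal.mem_span_singleton]
      exact fun h => hqp.not_isUnit (isUnit_of_dvd_one h)
    · intro n hn
      rw [hdeg] at hn
      rw [Ideal.mem_span_singleton, coeff_sub, coeff_X_pow, if_neg (by omega), coeff_C]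
      split_ifs
      · simpa using hqm
      · simp
    · rw [Ideal.span_singleton_pow, Ideal.mem_span_singleton]
      simp only [coeff_sub, coeff_X_pow, coeff_C]
      norm_num
      rw [sq]
      intro h
      exact hqp.not_isUnit (hsf q h)
  have hirrQ : Irreducible (X ^ 12 - C (m : ℚ) : ℚ[X]) := by
    have := (Monic.irreducible_iff_irreducible_map_fraction_map (K := ℚ) hmon).1 hirr
    simpa using this
  symm
  apply minpoly.eq_of_irreducible_of_monic hirrQ
  · simp [hroot]
  · exact monic_X_pow_sub_C _ (by norm_num)

lemma exists_algHom_gen (F K L : Type*) [Field F] [Field K] [Field L] [Algebra F K] [Algebra F L]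
    (α : K) (hintg : IsIntegral F α) (hgen : IntermediateField.adjoin F {α} = ⊤) (x : L)
    (hx : aeval x (minpoly F α) = 0) : ∃ σ : K →ₐ[F] L, σ α = x := by
  let ψ : IntermediateField.adjoin F {α} →ₐ[F] L :=
    (IntermediateField.algHomAdjoinIntegralEquiv F hintg).symm ⟨x, by
      rw [mem_aroots]; exact ⟨minpoly.ne_zero hintg, hx⟩⟩
  have hψ : ψ (IntermediateField.AdjoinSimple.gen F α) = x :=
    IntermediateField.algHomAdjoinIntegralEquiv_symm_apply_gen F hintg _
  refine ⟨ψ.comp ((IntermediateField.equivOfEq hgen).symm.toAlgHom.comp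
    IntermediateField.topEquiv.symm.toAlgHom), ?_⟩
  rw [← hψ]; rfl

lemma exists_hom (m : ℤ) (hsf : Squarefree m)
    (h1 : m ≠ 1) (h2 : m ≠ -1)
    (K : Type*) [Field K] [NumberField K] (α : K)
    (hroot : α ^ 12 = (m : K))
    (hgen : IntermediateField.adjoin ℚ {α} = ⊤)
    (V : Type*) [CommRing V] [IsDomain V] [CharZero V] [IsIntegrallyClosed V]
    (x : V) (hx : x ^ 12 = (m : V)) (a : 𝓞 K) (ha : (a : K) = α) :
    ∃ Φ : 𝓞 K →+* V, Φ a = x := by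
  have hmin := minpoly_alpha m hsf h1 h2 K α hroot
  let L := FractionRing V
  have : CharZero L := charZero_of_injective_algebraMap (IsFractionRing.injective V L)
  have hintg : IsIntegral ℚ α := Algebra.IsIntegral.isIntegral α
  let xL : L := algebraMap V L x
  have hxL : xL ^ 12 = (m : L) := by
    simp only [xL]; rw [← map_pow, hx]; simp
  obtain ⟨σ, hσ⟩ : ∃ σ : K →+* L, σ α = xL := by
    let _ : Algebra ℚ L := DivisionRing.toRatAlgebra
    obtain ⟨σ, hσ⟩ := exists_algHom_gen ℚ K L α hintg hgen xL (by rw [hmin]; simp [hxL])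
    exact ⟨σ.toRingHom, hσ⟩
  have key : ∀ z : 𝓞 K, ∃ y : V, algebraMap V L y = σ z := by
    intro z
    apply IsIntegrallyClosed.isIntegral_iff.1
    have h1 : IsIntegral ℤ (z : K) := z.isIntegral_coe
    obtain ⟨f, hf, he⟩ := h1
    refine ⟨f.map (Int.castRingHom V), hf.map _, ?_⟩
    have h3 := congrArg σ he
    rw [hom_eval₂, map_zero] at h3
    rw [eval₂_map, ← h3]
    congr 1
    exact RingHom.ext_int _ _
  choose F hF using key
  have inj : Function.Injective (algebraMap V L) := IsFractionRing.injective V L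
  refine ⟨{ toFun := F, map_one' := ?_, map_mul' := ?_, map_zero' := ?_, map_add' := ?_ }, ?_⟩
  · apply inj; rw [hF]; simp
  · intro u v; apply inj; rw [map_mul, hF, hF, hF]; simp
  · apply inj; rw [hF]; simp
  · intro u v; apply inj; rw [map_add, hF, hF, hF]; simp
  · apply inj; change algebraMap V L (F a) = _; rw [hF, ha, hσ]

/-- data of a henselian DVR with uniformizer `p` -/
structure HD (p : ℕ) (W k : Type*) [CommRing W] [Field k] (res : W →+* k) : Prop where
  surj : Function.Surjective res
  ker : ∀ w, res w = 0 ↔ (p : W) ∣ w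
  unit : ∀ w, res w ≠ 0 → IsUnit w
  hens : ∀ f : W[X], f.Monic → ∀ a : k, (f.map res).eval a = 0 →
    (f.map res).derivative.eval a ≠ 0 → ∃ b : W, f.eval b = 0 ∧ res b = a

lemma witt_HD (p : ℕ) [Fact p.Prime] (k : Type*) [Field k] [CharP k p] [PerfectRing k p] :
    HD p (WittVector p k) k WittVector.constantCoeff := by
  have hk : ∀ w : WittVector p k, WittVector.constantCoeff w = 0 ↔ (p : WittVector p k) ∣ w := by
    intro w
    rw [← Ideal.mem_span_singleton, WittVector.mem_span_p_iff_coeff_zero_eq_zero]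
    rfl
  have hs := WittVector.constantCoeff_surjective (R := k) p
  refine ⟨hs, hk, fun w hw => WittVector.isUnit_of_coeff_zero_ne_zero _ hw, ?_⟩
  intro f hf a h0 h1
  obtain ⟨a, rfl⟩ := hs a
  rw [eval_map_apply] at h0
  rw [derivative_map, eval_map_apply] at h1
  obtain ⟨b, hb, hba⟩ := HenselianRing.is_henselian (I := Ideal.span {(p : WittVector p k)}) f hf a
    (by rwa [Ideal.mem_span_singleton, ← hk]) (by
      apply IsUnit.map
      exact WittVector.isUnit_of_coeff_zero_ne_zero _ h1)
  refine ⟨b, hb, ?_⟩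
  rw [Ideal.mem_span_singleton, ← hk, map_sub, sub_eq_zero] at hba
  exact hba

lemma witt_charZero (p : ℕ) [Fact p.Prime] (k : Type*) [Field k] [CharP k p] [PerfectRing k p] :
    CharZero (WittVector p k) := by
  have hp : (p : WittVector p k) ≠ 0 := (WittVector.irreducible p).ne_zero
  obtain ⟨q, hq⟩ := CharP.exists (WittVector p k)
  rcases CharP.char_is_prime_or_zero (WittVector p k) q with h | h
  · exfalso
    have h1 : ((q : ℕ) : k) = 0 := by
      have : ((q : ℕ) : WittVector p k) = 0 := CharP.cast_eq_zero _ q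
      have h3 := congrArg WittVector.constantCoeff this
      rwa [map_natCast, map_zero] at h3
    rw [CharP.cast_eq_zero_iff k p] at h1
    have h4 : p = q := (Nat.prime_dvd_prime_iff_eq Fact.out h).1 h1
    apply hp
    have h5 : ((q : ℕ) : WittVector p k) = 0 := CharP.cast_eq_zero _ q
    rwa [← congrArg (fun n : ℕ => (n : WittVector p k)) h4] at h5
  · subst h
    exact CharP.charP_to_charZero _

/-- quadratic Eisenstein extension -/
lemma exists_quad (p : ℕ) (W k : Type) [CommRing W] [IsDomain W] [IsDiscreteValuationRing W]
    [CharZero W] [Field k] (res : W →+* k) (H : HD p W k res) (hp : Prime (p : W)) (a b : W)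
    (ha : (p : W) ∣ a) (hb : Associated (p : W) b) :
    ∃ (V : Type) (_ : CommRing V) (_ : IsDomain V) (_ : CharZero V) (_ : IsIntegrallyClosed V)
      (i : W →+* V) (ρ : V →+* k) (π : V), (∀ w, ρ (i w) = res w) ∧ ρ π = 0 ∧
        π ^ 2 + i a * π + i b = 0 := by
  let P : W[X] := X ^ 2 + C a * X + C b
  have hdeg : P.natDegree = 2 := by simp only [P]; compute_degree!
  have hmon : P.Monic := by simp only [P]; monicity!
  have hirr : Irreducible P := by
    refine IsEisensteinAt.irreducible (𝓟 := Ideal.span {(p : W)}) ?_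
      ((Ideal.span_singleton_prime hp.ne_zero).2 hp) hmon.isPrimitive (by rw [hdeg]; norm_num)
    refine ⟨?_, ?_, ?_⟩
    · rw [hmon.leadingCoeff, Ideal.mem_span_singleton]
      exact fun h => hp.not_isUnit (isUnit_of_dvd_one h)
    · intro n hn
      rw [hdeg] at hn
      rw [Ideal.mem_span_singleton]
      interval_cases n
      · simpa [P] using hb.dvd
      · simpa [P, coeff_X, coeff_C] using ha
    · rw [Ideal.span_singleton_pow, Ideal.mem_span_singleton]
      simp only [P, coeff_add, coeff_X_pow, coeff_C]
      norm_num
      intro h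
      have := h.trans hb.symm.dvd
      rw [sq] at this
      exact hp.not_isUnit (isUnit_of_dvd_one ((mul_dvd_mul_iff_left hp.ne_zero).1 (by simpa using this)))
  have hprime : Prime P := hirr.prime
  let V := AdjoinRoot P
  have hdom : IsDomain V := AdjoinRoot.isDomain_of_prime hprime
  have hinj : Function.Injective (algebraMap W V) := by
    apply AdjoinRoot.of.injective_of_degree_ne_zero
    rw [degree_eq_natDegree hmon.ne_zero, hdeg]; norm_num
  have hcz : CharZero V := charZero_of_injective_algebraMap hinj
  let i : W →+* V := algebraMap W V
  let π : V := AdjoinRoot.root P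
  have hra : res a = 0 := (H.ker a).2 ha
  have hrb : res b = 0 := (H.ker b).2 hb.dvd
  let ρ : V →+* k := AdjoinRoot.lift res 0 (by simp [P, hra, hrb])
  have hρi : ∀ w, ρ (i w) = res w := fun w => AdjoinRoot.lift_of _
  have hρπ : ρ π = 0 := AdjoinRoot.lift_root _
  have hπ : π ^ 2 + i a * π + i b = 0 := by
    have := AdjoinRoot.eval₂_root P
    have h2 : P.eval₂ (AdjoinRoot.of P) (AdjoinRoot.root P) = π ^ 2 + i a * π + i b := by
      simp only [P, eval₂_add, eval₂_mul, eval₂_pow, eval₂_X, eval₂_C]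
      rfl
    rw [← h2]; exact this
  have : Module.Finite W V := hmon.finite_adjoinRoot
  have hnoeth : IsNoetherianRing V := by
    exact IsNoetherianRing.of_finite W V
  have hρs : Function.Surjective ρ := fun y => by
    obtain ⟨w, rfl⟩ := H.surj y
    exact ⟨i w, hρi w⟩
  have hpπ : π ∣ i p := by
    have : π ∣ i b := ⟨-(π + i a), by linear_combination hπ⟩
    exact this.trans (map_dvd i hb.symm.dvd)
  have hform : ∀ v : V, ∃ w v', v = i w + π * v' := by
    intro v
    induction v using AdjoinRoot.induction_on with
    | ih f =>
      refine ⟨f.coeff 0, AdjoinRoot.mk P f.divX, ?_⟩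
      conv_lhs => rw [← Polynomial.X_mul_divX_add f]
      simp only [map_add, map_mul, AdjoinRoot.mk_X, AdjoinRoot.mk_C]
      rw [add_comm]; rfl
  have hker : RingHom.ker ρ = Ideal.span {π} := by
    ext v
    rw [RingHom.mem_ker, Ideal.mem_span_singleton]
    constructor
    · intro h
      obtain ⟨w, v', rfl⟩ := hform v
      rw [map_add, map_mul, hρπ, zero_mul, add_zero, hρi, H.ker] at h
      exact dvd_add (hpπ.trans (map_dvd i h)) (dvd_mul_right _ _)
    · rintro ⟨v', rfl⟩
      rw [map_mul, hρπ, zero_mul]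
  have hmax : (RingHom.ker ρ).IsMaximal := RingHom.ker_isMaximal_of_surjective ρ hρs
  have huniq : ∀ M : Ideal V, M.IsMaximal → M = RingHom.ker ρ := by
    intro M hM
    symm
    apply hmax.eq_of_le hM.ne_top
    rw [hker, Ideal.span_singleton_le_iff_mem]
    have h1 : (M.comap (algebraMap W V)).IsMaximal :=
      Ideal.isMaximal_comap_of_isIntegral_of_isMaximal M
    have h2 := IsLocalRing.eq_maximalIdeal h1
    have h3 : ∀ w : W, (p : W) ∣ w → i w ∈ M := by
      intro w hw
      have : w ∈ M.comap (algebraMap W V) := by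
        rw [h2, IsLocalRing.mem_maximalIdeal]
        exact fun hu => hp.not_isUnit (isUnit_of_dvd_unit hw hu)
      exact this
    have h4 : π ^ 2 ∈ M := by
      have : π ^ 2 = -(i a * π + i b) := by linear_combination hπ
      rw [this]
      exact M.neg_mem (M.add_mem (M.mul_mem_right _ (h3 a ha)) (h3 b hb.dvd))
    exact hM.isPrime.mem_of_pow_mem 2 h4
  have hloc : IsLocalRing V := IsLocalRing.of_unique_max_ideal ⟨_, hmax, huniq⟩
  have hmi : IsLocalRing.maximalIdeal V = Ideal.span {π} := by
    rw [← hker]; exact huniq _ inferInstance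
  have hprin : (IsLocalRing.maximalIdeal V).IsPrincipal := ⟨⟨π, hmi⟩⟩
  have hpid : IsPrincipalIdealRing V :=
    ((tfae_of_isNoetherianRing_of_isLocalRing_of_isDomain V).out 4 0).1 hprin
  have hic : IsIntegrallyClosed V := inferInstance
  exact ⟨V, inferInstance, hdom, hcz, hic, i, ρ, π, hρi, hρπ, hπ⟩

/-- homomorphisms out of `R` prescribed at `a` -/
def Lifts (R : Type*) [CommRing R] (a : R) (m : ℤ) : Prop :=
  ∀ (V : Type) [CommRing V] [IsDomain V] [CharZero V] [IsIntegrallyClosed V] (x : V),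
    x ^ 12 = (m : V) → ∃ Φ : R →+* V, Φ a = x

lemma three_case {R : Type*} [CommRing R] (a : R) (m : ℤ) (hL : Lifts R a m) (ε n : ℤ)
    (hε : ε ^ 2 = 1) (hm : m = ε * (1 + 9 * n)) (η : R)
    (hη : 3 * η = 1 + ε * a ^ 4 + (ε * a ^ 4) ^ 2)
    (W k : Type) [CommRing W] [IsDomain W] [IsDiscreteValuationRing W]
    [CharZero W] [Field k] (res : W →+* k) (H : HD 3 W k res) (hp : Prime (3 : W))
    (s : k) (hs : s ^ 4 = ε) :
    (∃ φ : R →+* k, φ a = s ∧ φ η = 1) ∧ (∃ φ : R →+* k, φ a = s ∧ φ η = 0) := by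
  have h3 : (3 : k) = 0 := by
    have := (H.ker 3).2 (by norm_num)
    rwa [map_ofNat] at this
  have hεk : (ε : k) ^ 2 = 1 := by exact_mod_cast congrArg (Int.cast : ℤ → k) hε
  have hεW : (ε : W) ^ 2 = 1 := by exact_mod_cast congrArg (Int.cast : ℤ → W) hε
  have hs0 : s ≠ 0 := by
    rintro rfl
    rw [← hs] at hεk
    norm_num at hεk
  obtain ⟨η0, hη0, hη1⟩ := H.hens (X ^ 3 - X ^ 2 - C (3 * n : W) * X - C (3 * n ^ 2 : W))
    (by monicity!) 1 (by simp [map_ofNat, h3]) (by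
      simp only [Polynomial.map_sub, Polynomial.map_mul, Polynomial.map_pow, map_X, map_C,
        derivative_sub, derivative_mul, derivative_X_pow, derivative_C, derivative_X, map_mul]
      simp [map_ofNat, h3]
      intro h
      have : (1 : k) = 0 := by linear_combination h3 - h
      exact one_ne_zero this)
  simp only [eval_sub, eval_mul, eval_pow, eval_X, eval_C] at hη0
  have hu : IsUnit η0 := H.unit _ (by rw [hη1]; exact one_ne_zero)
  obtain ⟨t, ht⟩ : ∃ t, t * η0 = (n : W) := by
    obtain ⟨u, rfl⟩ := hu
    exact ⟨n * (u⁻¹ : Wˣ), by simp⟩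
  have hη2 : η0 = 1 + 3 * t + 3 * t ^ 2 := by
    have : η0 ^ 2 * (η0 - (1 + 3 * t + 3 * t ^ 2)) = 0 := by
      rw [← ht] at hη0
      linear_combination hη0
    rcases mul_eq_zero.1 this with h | h
    · exact absurd (pow_eq_zero_iff (by norm_num) |>.1 h) hu.ne_zero
    · exact sub_eq_zero.1 h
  let v := 1 + 3 * t
  have hv : v ^ 3 = 1 + 9 * n := by
    simp only [v]; rw [← ht, hη2]; ring
  have hrv : res v = 1 := by simp [map_ofNat, v, h3]
  obtain ⟨A, hA, hAs⟩ := H.hens (X ^ 4 - C (ε * v : W)) (by monicity!) s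
    (by simp [map_ofNat, hrv, hs]) (by
      simp only [Polynomial.map_sub, Polynomial.map_pow, map_X, map_C,
        derivative_sub, derivative_X_pow, derivative_C]
      simp
      refine ⟨?_, hs0⟩
      intro h
      have : (1 : k) = 0 := by linear_combination h - h3
      exact one_ne_zero this)
  simp only [eval_sub, eval_pow, eval_X, eval_C] at hA
  have hA4 : A ^ 4 = ε * v := sub_eq_zero.1 hA
  have hA12 : A ^ 12 = (m : W) := by
    have : A ^ 12 = (A ^ 4) ^ 3 := by ring
    rw [this, hA4, mul_pow, hv, hm]; push_cast
    linear_combination (ε : W) * (1 + 9 * n) * hεW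
  have hεA : ε * A ^ 4 = v := by rw [hA4]; linear_combination v * hεW
  constructor
  · obtain ⟨Φ, hΦ⟩ := hL W A hA12
    refine ⟨res.comp Φ, by simp [map_ofNat, hΦ, hAs], ?_⟩
    have h1 := congrArg Φ hη
    simp only [map_mul, map_add, map_pow, map_one, map_intCast, hΦ, hεA, map_ofNat] at h1
    have h2 : Φ η = η0 := by
      apply mul_left_cancel₀ (by norm_num : (3 : W) ≠ 0)
      rw [h1, hη2]; simp only [v]; ring
    simp [map_ofNat, h2, hη1]
  · obtain ⟨V, _, _, _, _, i, ρ, π, hρ, hρπ, hπ⟩ := exists_quad 3 W k res H (by exact_mod_cast hp)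
      3 3 (by norm_num) (by norm_num)
    rw [map_ofNat] at hπ
    let ω := 1 + π
    have hω : 1 + ω + ω ^ 2 = 0 := by simp only [ω]; linear_combination hπ
    have hω3 : ω ^ 3 = 1 := by linear_combination (ω - 1) * hω
    have hρω : ρ ω = 1 := by simp [map_ofNat, ω, hρπ]
    obtain ⟨Φ, hΦ⟩ := hL V (i A * ω) (by
      have h5 : (ω ^ 12 : V) = 1 := by
        rw [show ω ^ 12 = (ω ^ 3) ^ 4 by ring, hω3]; ring
      rw [mul_pow, ← map_pow, hA12, h5]; simp)
    refine ⟨ρ.comp Φ, by simp [map_ofNat, hΦ, hρ, hAs, hρω], ?_⟩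
    have h1 := congrArg Φ hη
    simp only [map_mul, map_add, map_pow, map_one, map_intCast, hΦ, map_ofNat] at h1
    have h6 : (ε : V) * (i A * ω) ^ 4 = i v * ω := by
      rw [← hεA, map_mul, map_pow, map_intCast]
      linear_combination (ε * i A ^ 4 * ω : V) * hω3
    rw [h6] at h1
    have h2 : Φ η = i t * ω + (2 * i t + 3 * i t ^ 2) * ω ^ 2 := by
      apply mul_left_cancel₀ (by norm_num : (3 : V) ≠ 0)
      rw [h1]; simp only [v, map_add, map_mul, map_one, map_ofNat]
      linear_combination hω
    simp [map_ofNat, h2, hρω, hρ]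
    linear_combination (res t + res t ^ 2) * h3

lemma two_case_five {R : Type*} [CommRing R] (a : R) (m : ℤ) (hL : Lifts R a m) (n : ℤ)
    (hm : m = 1 + 4 * (2 * n + 1)) (β : R) (hβ : 2 * β = 1 + a ^ 6)
    (W k : Type) [CommRing W] [IsDomain W] [IsDiscreteValuationRing W]
    [CharZero W] [Field k] (res : W →+* k) (H : HD 2 W k res) (hp : Prime (2 : W))
    (s : k) (hs : s ^ 2 + s + 1 = 0) (z : k) (hz : z ^ 2 + z = 1) :
    ∃ φ : R →+* k, φ a = s ∧ φ β = 1 + z := by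
  have h2 : (2 : k) = 0 := by
    have := (H.ker 2).2 (by norm_num)
    rwa [map_ofNat] at this
  have hone : ∀ x : k, 2 * x + 1 ≠ 0 := fun x h => one_ne_zero (α := k) (by
    linear_combination h - x * h2)
  obtain ⟨c, hc, hcz⟩ := H.hens (X ^ 2 + X - C (2 * n + 1 : W)) (by monicity!) z
    (by simp [map_ofNat, h2, hz]) (by
      simp only [Polynomial.map_sub, Polynomial.map_add, Polynomial.map_pow, map_X, map_C,
        derivative_sub, derivative_add, derivative_X_pow, derivative_C, derivative_X]
      simpa using hone z)
  simp only [eval_sub, eval_add, eval_pow, eval_X, eval_C] at hc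
  obtain ⟨Z, hZ, hZs⟩ := H.hens (X ^ 2 + X + C (1 : W)) (by monicity!) s
    (by simp [map_ofNat, hs]) (by
      simp only [Polynomial.map_add, Polynomial.map_pow, map_X, map_C,
        derivative_add, derivative_X_pow, derivative_C, derivative_X]
      simpa using hone s)
  simp only [eval_add, eval_pow, eval_X, eval_C] at hZ
  have hZ3 : Z ^ 3 = 1 := by linear_combination (Z - 1) * hZ
  have hrm : res m = 1 := by
    rw [hm]; push_cast; simp only [map_add, map_mul, map_one, map_ofNat, map_intCast]
    linear_combination (4 * n + 2) * h2
  obtain ⟨mi, hmi⟩ : ∃ mi : W, m * mi = 1 :=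
    (H.unit m (by rw [hrm]; exact one_ne_zero)).exists_right_inv
  have hrmi : res mi = 1 := by
    have := congrArg res hmi
    rwa [map_mul, hrm, one_mul, map_one] at this
  obtain ⟨r, hr, hr1⟩ := H.hens (X ^ 3 - C (mi ^ 2)) (by monicity!) 1
    (by simp [map_ofNat, hrmi]) (by
      simp only [Polynomial.map_sub, Polynomial.map_pow, map_X, map_C,
        derivative_sub, derivative_X_pow, derivative_C]
      have := hone 1
      simp
      intro h
      apply this
      linear_combination h)
  simp only [eval_sub, eval_pow, eval_X, eval_C] at hr
  have hr3 : r ^ 3 = mi ^ 2 := sub_eq_zero.1 hr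
  have hz0 : z ≠ 0 := by rintro rfl; norm_num at hz
  have huc : IsUnit (-c) := H.unit _ (by rw [map_neg, hcz]; exact neg_ne_zero.2 hz0)
  obtain ⟨V, _, _, _, _, i, ρ, π, hρ, hρπ, hπ⟩ := exists_quad 2 W k res H (by exact_mod_cast hp)
      2 (2 * (-c)) (by norm_num) (by
        obtain ⟨u, hu⟩ := huc
        exact ⟨u, by rw [hu]; norm_num⟩)
  simp only [map_ofNat, map_mul, map_neg] at hπ
  let g := 1 + π
  have hρg : ρ g = 1 := by simp [map_ofNat, g, hρπ]
  have hg2 : g ^ 2 = 1 + 2 * i c := by simp only [g]; linear_combination hπ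
  have hic : i c ^ 2 + i c = 2 * n + 1 := by
    have := congrArg i hc
    simp only [map_sub, map_add, map_mul, map_pow, map_ofNat, map_intCast, map_one, map_zero] at this
    linear_combination this
  have hg4 : g ^ 4 = m := by
    rw [show g ^ 4 = (g ^ 2) ^ 2 by ring, hg2, hm]; push_cast
    linear_combination 4 * hic
  have himi : (m : V) * i mi = 1 := by
    have := congrArg i hmi
    simpa using this
  have hx3 : (i Z * i r * g ^ 3) ^ 3 = i mi ^ 2 * g ^ 9 := by
    have e1 : i Z ^ 3 = 1 := by rw [← map_pow, hZ3, map_one]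
    have e2 : i r ^ 3 = i mi ^ 2 := by rw [← map_pow, hr3, map_pow]
    rw [mul_pow, mul_pow, e1, e2]; ring
  have hx3' : (i Z * i r * g ^ 3) ^ 3 = g := by
    rw [hx3, show i mi ^ 2 * g ^ 9 = i mi ^ 2 * (g ^ 4) ^ 2 * g by ring, hg4]
    linear_combination g * (m * i mi + 1) * himi
  obtain ⟨Φ, hΦ⟩ := hL V (i Z * i r * g ^ 3) (by
    rw [show (i Z * i r * g ^ 3) ^ 12 = ((i Z * i r * g ^ 3) ^ 3) ^ 4 by ring, hx3', hg4])
  refine ⟨ρ.comp Φ, by simp [map_ofNat, hΦ, hρ, hZs, hr1, hρg], ?_⟩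
  have h1 := congrArg Φ hβ
  simp only [map_mul, map_add, map_pow Φ, map_one, hΦ, map_ofNat] at h1
  rw [show (i Z * i r * g ^ 3) ^ 6 = ((i Z * i r * g ^ 3) ^ 3) ^ 2 by ring, hx3', hg2] at h1
  have h4 : Φ β = 1 + i c := by
    apply mul_left_cancel₀ (two_ne_zero : (2 : V) ≠ 0)
    rw [h1]; ring
  simp [map_ofNat, h4, hρ, hcz]

lemma two_case_one {R : Type*} [CommRing R] (a : R) (m : ℤ) (hL : Lifts R a m) (n : ℤ)
    (hm : m = 1 + 8 * n) (δ : R) (hδ : 4 * δ = (1 + a ^ 3) * (1 + a ^ 6))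
    (W k : Type) [CommRing W] [IsDomain W] [IsDiscreteValuationRing W]
    [CharZero W] [Field k] (res : W →+* k) (H : HD 2 W k res)
    (s : k) (hs : s ^ 2 + s + 1 = 0) (z : k) (hz : z ^ 2 + z = n) :
    ∃ φ : R →+* k, φ a = s ∧ φ δ = 1 + z := by
  have h2 : (2 : k) = 0 := by
    have := (H.ker 2).2 (by norm_num)
    rwa [map_ofNat] at this
  have hone : ∀ x : k, 2 * x + 1 ≠ 0 := fun x h => one_ne_zero (α := k) (by
    linear_combination h - x * h2)
  obtain ⟨c, hc, hc0⟩ := H.hens (X ^ 2 + X - C (2 * n : W)) (by monicity!) 0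
    (by simp [map_ofNat, h2]) (by
      simp only [Polynomial.map_sub, Polynomial.map_add, Polynomial.map_pow, map_X, map_C,
        derivative_sub, derivative_add, derivative_X_pow, derivative_C, derivative_X]
      simp)
  simp only [eval_sub, eval_add, eval_pow, eval_X, eval_C] at hc
  obtain ⟨d, hd⟩ := (H.ker c).1 hc0
  push_cast at hd
  have hdn : d = n - 2 * d ^ 2 := by
    apply mul_left_cancel₀ (two_ne_zero : (2 : W) ≠ 0)
    rw [hd] at hc
    linear_combination hc
  have hrd : res d = n := by
    rw [hdn]; simp [map_ofNat, h2]
  obtain ⟨y, hy, hyz⟩ := H.hens (X ^ 2 + X - C d) (by monicity!) z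
    (by simp [map_ofNat, hrd, hz]) (by
      simp only [Polynomial.map_sub, Polynomial.map_add, Polynomial.map_pow, map_X, map_C,
        derivative_sub, derivative_add, derivative_X_pow, derivative_C, derivative_X]
      simpa using hone z)
  simp only [eval_sub, eval_add, eval_pow, eval_X, eval_C] at hy
  let g := 1 + 2 * y
  have hrg : res g = 1 := by simp [map_ofNat, g, h2]
  have hg2 : g ^ 2 = 1 + 4 * d := by simp only [g]; linear_combination 4 * hy
  have hg4 : g ^ 4 = m := by
    rw [show g ^ 4 = (g ^ 2) ^ 2 by ring, hg2, hm]; push_cast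
    linear_combination 8 * hdn
  have hs0 : s ≠ 0 := by rintro rfl; norm_num at hs
  obtain ⟨x, hx, hxs⟩ := H.hens (X ^ 3 - C g) (by monicity!) s
    (by simp [map_ofNat, hrg]; linear_combination (s - 1) * hs) (by
      simp only [Polynomial.map_sub, Polynomial.map_pow, map_X, map_C,
        derivative_sub, derivative_X_pow, derivative_C]
      simp [map_ofNat, hs0]
      intro h
      apply hone 1
      linear_combination h)
  simp only [eval_sub, eval_pow, eval_X, eval_C] at hx
  have hx3 : x ^ 3 = g := sub_eq_zero.1 hx
  obtain ⟨Φ, hΦ⟩ := hL W x (by rw [show x ^ 12 = (x ^ 3) ^ 4 by ring, hx3, hg4])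
  refine ⟨res.comp Φ, by simp [map_ofNat, hΦ, hxs], ?_⟩
  have h1 := congrArg Φ hδ
  simp only [map_mul, map_add, map_pow Φ, map_one, hΦ, map_ofNat] at h1
  rw [show x ^ 6 = (x ^ 3) ^ 2 by ring, hx3, hg2] at h1
  have h4 : Φ δ = (1 + y) * (1 + 2 * d) := by
    apply mul_left_cancel₀ (by norm_num : (4 : W) ≠ 0)
    rw [h1]; simp only [g]; ring
  simp [map_ofNat, h4, hyz, h2]

lemma hom_eq {R k : Type*} [CommRing R] [Field k] (θ : R) (hθ : Algebra.adjoin ℤ {θ} = ⊤)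
    (φ ψ : R →+* k) (h : φ θ = ψ θ) : φ = ψ := by
  have : φ.toIntAlgHom = ψ.toIntAlgHom := by
    apply AlgHom.ext_of_adjoin_eq_top hθ
    intro x hx
    rw [Set.mem_singleton_iff] at hx
    subst hx
    exact h
  ext x
  exact congrArg (fun f : R →ₐ[ℤ] k => f x) this

lemma count_le {R k I J : Type*} [CommRing R] [Field k] [Finite k] [Fintype I] [Fintype J]
    (θ : R) (hθ : Algebra.adjoin ℤ {θ} = ⊤) (a b : R) (s : I → k) (t : J → k)
    (hs : Function.Injective s) (ht : Function.Injective t)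
    (h : ∀ i j, ∃ φ : R →+* k, φ a = s i ∧ φ b = t j) :
    Fintype.card I * Fintype.card J ≤ Nat.card k := by
  choose Φ h1 h2 using h
  have hinj : Function.Injective (fun x : I × J => Φ x.1 x.2 θ) := by
    rintro ⟨i, j⟩ ⟨i', j'⟩ hh
    have e := hom_eq θ hθ _ _ hh
    have e1 : s i = s i' := by rw [← h1 i j, ← h1 i' j', e]
    have e2 : t j = t j' := by rw [← h2 i j, ← h2 i' j', e]
    rw [hs e1, ht e2]
  have := Nat.card_le_card_of_injective _ hinj
  simpa using this

lemma count_le' {R k I J : Type*} [CommRing R] [Field k] [Finite k] [Fintype I] [Fintype J]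
    (p : ℕ) [Fact p.Prime] [CharP k p]
    (θ : R) (hθ : Algebra.adjoin ℤ {θ} = ⊤) (a b : R) (s : I → k) (t : J → k)
    (hs : Function.Injective s) (ht : Function.Injective t) (hsp : ∀ i, s i ^ p ≠ s i)
    (h : ∀ i j, ∃ φ : R →+* k, φ a = s i ∧ φ b = t j) :
    Fintype.card I * Fintype.card J + 2 ≤ Nat.card k := by
  choose Φ h1 h2 using h
  have hinj : Function.Injective (fun x : I × J => Φ x.1 x.2 θ) := by
    rintro ⟨i, j⟩ ⟨i', j'⟩ hh
    have e := hom_eq θ hθ _ _ hh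
    have e1 : s i = s i' := by rw [← h1 i j, ← h1 i' j', e]
    have e2 : t j = t j' := by rw [← h2 i j, ← h2 i' j', e]
    rw [hs e1, ht e2]
  have hfix : ∀ i j, Φ i j θ ^ p ≠ Φ i j θ := by
    intro i j hh
    have e := hom_eq θ hθ ((frobenius k p).comp (Φ i j)) (Φ i j) (by simpa [frobenius_def] using hh)
    apply hsp i
    rw [← h1 i j]
    conv_rhs => rw [← e]
    simp [frobenius_def]
  have hp0 : p ≠ 0 := (Fact.out : p.Prime).ne_zero
  let f : Option (Option (I × J)) → k := fun o => match o with
    | none => 0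
    | some none => 1
    | some (some x) => Φ x.1 x.2 θ
  have hf : Function.Injective f := by
    have n0 : ∀ x : I × J, Φ x.1 x.2 θ ≠ 0 := fun x hx => hfix x.1 x.2 (by rw [hx]; simp [hp0])
    have n1 : ∀ x : I × J, Φ x.1 x.2 θ ≠ 1 := fun x hx => hfix x.1 x.2 (by rw [hx]; simp)
    rintro (_ | _ | x) (_ | _ | y) hxy
    · rfl
    · exact absurd hxy zero_ne_one
    · exact absurd hxy.symm (n0 y)
    · exact absurd hxy one_ne_zero
    · rfl
    · exact absurd hxy.symm (n1 y)
    · exact absurd hxy (n0 x)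
    · exact absurd hxy (n1 x)
    · rw [hinj hxy]
  have hc := Nat.card_le_card_of_injective _ hf
  simp only [Finite.card_option, Nat.card_prod, Nat.card_eq_fintype_card (α := I),
    Nat.card_eq_fintype_card (α := J)] at hc
  exact hc

lemma not_mono_two {R k : Type*} [CommRing R] [Field k] [Finite k] [CharP k 2]
    (hcard : Nat.card k = 4) (a b θ : R) (hθ : Algebra.adjoin ℤ {θ} = ⊤) (n : ℤ)
    (h : ∀ s z : k, s ^ 2 + s + 1 = 0 → z ^ 2 + z = n →
      ∃ φ : R →+* k, φ a = s ∧ φ b = 1 + z) : False := by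
  classical
  have h2 : (2 : k) = 0 := by exact_mod_cast CharP.cast_eq_zero k 2
  obtain ⟨w, hw⟩ : ∃ w : k, w ^ 2 + w + 1 = 0 := by
    have : Fintype k := Fintype.ofFinite k
    rw [Nat.card_eq_fintype_card] at hcard
    obtain ⟨w, hw⟩ : ∃ w : k, w ∉ ({0, 1} : Finset k) := by
      by_contra hcon
      push Not at hcon
      have h5 : (Finset.univ : Finset k) ⊆ {0, 1} := fun x _ => hcon x
      have h6 := Finset.card_le_card h5
      have h7 : Finset.card ({0, 1} : Finset k) ≤ 2 := Finset.card_le_two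
      rw [Finset.card_univ, hcard] at h6
      omega
    simp only [Finset.mem_insert, Finset.mem_singleton, not_or] at hw
    have h3 := FiniteField.pow_card_sub_one_eq_one w hw.1
    rw [hcard] at h3
    have h8 : (w - 1) * (w ^ 2 + w + 1) = 0 := by
      norm_num at h3
      linear_combination h3
    rcases mul_eq_zero.1 h8 with h | h
    · exact absurd (sub_eq_zero.1 h) hw.2
    · exact ⟨w, h⟩
  obtain ⟨z, hz⟩ : ∃ z : k, z ^ 2 + z = n := by
    rcases Int.even_or_odd' n with ⟨r, rfl | rfl⟩
    · exact ⟨0, by push_cast; linear_combination -(r : k) * h2⟩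
    · exact ⟨w, by push_cast; linear_combination hw - (r + 1 : k) * h2⟩
  have hinj : ∀ x : k, Function.Injective (fun i : Bool => if i then x else x + 1) := by
    intro x i j hij
    cases i <;> cases j <;> simp at hij ⊢
  have hsr : ∀ i : Bool, (if i then w else w + 1) ^ 2 + (if i then w else w + 1) + 1 = 0 := by
    intro i; cases i <;> simp
    · linear_combination hw + (w + 1) * h2
    · exact hw
  have := count_le' (k := k) 2 θ hθ a b (fun i : Bool => if i then w else w + 1)
    (fun i : Bool => 1 + if i then z else z + 1) (hinj w)
    ((add_right_injective (1 : k)).comp (hinj z)) (by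
      intro i hi
      have h4 := hsr i
      beta_reduce at hi
      rw [hi] at h4
      refine one_ne_zero (α := k) ?_
      linear_combination h4 - (if i then w else w + 1) * h2) (by
      intro i j
      refine h _ _ (hsr i) ?_
      cases j <;> simp
      · linear_combination hz + (z + 1) * h2
      · exact hz)
  rw [hcard] at this
  simp at this

lemma not_mono_three_pos {R : Type*} [CommRing R] (a b θ : R) (hθ : Algebra.adjoin ℤ {θ} = ⊤)
    (h : ∀ s : ZMod 3, s ^ 4 = 1 → (∃ φ : R →+* ZMod 3, φ a = s ∧ φ b = 1) ∧
      (∃ φ : R →+* ZMod 3, φ a = s ∧ φ b = 0)) : False := by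
  have := count_le (k := ZMod 3) θ hθ a b (fun i : Bool => if i then 1 else 2)
    (fun i : Bool => if i then 1 else 0) (by decide) (by decide) (by
      intro i j
      have := h (if i then 1 else 2) (by cases i <;> decide)
      cases j
      · exact this.2
      · exact this.1)
  simp at this

lemma not_mono_three_neg {R k : Type*} [CommRing R] [Field k] [Finite k] [CharP k 3]
    (hcard : Nat.card k = 9) (a b θ : R) (hθ : Algebra.adjoin ℤ {θ} = ⊤)
    (h : ∀ s : k, s ^ 4 = -1 → (∃ φ : R →+* k, φ a = s ∧ φ b = 1) ∧
      (∃ φ : R →+* k, φ a = s ∧ φ b = 0)) : False := by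
  classical
  have h3 : (3 : k) = 0 := by exact_mod_cast CharP.cast_eq_zero k 3
  have h11 : (-1 : k) ≠ 1 := by
    intro h
    refine one_ne_zero (α := k) ?_
    linear_combination h3 + h
  obtain ⟨w, hw⟩ : ∃ w : k, w ^ 4 = -1 := by
    have : Fintype k := Fintype.ofFinite k
    rw [Nat.card_eq_fintype_card] at hcard
    obtain ⟨w, hw⟩ : ∃ w : k, w ∉ insert 0 (nthRootsFinset 4 (1 : k)) := by
      by_contra hcon
      push Not at hcon
      have h5 : (Finset.univ : Finset k) ⊆ insert 0 (nthRootsFinset 4 (1 : k)) := fun x _ => hcon x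
      have h6 := Finset.card_le_card h5
      have h7 := Finset.card_insert_le 0 (nthRootsFinset 4 (1 : k))
      have h8 : (nthRootsFinset 4 (1 : k)).card ≤ 4 := by
        rw [nthRootsFinset]
        exact (Multiset.toFinset_card_le _).trans (card_nthRoots 4 1)
      rw [Finset.card_univ, hcard] at h6
      omega
    simp only [Finset.mem_insert, not_or, mem_nthRootsFinset (by norm_num : 0 < 4)] at hw
    have h3 := FiniteField.pow_card_sub_one_eq_one w hw.1
    rw [hcard] at h3
    have h8 : (w ^ 4 - 1) * (w ^ 4 + 1) = 0 := by
      norm_num at h3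
      linear_combination h3
    rcases mul_eq_zero.1 h8 with h | h
    · exact absurd (sub_eq_zero.1 h) hw.2
    · exact ⟨w, eq_neg_of_add_eq_zero_left h⟩
  have hord : orderOf w = 2 ^ 3 := by
    apply orderOf_eq_prime_pow
    · norm_num [hw]; exact h11
    · rw [show (2 : ℕ) ^ (2 + 1) = 4 * 2 by norm_num, pow_mul, hw]; norm_num
  have hs4 : ∀ i : Fin 4, (w ^ (2 * (i : ℕ) + 1)) ^ 4 = -1 := by
    intro i
    rw [← pow_mul, mul_comm, pow_mul, hw]
    exact Odd.neg_one_pow ⟨i, rfl⟩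
  have := count_le' (k := k) 3 θ hθ a b (fun i : Fin 4 => w ^ (2 * (i : ℕ) + 1))
    (fun i : Bool => if i then 1 else 0) (by
      intro i j hij
      have := pow_injOn_Iio_orderOf (x := w) (by rw [hord, Set.mem_Iio]; omega)
        (by rw [hord, Set.mem_Iio]; omega) hij
      ext; omega) (by
      intro i j hij
      cases i <;> cases j <;> simp at hij ⊢) (by
      intro i hi
      have h4 := hs4 i
      beta_reduce at hi
      set s := w ^ (2 * (i : ℕ) + 1)
      apply h11
      have h5 : s ^ 2 = -1 := by linear_combination h4 - s * hi
      linear_combination (-1 : k) * h4 + (s ^ 2 - 1) * h5) (by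
      intro i j
      have := h _ (hs4 i)
      cases j
      · simpa using this.2
      · simpa using this.1)
  rw [hcard] at this
  simp at this

theorem pure_duodecic_not_monogenic (m : ℤ) (hsf : Squarefree m)
    (h0 : m ≠ 0) (h1 : m ≠ 1) (h2 : m ≠ -1)
    (K : Type*) [Field K] [NumberField K] (α : K)
    (hroot : α ^ 12 = (m : K))
    (hgen : IntermediateField.adjoin ℚ {α} = ⊤)
    (hmod : m ≡ 1 [ZMOD 4] ∨ m ≡ 1 [ZMOD 9] ∨ m ≡ -1 [ZMOD 9]) :
    ¬ ∃ θ : 𝓞 K, Algebra.adjoin ℤ {θ} = ⊤ := by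
  rintro ⟨θ, hθ⟩
  have hαi : IsIntegral ℤ α := by
    refine ⟨X ^ 12 - C m, monic_X_pow_sub_C m (by norm_num), ?_⟩
    rw [eval₂_sub, eval₂_X_pow, eval₂_C, hroot]; simp
  let a : 𝓞 K := ⟨α, hαi⟩
  have hacoe : (a : K) = α := rfl
  have hL : Lifts (𝓞 K) a m := by
    intro V _ _ _ _ x hx
    exact exists_hom m hsf h1 h2 K α hroot hgen V x hx a rfl
  have inj : Function.Injective (algebraMap (𝓞 K) K) := FaithfulSMul.algebraMap_injective _ _
  have W2p : Prime (2 : WittVector 2 (GaloisField 2 2)) := by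
    exact_mod_cast (WittVector.irreducible (k := GaloisField 2 2) 2).prime
  have W2c := witt_charZero 2 (GaloisField 2 2)
  have W2H := witt_HD 2 (GaloisField 2 2)
  have three : ∀ ε n : ℤ, ε ^ 2 = 1 → m = ε * (1 + 9 * n) → ∃ η : 𝓞 K,
      3 * η = 1 + ε * a ^ 4 + (ε * a ^ 4) ^ 2 := by
    intro ε n hε hm
    have hεK : (ε : K) ^ 2 = 1 := by exact_mod_cast congrArg (Int.cast : ℤ → K) hε
    set y : K := ε * α ^ 4 with hy
    have hy3 : y ^ 3 = 1 + 9 * n := by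
      have : (m : K) = ε * (1 + 9 * n) := by rw [hm]; push_cast; ring
      rw [hy, mul_pow, show (α ^ 4) ^ 3 = α ^ 12 by ring, hroot, this]
      linear_combination (1 + 9 * n : K) * ((ε : K) ^ 2 + 1) * hεK
    have hintg : IsIntegral ℤ ((1 + y + y ^ 2) / 3 : K) := by
      refine ⟨X ^ 3 - X ^ 2 - C (3 * n) * X - C (3 * n ^ 2), by monicity!, ?_⟩
      simp only [eval₂_sub, eval₂_mul, eval₂_pow, eval₂_X, eval₂_C]
      simp
      have hn : (n : K) = (y ^ 3 - 1) / 9 := by rw [hy3]; field_simp; ring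
      rw [hn]
      field_simp
      ring
    refine ⟨⟨_, hintg⟩, ?_⟩
    apply inj
    simp only [map_mul, map_add, map_pow, map_one, map_intCast, map_ofNat]
    change 3 * ((1 + y + y ^ 2) / 3 : K) = 1 + ε * α ^ 4 + (ε * α ^ 4) ^ 2
    rw [← hy]; field_simp
  rcases hmod with h | h | h
  · have hdvd := h.symm.dvd
    obtain ⟨q, hq⟩ := hdvd
    rcases Int.even_or_odd' q with ⟨n, rfl | rfl⟩
    · have hm : m = 1 + 8 * n := by linarith
      have hintg : IsIntegral ℤ ((1 + α ^ 3) * (1 + α ^ 6) / 4 : K) := by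
        refine ⟨X ^ 4 - X ^ 3 - C (3 * n) * X ^ 2 - C (4 * n ^ 2) * X - C (2 * n ^ 3),
          by monicity!, ?_⟩
        simp only [eval₂_sub, eval₂_mul, eval₂_pow, eval₂_X, eval₂_C]
        simp
        have hn : (n : K) = (α ^ 12 - 1) / 8 := by
          rw [hroot, hm]; push_cast; field_simp; ring
        rw [hn]
        field_simp
        ring
      let δ : 𝓞 K := ⟨_, hintg⟩
      have hδ : 4 * δ = (1 + a ^ 3) * (1 + a ^ 6) := by
        apply inj
        simp only [map_mul, map_add, map_pow, map_one, map_ofNat]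
        change 4 * ((1 + α ^ 3) * (1 + α ^ 6) / 4 : K) = (1 + α ^ 3) * (1 + α ^ 6)
        field_simp
      exact not_mono_two (GaloisField.card 2 2 (by norm_num)) a δ θ hθ n fun s z hs hz =>
        two_case_one a m hL n hm δ hδ _ _ _ W2H s hs z hz
    · have hm : m = 1 + 4 * (2 * n + 1) := by linarith
      have hintg : IsIntegral ℤ ((1 + α ^ 6) / 2 : K) := by
        refine ⟨X ^ 2 - X - C (2 * n + 1), by monicity!, ?_⟩
        simp only [eval₂_sub, eval₂_mul, eval₂_pow, eval₂_X, eval₂_C]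
        simp
        have hn : (n : K) = ((α ^ 12 - 1) / 4 - 1) / 2 := by
          rw [hroot, hm]; push_cast; field_simp; ring
        rw [hn]
        field_simp
        ring
      let β : 𝓞 K := ⟨_, hintg⟩
      have hβ : 2 * β = 1 + a ^ 6 := by
        apply inj
        simp only [map_mul, map_add, map_pow, map_one, map_ofNat]
        change 2 * ((1 + α ^ 6) / 2 : K) = 1 + α ^ 6
        field_simp
      exact not_mono_two (GaloisField.card 2 2 (by norm_num)) a β θ hθ 1 fun s z hs hz =>
        two_case_five a m hL n hm β hβ _ _ _ W2H W2p s hs z (by simpa using hz)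
  · obtain ⟨n, hn⟩ := h.symm.dvd
    have hm : m = 1 * (1 + 9 * n) := by linarith
    obtain ⟨η, hη⟩ := three 1 n (by norm_num) hm
    have Wp : Prime (3 : WittVector 3 (ZMod 3)) := by
      exact_mod_cast (WittVector.irreducible (k := ZMod 3) 3).prime
    have Wc := witt_charZero 3 (ZMod 3)
    have WH := witt_HD 3 (ZMod 3)
    exact not_mono_three_pos a η θ hθ fun s hs =>
      three_case a m hL 1 n (by norm_num) hm η hη _ _ _ WH Wp s (by simpa using hs)
  · obtain ⟨n, hn⟩ := h.symm.dvd
    have hm : m = (-1) * (1 + 9 * (-n)) := by linarith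
    obtain ⟨η, hη⟩ := three (-1) (-n) (by norm_num) hm
    have Wp : Prime (3 : WittVector 3 (GaloisField 3 2)) := by
      exact_mod_cast (WittVector.irreducible (k := GaloisField 3 2) 3).prime
    have Wc := witt_charZero 3 (GaloisField 3 2)
    have WH := witt_HD 3 (GaloisField 3 2)
    exact not_mono_three_neg (GaloisField.card 3 2 (by norm_num)) a η θ hθ fun s hs =>
      three_case a m hL (-1) (-n) (by norm_num) hm η hη _ _ _ WH Wp s (by simpa using hs)
end

section
/- Let m be a squarefree rational integer with m ∉ {0, 1, -1}, α a complex root of the irreducible polynomial x^12 − m, K = ℚ(α), and Z_K the ring of integers of K. If m ≡ 1 (mod 16), then 2Z_K = 𝔭₁𝔭₂𝔭₃²𝔮₁𝔮₂𝔮₃², where 𝔭₁, 𝔭₂, 𝔭₃, 𝔮₁, 𝔮₂, 𝔮₃ are six pairwise distinct prime ideals of Z_K, with residue degrees f(𝔭₁) = f(𝔭₂) = f(𝔭₃) = 1 and f(𝔮₁) = f(𝔮₂) = f(𝔮₃) = 2. -/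
open Polynomial NumberField

namespace TwoFactor

/-- Eisenstein irreducibility of `X^12 - m`. -/
lemma irred (m : ℤ) (hsf : Squarefree m) (h1 : m ≠ 1) (h2 : m ≠ -1) :
    Irreducible (X ^ 12 - C (m : ℚ) : ℚ[X]) := by
  have hnu : ¬ IsUnit m := by
    rw [Int.isUnit_iff]; tauto
  obtain ⟨p, hp, hpm⟩ := WfDvdMonoid.exists_irreducible_factor hnu hsf.ne_zero
  have hp' : Prime p := hp.prime
  have hmon : (X ^ 12 - C m : ℤ[X]).Monic := monic_X_pow_sub_C m (by norm_num)
  have hdeg : (X ^ 12 - C m : ℤ[X]).degree = 12 := degree_X_pow_sub_C (by norm_num) m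
  have hirr : Irreducible (X ^ 12 - C m : ℤ[X]) := by
    refine irreducible_of_eisenstein_criterion (P := Ideal.span {p})
      ((Ideal.span_singleton_prime hp'.ne_zero).2 hp') ?_ ?_ ?_ ?_ hmon.isPrimitive
    · rw [hmon.leadingCoeff, Ideal.mem_span_singleton]
      exact fun h => hp.not_isUnit (isUnit_of_dvd_one h)
    · intro n hn
      rw [hdeg] at hn
      have hn' : n < 12 := by exact_mod_cast hn
      rw [coeff_sub, coeff_X_pow, coeff_C, Ideal.mem_span_singleton, if_neg (by omega)]
      split_ifs <;> simp [hpm]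
    · rw [hdeg]; norm_num
    · rw [Ideal.span_singleton_pow, Ideal.mem_span_singleton]
      simp only [coeff_sub, coeff_X_pow, coeff_C]
      norm_num
      intro h
      exact hp.not_isUnit (hsf p (by rwa [← pow_two]))
  have := (IsPrimitive.Int.irreducible_iff_irreducible_map_cast hmon.isPrimitive).1 hirr
  simpa using this

/-- Embeddings of `K` into `ℂ` and the degree. -/
lemma embed (m : ℤ) (hsf : Squarefree m) (h1 : m ≠ 1) (h2 : m ≠ -1)
    (K : Type*) [Field K] [NumberField K] (α : K) (hroot : α ^ 12 = (m : K))
    (hgen : IntermediateField.adjoin ℚ {α} = ⊤) :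
    Module.finrank ℚ K = 12 ∧ ∀ r : ℂ, r ^ 12 = m → ∃ φ : K →+* ℂ, φ α = r := by
  have hint : IsIntegral ℚ α := Algebra.IsIntegral.isIntegral α
  have htop : Algebra.adjoin ℚ {α} = ⊤ := by
    rw [← IntermediateField.adjoin_simple_toSubalgebra_of_isAlgebraic hint.isAlgebraic, hgen]
    rfl
  have hmin : minpoly ℚ α = X ^ 12 - C (m : ℚ) := by
    symm
    apply minpoly.eq_of_irreducible_of_monic (irred m hsf h1 h2)
    · simp [hroot]
    · exact monic_X_pow_sub_C _ (by norm_num)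
  let pb := PowerBasis.ofAdjoinEqTop hint htop
  have hg : pb.gen = α := PowerBasis.ofAdjoinEqTop_gen hint htop
  constructor
  · rw [pb.finrank, PowerBasis.ofAdjoinEqTop_dim, hmin]
    exact natDegree_X_pow_sub_C
  · intro r hr
    have h : aeval r (minpoly ℚ pb.gen) = 0 := by
      rw [hg, hmin]; simp [hr]
    refine ⟨(pb.lift r h : K →ₐ[ℚ] ℂ).toRingHom, ?_⟩
    have := pb.lift_gen r h
    rw [hg] at this
    exact this

/-- Facts about the prime `P` over two for the ramified type. -/
lemma two_mem_sq {R : Type*} [CommRing R] (P : Ideal R) (θ β : R) (k : ℤ)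
    (h2 : (2 : R) ∈ P) (hθ : θ ∈ P) (hβ : 1 + β ∈ P)
    (hq : θ ^ 2 = θ + 4 * k) (hb : β ^ 2 = 2 * θ - 1) : (2 : R) ∈ P ^ 2 := by
  have h4 : (2 * 2 : R) ∈ P ^ 2 := by rw [pow_two]; exact Ideal.mul_mem_mul h2 h2
  have h5 : θ * θ ∈ P ^ 2 := by rw [pow_two]; exact Ideal.mul_mem_mul hθ hθ
  have h6 : (1 + β) * (1 + β) ∈ P ^ 2 := by rw [pow_two]; exact Ideal.mul_mem_mul hβ hβ
  have h7 : θ ∈ P ^ 2 := by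
    have : θ = θ * θ - k * (2 * 2) := by linear_combination -hq
    rw [this]
    exact sub_mem h5 (Ideal.mul_mem_left _ _ h4)
  have h8 : 2 * β ∈ P ^ 2 := by
    have : 2 * β = (1 + β) * (1 + β) - 2 * θ := by linear_combination -hb
    rw [this]
    exact sub_mem h6 (Ideal.mul_mem_left _ _ h7)
  have : (2 : R) = 2 * 2 * θ - β * (2 * β) := by linear_combination 2 * hb
  rw [this]
  exact sub_mem (Ideal.mul_mem_left _ _ h7) (Ideal.mul_mem_left _ _ h8)

/-- The final counting argument. -/
lemma count {K : Type*} [Field K] [NumberField K] (hK : Module.finrank ℚ K = 12)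
    (γ : 𝓞 K) (p₁ p₂ p₃ q₁ q₂ q₃ : Ideal (𝓞 K))
    (hp₁ : p₁.IsPrime) (hp₂ : p₂.IsPrime) (hp₃ : p₃.IsPrime)
    (hq₁ : q₁.IsPrime) (hq₂ : q₂.IsPrime) (hq₃ : q₃.IsPrime)
    (h₁ : 2 ∈ p₁) (h₂ : 2 ∈ p₂) (h₃ : 2 ∈ p₃ ^ 2) (k₁ : 2 ∈ q₁) (k₂ : 2 ∈ q₂) (k₃ : 2 ∈ q₃ ^ 2)
    (g₁ : γ ^ 2 + γ + 1 ∈ q₁) (g₂ : γ ^ 2 + γ + 1 ∈ q₂) (g₃ : γ ^ 2 + γ + 1 ∈ q₃)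
    (hne : [p₁, p₂, p₃, q₁, q₂, q₃].Pairwise (· ≠ ·)) :
      Ideal.absNorm p₁ = 2 ∧ Ideal.absNorm p₂ = 2 ∧ Ideal.absNorm p₃ = 2 ∧
      Ideal.absNorm q₁ = 2 ^ 2 ∧ Ideal.absNorm q₂ = 2 ^ 2 ∧ Ideal.absNorm q₃ = 2 ^ 2 ∧
      Ideal.span {(2 : 𝓞 K)} = p₁ * p₂ * p₃ ^ 2 * q₁ * q₂ * q₃ ^ 2 := by
  have h₃' : 2 ∈ p₃ := Ideal.pow_le_self (by norm_num) h₃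
  have k₃' : 2 ∈ q₃ := Ideal.pow_le_self (by norm_num) k₃
  have hN : Ideal.absNorm (Ideal.span {(2 : 𝓞 K)}) = 2 ^ 12 := by
    have := Ideal.absNorm_span_natCast (S := 𝓞 K) 2
    rw [RingOfIntegers.rank, hK] at this
    simpa using this
  have hdvd : ∀ P : Ideal (𝓞 K), P.IsPrime → 2 ∈ P →
      ∃ i, 1 ≤ i ∧ Ideal.absNorm P = 2 ^ i := by
    intro P hP h
    have hle : Ideal.span {(2 : 𝓞 K)} ≤ P := by
      rwa [Ideal.span_singleton_le_iff_mem]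
    have := Ideal.absNorm_dvd_absNorm_of_le hle
    rw [hN, Nat.dvd_prime_pow Nat.prime_two] at this
    obtain ⟨i, -, hi⟩ := this
    refine ⟨i, ?_, hi⟩
    rcases Nat.eq_zero_or_pos i with rfl | h0
    · rw [pow_zero, Ideal.absNorm_eq_one_iff] at hi
      exact absurd hi hP.ne_top
    · exact h0
  have hdvd2 : ∀ P : Ideal (𝓞 K), P.IsPrime → 2 ∈ P → γ ^ 2 + γ + 1 ∈ P →
      ∃ i, 2 ≤ i ∧ Ideal.absNorm P = 2 ^ i := by
    intro P hP h hg
    obtain ⟨i, hi1, hi⟩ := hdvd P hP h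
    refine ⟨i, ?_, hi⟩
    by_contra hlt
    obtain rfl : i = 1 := by omega
    have hc : Nat.card (𝓞 K ⧸ P) = 2 := by
      rw [← Submodule.cardQuot_apply, ← Ideal.absNorm_apply, hi, pow_one]
    obtain ⟨y, hy, huniq⟩ := (Nat.card_eq_two_iff' (0 : 𝓞 K ⧸ P)).1 hc
    have hone : (1 : 𝓞 K ⧸ P) ≠ 0 := by
      intro h
      have := (Ideal.Quotient.eq_zero_iff_mem (I := P) (a := 1)).1 h
      exact hP.ne_top ((Ideal.eq_top_iff_one P).2 this)
    have h1 := huniq 1 hone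
    have hnot1 : (1 : 𝓞 K) ∉ P := fun h => hP.ne_top ((Ideal.eq_top_iff_one P).2 h)
    by_cases hγ : Ideal.Quotient.mk P γ = 0
    · rw [Ideal.Quotient.eq_zero_iff_mem] at hγ
      apply hnot1
      have : (1 : 𝓞 K) = (γ ^ 2 + γ + 1) - (γ + 1) * γ := by ring
      rw [this]
      exact sub_mem hg (Ideal.mul_mem_left _ _ hγ)
    · have h3 : Ideal.Quotient.mk P γ = Ideal.Quotient.mk P 1 := by
        rw [huniq _ hγ, map_one, h1]
      rw [Ideal.Quotient.eq] at h3
      apply hnot1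
      have : (1 : 𝓞 K) = (γ ^ 2 + γ + 1) - (γ + 2) * (γ - 1) - 2 := by ring
      rw [this]
      exact sub_mem (sub_mem hg (Ideal.mul_mem_left _ _ h3)) h
  have hmax : ∀ P : Ideal (𝓞 K), P.IsPrime → 2 ∈ P → P.IsMaximal := by
    intro P hP h
    refine hP.isMaximal ?_
    rintro rfl
    simp at h
  have hcop : ∀ P Q : Ideal (𝓞 K), P.IsPrime → 2 ∈ P → Q.IsPrime → 2 ∈ Q → P ≠ Q →
      IsCoprime P Q := by
    intro P Q hP h hQ h' hPQ
    exact Ideal.isCoprime_iff_sup_eq.2 ((hmax P hP h).coprime_of_ne (hmax Q hQ h') hPQ)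
  have hdv : ∀ P : Ideal (𝓞 K), 2 ∈ P → P ∣ Ideal.span {(2 : 𝓞 K)} := by
    intro P h
    rwa [Ideal.dvd_iff_le, Ideal.span_singleton_le_iff_mem]
  simp only [List.pairwise_cons, List.mem_cons, List.not_mem_nil, or_false, forall_eq_or_imp,
    forall_eq] at hne
  obtain ⟨⟨n12, n13, n14, n15, n16⟩, ⟨n23, n24, n25, n26⟩, ⟨n34, n35, n36⟩, ⟨n45, n46⟩, n56, -⟩ := hne
  have c12 := hcop _ _ hp₁ h₁ hp₂ h₂ n12
  have c13 := hcop _ _ hp₁ h₁ hp₃ h₃' n13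
  have c14 := hcop _ _ hp₁ h₁ hq₁ k₁ n14
  have c15 := hcop _ _ hp₁ h₁ hq₂ k₂ n15
  have c16 := hcop _ _ hp₁ h₁ hq₃ k₃' n16
  have c23 := hcop _ _ hp₂ h₂ hp₃ h₃' n23
  have c24 := hcop _ _ hp₂ h₂ hq₁ k₁ n24
  have c25 := hcop _ _ hp₂ h₂ hq₂ k₂ n25
  have c26 := hcop _ _ hp₂ h₂ hq₃ k₃' n26
  have c34 := hcop _ _ hp₃ h₃' hq₁ k₁ n34
  have c35 := hcop _ _ hp₃ h₃' hq₂ k₂ n35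
  have c36 := hcop _ _ hp₃ h₃' hq₃ k₃' n36
  have c45 := hcop _ _ hq₁ k₁ hq₂ k₂ n45
  have c46 := hcop _ _ hq₁ k₁ hq₃ k₃' n46
  have c56 := hcop _ _ hq₂ k₂ hq₃ k₃' n56
  have d2 : p₁ * p₂ ∣ Ideal.span {(2 : 𝓞 K)} := c12.mul_dvd (hdv _ h₁) (hdv _ h₂)
  have d3 : p₁ * p₂ * p₃ ^ 2 ∣ Ideal.span {(2 : 𝓞 K)} :=
    (IsCoprime.mul_left c13.pow_right c23.pow_right).mul_dvd d2 (hdv _ h₃)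
  have d4 : p₁ * p₂ * p₃ ^ 2 * q₁ ∣ Ideal.span {(2 : 𝓞 K)} :=
    ((c14.mul_left c24).mul_left c34.pow_left).mul_dvd d3 (hdv _ k₁)
  have d5 : p₁ * p₂ * p₃ ^ 2 * q₁ * q₂ ∣ Ideal.span {(2 : 𝓞 K)} :=
    (((c15.mul_left c25).mul_left c35.pow_left).mul_left c45).mul_dvd d4 (hdv _ k₂)
  have d6 : p₁ * p₂ * p₃ ^ 2 * q₁ * q₂ * q₃ ^ 2 ∣ Ideal.span {(2 : 𝓞 K)} :=
    IsCoprime.mul_dvd (IsCoprime.pow_right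
      ((((c16.mul_left c26).mul_left c36.pow_left).mul_left c46).mul_left c56)) d5 (hdv _ k₃)
  obtain ⟨J, hJ⟩ := d6
  obtain ⟨a₁, la₁, ea₁⟩ := hdvd p₁ hp₁ h₁
  obtain ⟨a₂, la₂, ea₂⟩ := hdvd p₂ hp₂ h₂
  obtain ⟨a₃, la₃, ea₃⟩ := hdvd p₃ hp₃ h₃'
  obtain ⟨b₁, lb₁, eb₁⟩ := hdvd2 q₁ hq₁ k₁ g₁
  obtain ⟨b₂, lb₂, eb₂⟩ := hdvd2 q₂ hq₂ k₂ g₂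
  obtain ⟨b₃, lb₃, eb₃⟩ := hdvd2 q₃ hq₃ k₃' g₃
  have hE := congrArg Ideal.absNorm hJ
  rw [hN] at hE
  simp only [map_mul, map_pow, ea₁, ea₂, ea₃, eb₁, eb₂, eb₃] at hE
  have hE' : 2 ^ 12 = 2 ^ (a₁ + a₂ + a₃ * 2 + b₁ + b₂ + b₃ * 2) * Ideal.absNorm J := by
    rw [hE]; ring
  have hle : a₁ + a₂ + a₃ * 2 + b₁ + b₂ + b₃ * 2 ≤ 12 :=
    (Nat.pow_dvd_pow_iff_le_right (by norm_num : 1 < 2)).1 ⟨_, hE'⟩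
  obtain rfl : a₁ = 1 := by omega
  obtain rfl : a₂ = 1 := by omega
  obtain rfl : a₃ = 1 := by omega
  obtain rfl : b₁ = 2 := by omega
  obtain rfl : b₂ = 2 := by omega
  obtain rfl : b₃ = 2 := by omega
  have hJ1 : Ideal.absNorm J = 1 := by norm_num at hE'; omega
  rw [Ideal.absNorm_eq_one_iff] at hJ1
  refine ⟨by simpa using ea₁, by simpa using ea₂, by simpa using ea₃, eb₁, eb₂, eb₃, ?_⟩
  rw [hJ, hJ1, Ideal.mul_top]

/-- There is a prime of the ring of all algebraic integers in `ℂ` above two. -/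
lemma exists_prime : ∃ M : Ideal (𝓞 ℂ), M.IsPrime ∧ (2 : 𝓞 ℂ) ∈ M := by
  have hu : ¬ IsUnit (2 : 𝓞 ℂ) := by
    intro h
    obtain ⟨y, hy⟩ := h.exists_right_inv
    have hy' : (2 : ℂ) * (y : ℂ) = 1 := by
      simpa only [map_mul, map_ofNat, map_one] using congrArg (algebraMap (𝓞 ℂ) ℂ) hy
    have hi : IsIntegral ℤ (algebraMap ℚ ℂ (1 / 2)) := by
      have : algebraMap ℚ ℂ (1 / 2) = (y : ℂ) := by
        simp; linear_combination -hy' / 2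
      rw [this]
      exact y.isIntegral_coe
    rw [isIntegral_algebraMap_iff (algebraMap ℚ ℂ).injective] at hi
    obtain ⟨n, hn⟩ := IsIntegrallyClosed.isIntegral_iff.1 hi
    have : (2 * n : ℚ) = 1 := by
      simp at hn; rw [hn]; norm_num
    have h3 : 2 * n = 1 := by exact_mod_cast this
    omega
  obtain ⟨M, hM, hM2⟩ := exists_max_ideal_of_mem_nonunits hu
  exact ⟨M, hM.isPrime, hM2⟩

end TwoFactor

/-- If `m ≡ 1 (mod 16)` (with `m` squarefree, `m ∉ {0,1,-1}`, `K = ℚ(α)`, `α^12 = m`),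
then `2 Z_K = 𝔭₁𝔭₂𝔭₃²𝔮₁𝔮₂𝔮₃²` with six pairwise distinct prime ideals, where the `𝔭ᵢ`
have residue degree `1` (absolute norm `2`) and the `𝔮ᵢ` have residue degree `2`
(absolute norm `4`). -/
theorem factorization_two_of_one_mod_sixteen (m : ℤ) (hsf : Squarefree m)
    (h0 : m ≠ 0) (h1 : m ≠ 1) (h2 : m ≠ -1)
    (K : Type*) [Field K] [NumberField K] (α : K)
    (hroot : α ^ 12 = (m : K))
    (hgen : IntermediateField.adjoin ℚ {α} = ⊤)
    (hmod : m ≡ 1 [ZMOD 16]) :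
    ∃ p₁ p₂ p₃ q₁ q₂ q₃ : Ideal (𝓞 K),
      [p₁, p₂, p₃, q₁, q₂, q₃].Pairwise (· ≠ ·) ∧
      p₁.IsPrime ∧ p₂.IsPrime ∧ p₃.IsPrime ∧ q₁.IsPrime ∧ q₂.IsPrime ∧ q₃.IsPrime ∧
      Ideal.absNorm p₁ = 2 ∧ Ideal.absNorm p₂ = 2 ∧ Ideal.absNorm p₃ = 2 ∧
      Ideal.absNorm q₁ = 2 ^ 2 ∧ Ideal.absNorm q₂ = 2 ^ 2 ∧ Ideal.absNorm q₃ = 2 ^ 2 ∧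
      Ideal.span {(2 : 𝓞 K)} = p₁ * p₂ * p₃ ^ 2 * q₁ * q₂ * q₃ ^ 2 := by
  obtain ⟨hK, hemb⟩ := TwoFactor.embed m hsf h1 h2 K α hroot hgen
  obtain ⟨k, hk⟩ : ∃ k : ℤ, m = 1 + 16 * k := by
    obtain ⟨c, hc⟩ := hmod.dvd
    exact ⟨-c, by omega⟩
  have hr' : α ^ 12 = 1 + 16 * (k : K) := by rw [hroot, hk]; push_cast; ring
  -- the integral elements
  have iα : IsIntegral ℤ α := ⟨X ^ 12 - C m, monic_X_pow_sub_C m (by norm_num), by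
    rw [eval₂_sub, eval₂_X_pow, eval₂_C, eq_intCast, hroot, sub_self]⟩
  have iθ : IsIntegral ℤ ((1 + α ^ 6) / 2) := by
    refine ⟨X ^ 2 - X - C (4 * k), by monicity!, ?_⟩
    simp only [eval₂_sub, eval₂_add, eval₂_mul, eval₂_pow, eval₂_X, eval₂_C]
    simp only [eq_intCast, Int.cast_mul, Int.cast_ofNat]
    linear_combination (1 / 4) * hr'
  have iη : IsIntegral ℤ ((1 + α ^ 3) * (1 + α ^ 6) / 4) := by
    refine ⟨X ^ 4 - X ^ 2 * (X + C (2 * k)) - C (4 * k) * (X + C (2 * k)) ^ 2, by monicity!, ?_⟩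
    have hkk : (k : K) = (α ^ 12 - 1) / 16 := by rw [hr']; ring
    simp only [eval₂_sub, eval₂_add, eval₂_mul, eval₂_pow, eval₂_X, eval₂_C]
    simp only [eq_intCast, Int.cast_mul, Int.cast_ofNat, hkk]
    ring
  let a : 𝓞 K := ⟨α, iα⟩
  let θ : 𝓞 K := ⟨_, iθ⟩
  let η : 𝓞 K := ⟨_, iη⟩
  have ca : (a : K) = α := rfl
  have cθ : (θ : K) = (1 + α ^ 6) / 2 := rfl
  have cη : (η : K) = (1 + α ^ 3) * (1 + α ^ 6) / 4 := rfl
  have eθ : θ ^ 2 = θ + 4 * k := by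
    apply RingOfIntegers.ext
    simp only [map_add, map_sub, map_mul, map_pow, map_ofNat, map_intCast, map_one, cθ]
    linear_combination (1 / 4) * hr'
  have eβ : (a ^ 3) ^ 2 = 2 * θ - 1 := by
    apply RingOfIntegers.ext
    simp only [map_add, map_sub, map_mul, map_pow, map_ofNat, map_intCast, map_one, cθ, ca]
    ring
  have eη : η ^ 2 = θ * η + 2 * k * θ := by
    apply RingOfIntegers.ext
    simp only [map_add, map_sub, map_mul, map_pow, map_ofNat, map_intCast, map_one, cθ, cη]
    linear_combination (1 / 16) * (1 + α ^ 6) * hr'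
  obtain ⟨M, hM, hM2⟩ := TwoFactor.exists_prime
  have hnot1 : (1 : 𝓞 ℂ) ∉ M := fun h => hM.ne_top ((Ideal.eq_top_iff_one M).2 h)
  -- a primitive cube root of unity
  obtain ⟨s, hs⟩ := IsAlgClosed.exists_pow_nat_eq (-3 : ℂ) (n := 2) (by norm_num)
  obtain ⟨ω, hω⟩ : ∃ ω : ℂ, ω ^ 2 + ω + 1 = 0 :=
    ⟨(s - 1) / 2, by linear_combination (1 / 4) * hs⟩
  have hω3 : ω ^ 3 = 1 := by linear_combination (ω - 1) * hω
  have iω : IsIntegral ℤ ω :=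
    ⟨X ^ 2 + X + 1, by monicity!, by
      simp only [eval₂_add, eval₂_pow, eval₂_X, eval₂_one, hω]⟩
  obtain ⟨w, hw⟩ : ∃ w : 𝓞 ℂ, algebraMap (𝓞 ℂ) ℂ w = ω := ⟨⟨ω, iω⟩, rfl⟩
  have hw0 : w ^ 2 + w + 1 = 0 := by
    apply RingOfIntegers.ext
    simp only [map_add, map_pow, map_one, map_zero, hw, hω]
  -- embeddings attached to roots
  let V : ℂ → (𝓞 K →+* 𝓞 ℂ) → Prop := fun r ψ =>
    r ^ 12 = m ∧ algebraMap (𝓞 ℂ) ℂ (ψ a) = r ∧ algebraMap (𝓞 ℂ) ℂ (ψ θ) = (1 + r ^ 6) / 2 ∧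
      algebraMap (𝓞 ℂ) ℂ (ψ η) = (1 + r ^ 3) * (1 + r ^ 6) / 4
  have hV : ∀ r : ℂ, r ^ 12 = m → ∃ ψ, V r ψ := by
    intro r hr
    obtain ⟨φ, hφ⟩ := hemb r hr
    refine ⟨RingOfIntegers.mapRingHom φ, hr, ?_, ?_, ?_⟩
    · exact hφ
    · change φ ((1 + α ^ 6) / 2) = _
      simp only [map_div₀, map_mul, map_add, map_pow, map_one, map_ofNat, hφ]
    · change φ ((1 + α ^ 3) * (1 + α ^ 6) / 4) = _
      simp only [map_div₀, map_mul, map_add, map_pow, map_one, map_ofNat, hφ]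
  have tI : ∀ r ψ, V r ψ → ∃ r' ψ', V r' ψ' ∧ ψ' θ = 1 - ψ θ ∧ ψ' a ^ 4 = ψ a ^ 4 := by
    rintro r ψ ⟨hr, e1, e2, -⟩
    have hI : Complex.I ^ 2 = -1 := Complex.I_sq
    have hI4 : Complex.I ^ 4 = 1 := by linear_combination (Complex.I ^ 2 - 1) * hI
    have hI6 : Complex.I ^ 6 = -1 := by
      linear_combination Complex.I ^ 2 * hI4 + hI
    obtain ⟨ψ', hv⟩ := hV (r * Complex.I) (by
      rw [mul_pow, hr, show Complex.I ^ 12 = (Complex.I ^ 4) ^ 3 by ring, hI4]; ring)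
    refine ⟨_, ψ', hv, ?_, ?_⟩
    · apply FaithfulSMul.algebraMap_injective (𝓞 ℂ) ℂ
      simp only [map_sub, map_one]
      rw [hv.2.2.1, e2, mul_pow, hI6]
      ring
    · apply FaithfulSMul.algebraMap_injective (𝓞 ℂ) ℂ
      simp only [map_pow]
      rw [hv.2.1, e1, mul_pow, hI4, mul_one]
  have tN : ∀ r ψ, V r ψ → ∃ r' ψ', V r' ψ' ∧ ψ' θ = ψ θ ∧ ψ' η = ψ θ - ψ η ∧
      ψ' a ^ 4 = ψ a ^ 4 := by
    rintro r ψ ⟨hr, e1, e2, e3⟩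
    obtain ⟨ψ', hv⟩ := hV (-r) (by rw [← hr]; ring)
    refine ⟨_, ψ', hv, ?_, ?_, ?_⟩
    · apply FaithfulSMul.algebraMap_injective (𝓞 ℂ) ℂ
      rw [hv.2.2.1, e2]
      ring
    · apply FaithfulSMul.algebraMap_injective (𝓞 ℂ) ℂ
      simp only [map_sub, map_one]
      rw [hv.2.2.2, e2, e3]
      ring
    · apply FaithfulSMul.algebraMap_injective (𝓞 ℂ) ℂ
      simp only [map_pow]
      rw [hv.2.1, e1]
      ring
  have tW : ∀ r ψ, V r ψ → ∃ r' ψ', V r' ψ' ∧ ψ' θ = ψ θ ∧ ψ' η = ψ η ∧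
      ψ' a ^ 4 = w * ψ a ^ 4 := by
    rintro r ψ ⟨hr, e1, e2, e3⟩
    obtain ⟨ψ', hv⟩ := hV (r * ω) (by
      rw [mul_pow, hr, show ω ^ 12 = (ω ^ 3) ^ 4 by ring, hω3]; ring)
    have hω6 : ω ^ 6 = 1 := by rw [show ω ^ 6 = (ω ^ 3) ^ 2 by ring, hω3]; ring
    refine ⟨_, ψ', hv, ?_, ?_, ?_⟩
    · apply FaithfulSMul.algebraMap_injective (𝓞 ℂ) ℂ
      rw [hv.2.2.1, e2, mul_pow, hω6, mul_one]
    · apply FaithfulSMul.algebraMap_injective (𝓞 ℂ) ℂ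
      rw [hv.2.2.2, e3, mul_pow, mul_pow, hω6, hω3, mul_one, mul_one]
    · apply FaithfulSMul.algebraMap_injective (𝓞 ℂ) ℂ
      simp only [map_mul, map_pow]
      rw [hv.2.1, e1, hw]
      linear_combination r ^ 4 * ω * hω3
  -- step one: arrange `a ^ 4 ≡ 1`
  have S1 : ∃ r ψ, V r ψ ∧ ψ a ^ 4 - 1 ∈ M := by
    obtain ⟨r, hr⟩ := IsAlgClosed.exists_pow_nat_eq (m : ℂ) (n := 12) (by norm_num)
    obtain ⟨ψ, hv⟩ := hV r hr
    obtain ⟨r', ψ', hv', -, -, e'⟩ := tW _ _ hv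
    obtain ⟨r'', ψ'', hv'', -, -, e''⟩ := tW _ _ hv'
    have h12 : ψ a ^ 12 = 1 + 16 * (k : 𝓞 ℂ) := by
      apply FaithfulSMul.algebraMap_injective (𝓞 ℂ) ℂ
      simp only [map_add, map_mul, map_pow, map_ofNat, map_intCast, map_one, hv.2.1, hr, hk]
      push_cast
      ring
    have hprod : (ψ a ^ 4 - 1) * ((ψ a ^ 4 - w) * (ψ a ^ 4 - w ^ 2)) ∈ M := by
      have : (ψ a ^ 4 - 1) * ((ψ a ^ 4 - w) * (ψ a ^ 4 - w ^ 2)) = (8 * k) * 2 := by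
        linear_combination h12 + (-ψ a ^ 8 + ψ a ^ 4 * w - w + 1) * hw0
      rw [this]
      exact Ideal.mul_mem_left _ _ hM2
    rcases hM.mem_or_mem hprod with h | h
    · exact ⟨r, ψ, hv, h⟩
    rcases hM.mem_or_mem h with h | h
    · refine ⟨r'', ψ'', hv'', ?_⟩
      have : ψ'' a ^ 4 - 1 = w ^ 2 * (ψ a ^ 4 - w) := by
        rw [e'', e']
        linear_combination (w - 1) * hw0
      rw [this]
      exact Ideal.mul_mem_left _ _ h
    · refine ⟨r', ψ', hv', ?_⟩
      have : ψ' a ^ 4 - 1 = w * (ψ a ^ 4 - w ^ 2) := by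
        rw [e']
        linear_combination (w - 1) * hw0
      rw [this]
      exact Ideal.mul_mem_left _ _ h
  -- step two: arrange also `θ ≡ 0`
  have S2 : ∃ r ψ, V r ψ ∧ ψ a ^ 4 - 1 ∈ M ∧ ψ θ ∈ M := by
    obtain ⟨r, ψ, hv, hg⟩ := S1
    have hprod : ψ θ * (1 - ψ θ) ∈ M := by
      have h := congrArg ψ eθ
      simp only [map_add, map_mul, map_pow, map_ofNat, map_intCast] at h
      have : ψ θ * (1 - ψ θ) = (-2 * k) * 2 := by linear_combination -h
      rw [this]
      exact Ideal.mul_mem_left _ _ hM2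
    rcases hM.mem_or_mem hprod with h | h
    · exact ⟨r, ψ, hv, hg, h⟩
    · obtain ⟨r', ψ', hv', e1, e2⟩ := tI _ _ hv
      exact ⟨r', ψ', hv', by rwa [e2], by rwa [e1]⟩
  obtain ⟨r₃, ψ₃, v₃, g₃, t₃⟩ := S2
  -- step three: the two unramified types
  have S3 : ∃ r r' ψ ψ', V r ψ ∧ V r' ψ' ∧ ψ a ^ 4 - 1 ∈ M ∧ ψ' a ^ 4 - 1 ∈ M ∧
      1 - ψ θ ∈ M ∧ 1 - ψ' θ ∈ M ∧ 1 - ψ η ∈ M ∧ ψ' η ∈ M := by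
    obtain ⟨r, ψ, hv, e1, e2⟩ := tI _ _ v₃
    obtain ⟨r', ψ', hv', e1', e3', e2'⟩ := tN _ _ hv
    have ht : 1 - ψ θ ∈ M := by rw [e1]; simpa using t₃
    have ht' : 1 - ψ' θ ∈ M := by rwa [e1']
    have hg : ψ a ^ 4 - 1 ∈ M := by rwa [e2]
    have hg' : ψ' a ^ 4 - 1 ∈ M := by rwa [e2']
    have hprod : ψ η * (1 - ψ η) ∈ M := by
      have h := congrArg ψ eη
      simp only [map_add, map_mul, map_pow, map_ofNat, map_intCast] at h
      have : ψ η * (1 - ψ η) = ψ η * (1 - ψ θ) - (k * ψ θ) * 2 := by linear_combination -h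
      rw [this]
      exact sub_mem (Ideal.mul_mem_left _ _ ht) (Ideal.mul_mem_left _ _ hM2)
    rcases hM.mem_or_mem hprod with h | h
    · refine ⟨r', r, ψ', ψ, hv', hv, hg', hg, ht', ht, ?_, h⟩
      rw [e3', show 1 - (ψ θ - ψ η) = (1 - ψ θ) + ψ η by ring]
      exact add_mem ht h
    · refine ⟨r, r', ψ, ψ', hv, hv', hg, hg', ht, ht', h, ?_⟩
      rw [e3', show ψ θ - ψ η = (1 - ψ η) - (1 - ψ θ) by ring]
      exact sub_mem h ht
  obtain ⟨r₁, r₂, ψ₁, ψ₂, v₁, v₂, g₁, g₂, t₁, t₂, n₁, n₂⟩ := S3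
  -- step four: twist by the cube root of unity
  have tW' : ∀ r ψ, V r ψ → ψ a ^ 4 - 1 ∈ M → ∃ ψ' : 𝓞 K →+* 𝓞 ℂ,
      ψ' θ = ψ θ ∧ ψ' η = ψ η ∧ ψ' ((a ^ 4) ^ 2 + a ^ 4 + 1) ∈ M := by
    intro r ψ hv hg
    obtain ⟨r', ψ', hv', e1, e2, e3⟩ := tW _ _ hv
    refine ⟨ψ', e1, e2, ?_⟩
    simp only [map_add, map_pow, map_one, e3]
    have : (w * ψ a ^ 4) ^ 2 + w * ψ a ^ 4 + 1 =
        (w ^ 2 * (ψ a ^ 4 + 1) + w) * (ψ a ^ 4 - 1) := by linear_combination hw0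
    rw [this]
    exact Ideal.mul_mem_left _ _ hg
  obtain ⟨χ₁, x₁, y₁, z₁⟩ := tW' _ _ v₁ g₁
  obtain ⟨χ₂, x₂, y₂, z₂⟩ := tW' _ _ v₂ g₂
  obtain ⟨χ₃, x₃, y₃, z₃⟩ := tW' _ _ v₃ g₃
  have hg1 : ∀ ψ : 𝓞 K →+* 𝓞 ℂ, ψ a ^ 4 - 1 ∈ M →
      (a ^ 4) ^ 2 + a ^ 4 + 1 ∉ M.comap ψ := by
    intro ψ hg h
    rw [Ideal.mem_comap] at h
    simp only [map_add, map_pow, map_one] at h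
    apply hnot1
    have : (1 : 𝓞 ℂ) = ((ψ a ^ 4) ^ 2 + ψ a ^ 4 + 1) - (ψ a ^ 4 + 2) * (ψ a ^ 4 - 1) - 2 := by ring
    rw [this]
    exact sub_mem (sub_mem h (Ideal.mul_mem_left _ _ hg)) hM2
  have hone : ∀ x : 𝓞 ℂ, 1 - x ∈ M → x ∉ M := by
    intro x hx h
    exact hnot1 (by simpa using add_mem hx h)
  have hη3 : ψ₃ η ∈ M := by
    have h := congrArg ψ₃ eη
    simp only [map_add, map_mul, map_pow, map_ofNat, map_intCast] at h
    apply hM.mem_of_pow_mem 2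
    have : ψ₃ η ^ 2 = (ψ₃ η + 2 * k) * ψ₃ θ := by linear_combination h
    rw [this]
    exact Ideal.mul_mem_left _ _ t₃
  have h2mem : ∀ ψ : 𝓞 K →+* 𝓞 ℂ, (2 : 𝓞 K) ∈ M.comap ψ := by
    intro ψ
    rw [Ideal.mem_comap, map_ofNat]
    exact hM2
  have hprime : ∀ ψ : 𝓞 K →+* 𝓞 ℂ, (M.comap ψ).IsPrime := fun ψ => Ideal.comap_isPrime ψ M
  have hsq : ∀ ψ : 𝓞 K →+* 𝓞 ℂ, ψ θ ∈ M → (2 : 𝓞 K) ∈ (M.comap ψ) ^ 2 := by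
    intro ψ ht
    have ht' : θ ∈ M.comap ψ := ht
    refine TwoFactor.two_mem_sq _ θ (a ^ 3) k (h2mem ψ) ht' ?_ eθ eβ
    apply (hprime ψ).mem_of_pow_mem 2
    have : (1 + a ^ 3) ^ 2 = (a ^ 3 + θ) * 2 := by linear_combination eβ
    rw [this]
    exact Ideal.mul_mem_left _ _ (h2mem ψ)
  have hne : ∀ (P Q : Ideal (𝓞 K)) (x : 𝓞 K), x ∈ P → x ∉ Q → P ≠ Q := by
    rintro P Q x hx hx' rfl
    exact hx' hx
  have m₁ : η ∉ M.comap ψ₁ := hone _ n₁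
  have m₂ : η ∈ M.comap ψ₂ := n₂
  have m₃ : η ∈ M.comap ψ₃ := hη3
  have m₂' : θ ∉ M.comap ψ₂ := hone _ t₂
  have m₃' : θ ∈ M.comap ψ₃ := t₃
  have l₁ : η ∉ M.comap χ₁ := by rw [Ideal.mem_comap, y₁]; exact m₁
  have l₂ : η ∈ M.comap χ₂ := by rw [Ideal.mem_comap, y₂]; exact m₂
  have l₃ : η ∈ M.comap χ₃ := by rw [Ideal.mem_comap, y₃]; exact m₃
  have l₂' : θ ∉ M.comap χ₂ := by rw [Ideal.mem_comap, x₂]; exact m₂'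
  have l₃' : θ ∈ M.comap χ₃ := by rw [Ideal.mem_comap, x₃]; exact m₃'
  have hpw : [M.comap ψ₁, M.comap ψ₂, M.comap ψ₃, M.comap χ₁, M.comap χ₂, M.comap χ₃].Pairwise
      (· ≠ ·) := by
    simp only [List.pairwise_cons, List.mem_cons, List.not_mem_nil, or_false, forall_eq_or_imp,
      forall_eq]
    refine ⟨⟨?_, ?_, ?_, ?_, ?_⟩, ⟨?_, ?_, ?_, ?_⟩, ⟨?_, ?_, ?_⟩, ⟨?_, ?_⟩, ?_, ?_⟩
    · exact (hne _ _ _ m₂ m₁).symm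
    · exact (hne _ _ _ m₃ m₁).symm
    · exact (hne _ _ _ z₁ (hg1 _ g₁)).symm
    · exact (hne _ _ _ z₂ (hg1 _ g₁)).symm
    · exact (hne _ _ _ z₃ (hg1 _ g₁)).symm
    · exact (hne _ _ _ m₃' m₂').symm
    · exact (hne _ _ _ z₁ (hg1 _ g₂)).symm
    · exact (hne _ _ _ z₂ (hg1 _ g₂)).symm
    · exact (hne _ _ _ z₃ (hg1 _ g₂)).symm
    · exact (hne _ _ _ z₁ (hg1 _ g₃)).symm
    · exact (hne _ _ _ z₂ (hg1 _ g₃)).symm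
    · exact (hne _ _ _ z₃ (hg1 _ g₃)).symm
    · exact (hne _ _ _ l₂ l₁).symm
    · exact (hne _ _ _ l₃ l₁).symm
    · exact (hne _ _ _ l₃' l₂').symm
    · simp
  refine ⟨M.comap ψ₁, M.comap ψ₂, M.comap ψ₃, M.comap χ₁, M.comap χ₂, M.comap χ₃, hpw,
    hprime _, hprime _, hprime _, hprime _, hprime _, hprime _, ?_⟩
  exact TwoFactor.count hK (a ^ 4) _ _ _ _ _ _ (hprime _) (hprime _) (hprime _) (hprime _)
    (hprime _) (hprime _) (h2mem _) (h2mem _) (hsq _ t₃) (h2mem _) (h2mem _) (hsq _ l₃')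
    z₁ z₂ z₃ hpw
end

section
/- Let m be a squarefree rational integer with m ∉ {0, 1, -1}, α a complex root of the irreducible polynomial x^12 − m, K = ℚ(α), and Z_K the ring of integers of K. If m ≡ 9 (mod 16), then 2Z_K = 𝔭₁𝔭₂²𝔮₁𝔮₂𝔮₃², where 𝔭₁, 𝔭₂, 𝔮₁, 𝔮₂, 𝔮₃ are five pairwise distinct prime ideals of Z_K, with residue degrees f(𝔭₁) = 2, f(𝔭₂) = 1, and f(𝔮₁) = f(𝔮₂) = f(𝔮₃) = 2. -/
open Polynomial NumberField

set_option linter.unusedSimpArgs false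
set_option linter.unusedVariables false

namespace TwoNine

theorem absNorm_two (K : Type*) [Field K] [NumberField K] :
    Ideal.absNorm (Ideal.span {(2 : 𝓞 K)}) = 2 ^ Module.finrank ℚ K := by
  rw [Ideal.absNorm_span_singleton, ← RingOfIntegers.rank K]
  have := Algebra.norm_algebraMap (S := 𝓞 K) (2:ℤ)
  simp at this
  rw [this]; simp [Int.natAbs_pow]

theorem fin12 (m : ℤ) (hsf : Squarefree m)
    (h0 : m ≠ 0) (h1 : m ≠ 1) (h2 : m ≠ -1) : Irreducible (X ^ 12 - C (m:ℚ)) := by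
  have hu : ¬ IsUnit m := by rw [Int.isUnit_iff]; tauto
  obtain ⟨p, hp, hpm⟩ := WfDvdMonoid.exists_irreducible_factor hu h0
  have hp' : Prime p := hp.prime
  have hmon : (X ^ 12 - C m : ℤ[X]).Monic := monic_X_pow_sub_C m (by norm_num)
  have : Irreducible (X ^ 12 - C m : ℤ[X]) := by
    have hE : (X ^ 12 - C m : ℤ[X]).IsEisensteinAt (Ideal.span {p}) := by
      refine ⟨?_, ?_, ?_⟩
      · rw [hmon.leadingCoeff, Ideal.mem_span_singleton]
        exact fun h => hp.not_isUnit (isUnit_of_dvd_one h)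
      · intro n hn
        rw [natDegree_X_pow_sub_C] at hn
        rw [Ideal.mem_span_singleton, coeff_sub, coeff_X_pow, coeff_C]
        rw [if_neg (by omega)]
        split_ifs
        · simpa using hpm
        · simp
      · rw [Ideal.span_singleton_pow, Ideal.mem_span_singleton]
        simp only [coeff_sub, coeff_X_pow, coeff_C]
        simp only [if_true]
        norm_num
        intro h
        exact hp.not_isUnit (hsf p (by rwa [← sq]))
    refine hE.irreducible ?_ hmon.isPrimitive (by rw [natDegree_X_pow_sub_C]; norm_num)
    rw [Ideal.span_singleton_prime hp.ne_zero]; exact hp'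
  have := (Polynomial.Monic.irreducible_iff_irreducible_map_fraction_map (K := ℚ) hmon).1 this
  simpa using this

/-- Monic quadratic equations have integral roots. -/
theorem exists_int (K : Type*) [Field K] (a b : 𝓞 K) (x : K)
    (h : x ^ 2 + algebraMap (𝓞 K) K a * x + algebraMap (𝓞 K) K b = 0) :
    ∃ y : 𝓞 K, algebraMap (𝓞 K) K y = x := by
  have hx : IsIntegral (𝓞 K) x := by
    refine ⟨X ^ 2 + C a * X + C b, ?_, ?_⟩
    · monicity!
    · simpa [eval₂_add, eval₂_mul, eval₂_pow] using h
  have : IsIntegral ℤ x := isIntegral_trans (R := ℤ) (A := 𝓞 K) x hx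
  exact ⟨⟨x, this⟩, rfl⟩

/-- The three integral elements. -/
theorem exists_elements (m n : ℤ) (hm : m = 1 - 8 * n)
    (K : Type*) [Field K] [NumberField K] (α : K) (hroot : α ^ 12 = (m : K)) :
    ∃ A T Y : 𝓞 K, algebraMap (𝓞 K) K A = α ∧ A ^ 12 = (m : 𝓞 K) ∧ 2 * T = 1 + A ^ 6 ∧
      2 * Y = T * (1 + A ^ 3) := by
  have hα : IsIntegral ℤ α := by
    refine IsIntegral.of_pow (n := 12) (by norm_num) ?_
    rw [hroot]
    exact isIntegral_algebraMap (R := ℤ) (x := m)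
  subst hm
  push_cast at hroot
  let A : 𝓞 K := ⟨α, hα⟩
  have hA : algebraMap (𝓞 K) K A = α := rfl
  have inj : Function.Injective (algebraMap (𝓞 K) K) := FaithfulSMul.algebraMap_injective _ _
  obtain ⟨T, hT⟩ := exists_int K (-1) ((2 * n : ℤ) : 𝓞 K) ((1 + α ^ 6) / 2) (by
    simp only [map_mul, map_neg, map_one, map_intCast]
    push_cast
    linear_combination hroot / 4)
  have hT2 : 2 * algebraMap (𝓞 K) K T = 1 + α ^ 6 := by rw [hT]; ring
  obtain ⟨Y, hY⟩ := exists_int K (-T) ((n : 𝓞 K) * T) (algebraMap (𝓞 K) K T * (1 + α ^ 3) / 2) (by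
    simp only [map_mul, map_neg, map_intCast]
    rw [hT]
    linear_combination hroot * (1 + α ^ 6) / 16)
  refine ⟨A, T, Y, rfl, ?_, ?_, ?_⟩
  · apply inj; simp only [map_mul, map_add, map_sub, map_neg, map_zero, map_one, map_pow, map_ofNat, map_intCast]; rw [hA, hroot]; push_cast; rfl
  · apply inj; simp only [map_mul, map_add, map_sub, map_neg, map_zero, map_one, map_pow, map_ofNat, map_intCast]; rw [hA, hT2]
  · apply inj; simp only [map_mul, map_add, map_sub, map_neg, map_zero, map_one, map_pow, map_ofNat, map_intCast]; rw [hA, hY]; ring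

/-- Extending to the algebraic closure. -/
theorem exists_hom (m : ℤ) (hirr : Irreducible (X ^ 12 - C (m : ℚ)))
    (K L : Type*) [Field K] [NumberField K] [Field L] [Algebra ℚ L] [IsAlgClosed L] (A : 𝓞 K)
    (hroot : (A : K) ^ 12 = (m : K)) (x : 𝓞 L) (hx : x ^ 12 = (m : 𝓞 L)) :
    ∃ φ : 𝓞 K →+* 𝓞 L, φ A = x := by
  have hmin : X ^ 12 - C (m : ℚ) = minpoly ℚ (A : K) :=
    minpoly.eq_of_irreducible_of_monic hirr (by simp [hroot])
      (monic_X_pow_sub_C _ (by norm_num))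
  have hx' : (x : L) ^ 12 = m := by
    have := congrArg (fun t : 𝓞 L => (t : L)) hx
    push_cast at this
    simpa using this
  obtain ⟨φ, hφ⟩ := IntermediateField.exists_algHom_of_splits_of_aeval (F := ℚ) (E := K) (K := L)
    (fun s => ⟨Algebra.IsIntegral.isIntegral s, IsAlgClosed.splits _⟩) (x := (A : K)) (y := (x : L))
    (by rw [← hmin]; simp [hx'])
  refine ⟨RingOfIntegers.mapRingHom φ.toRingHom, ?_⟩
  apply RingOfIntegers.ext
  simpa using hφ

section shift
variable {R O k : Type*} [CommRing R] [CommRing O] [IsDomain O] [CharZero O] [CommRing k]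
  [IsDomain k]

theorem two_cancel {a b : O} (h : 2 * a = 2 * b) : a = b :=
  mul_left_cancel₀ two_ne_zero h

theorem shift (m : ℤ) (A T Y : R) (hA : A ^ 12 = (m : R)) (hT : 2 * T = 1 + A ^ 6)
    (hY : 2 * Y = T * (1 + A ^ 3))
    (H : ∀ x : O, x ^ 12 = (m : O) → ∃ φ : R →+* O, φ A = x)
    (ρ : O →+* k) (hm : (m : k) = 1) (z : O) (hz : z ^ 2 + z + 1 = 0)
    (φ : R →+* O) (g : k) (hg : g ^ 3 = 1) :
    ∃ φ' : R →+* O, φ' T = φ T ∧ φ' Y = φ Y ∧ ρ (φ' A) ^ 4 = g := by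
  have hz3 : z ^ 3 = 1 := by linear_combination (z - 1) * hz
  have key : ∀ w : O, w ^ 3 = 1 → ρ (φ A) ^ 4 * ρ w = g →
      ∃ φ' : R →+* O, φ' T = φ T ∧ φ' Y = φ Y ∧ ρ (φ' A) ^ 4 = g := by
    intro w hw hwg
    have hA' : φ A ^ 12 = (m : O) := by rw [← map_pow, hA, map_intCast]
    obtain ⟨φ', h'⟩ := H (φ A * w) (by
      rw [mul_pow, hA', show w ^ 12 = (w ^ 3) ^ 4 by ring, hw]; ring)
    have e1 := congrArg φ hT
    have e2 := congrArg φ' hT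
    have e3 := congrArg φ hY
    have e4 := congrArg φ' hY
    simp only [map_mul, map_add, map_one, map_pow, map_ofNat] at e1 e2 e3 e4
    have t : φ' T = φ T := two_cancel (by
      rw [e1, e2, h', mul_pow, show w ^ 6 = (w ^ 3) ^ 2 by ring, hw]; ring)
    refine ⟨φ', t, two_cancel (by rw [e3, e4, t, h', mul_pow, hw]; ring), ?_⟩
    rw [h', map_mul, mul_pow, ← hwg, show ρ w ^ 4 = ρ (w ^ 3) * ρ w by rw [map_pow]; ring, hw]
    simp
  have hρz : ρ z ^ 2 + ρ z + 1 = 0 := by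
    have := congrArg ρ hz
    simpa using this
  have hu : (ρ (φ A) ^ 4) ^ 3 = 1 := by
    have := congrArg (fun t => ρ (φ t)) hA
    simp only [map_pow, map_intCast, hm] at this
    rw [← this]; ring
  generalize ρ (φ A) ^ 4 = u at *
  have : (u * ρ 1 - g) * ((u * ρ z - g) * (u * ρ (z ^ 2) - g)) = 0 := by
    simp only [map_pow, map_one]
    linear_combination hu - hg +
      (u ^ 3 * (ρ z - 1) - u ^ 2 * g * ρ z + u * g ^ 2) * hρz
  rcases mul_eq_zero.1 this with h | h
  · exact key 1 (by simp) (sub_eq_zero.1 h)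
  rcases mul_eq_zero.1 h with h | h
  · exact key z hz3 (sub_eq_zero.1 h)
  · exact key (z ^ 2) (by rw [← pow_mul, mul_comm, pow_mul, hz3]; simp) (sub_eq_zero.1 h)

theorem flip (m : ℤ) (A T : R) (hA : A ^ 12 = (m : R)) (hT : 2 * T = 1 + A ^ 6)
    (H : ∀ x : O, x ^ 12 = (m : O) → ∃ φ : R →+* O, φ A = x)
    (i : O) (hi : i ^ 2 = -1) (φ : R →+* O) :
    ∃ φ' : R →+* O, φ' T = 1 - φ T := by
  have hA' : φ A ^ 12 = (m : O) := by rw [← map_pow, hA, map_intCast]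
  obtain ⟨φ', h'⟩ := H (φ A * i) (by
      rw [mul_pow, hA', show i ^ 12 = (i ^ 2) ^ 6 by ring, hi]; ring)
  have e1 := congrArg φ hT
  have e2 := congrArg φ' hT
  simp only [map_mul, map_add, map_one, map_pow, map_ofNat] at e1 e2
  refine ⟨φ', two_cancel ?_⟩
  rw [e2, h', mul_sub, e1, mul_pow, show i ^ 6 = (i ^ 2) ^ 3 by ring, hi]; ring

end shift

/-- The five homomorphisms. -/
theorem exists_five {R O k : Type*} [CommRing R] [CommRing O] [IsDomain O] [CharZero O]
    [CommRing k] [IsDomain k] [IsDomain R] [CharZero R]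
    (m n : ℤ) (hmn : m = 1 - 8 * n) (hn : Odd n) (A T Y : R) (hA : A ^ 12 = (m : R))
    (hT : 2 * T = 1 + A ^ 6) (hY : 2 * Y = T * (1 + A ^ 3))
    (H : ∀ x : O, x ^ 12 = (m : O) → ∃ φ : R →+* O, φ A = x)
    (ρ : O →+* k) (h2 : (2 : k) = 0) (z i x : O) (hz : z ^ 2 + z + 1 = 0) (hi : i ^ 2 = -1)
    (hx : x ^ 12 = (m : O)) :
    ∃ c₁ c₂ c₃ c₄ c₅ : R →+* k,
      (c₁ T = 1 ∧ c₁ A ^ 4 = 1 ∧ c₁ Y ^ 2 + c₁ Y + 1 = 0) ∧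
      (c₂ T = 0 ∧ c₂ A ^ 4 = 1) ∧
      (c₃ T = 1 ∧ c₃ A ^ 4 = c₃ Y ∧ c₃ Y ^ 2 + c₃ Y + 1 = 0) ∧
      (c₄ T = 1 ∧ c₄ A ^ 4 = c₄ Y + 1 ∧ c₄ Y ^ 2 + c₄ Y + 1 = 0) ∧
      (c₅ T = 0 ∧ (c₅ A ^ 4) ^ 2 + c₅ A ^ 4 + 1 = 0) := by
  have hmk : (m : k) = 1 := by
    rw [hmn]; push_cast; linear_combination (-4 * (n : k)) * h2
  have hnk : (n : k) = 1 := by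
    obtain ⟨j, rfl⟩ := hn
    push_cast; linear_combination (j : k) * h2
  have hA' : A ^ 12 = 1 - 8 * (n : R) := by rw [hA, hmn]; push_cast; ring
  have hTT : T ^ 2 - T + 2 * (n : R) = 0 := by
    apply two_cancel; apply two_cancel
    linear_combination (2 * T + A ^ 6 - 1) * hT + hA'
  have hYY : Y ^ 2 - T * Y + n * T = 0 := by
    apply two_cancel; apply two_cancel
    linear_combination (2 * Y + T * (1 + A ^ 3) - 2 * T) * hY - T ^ 2 * hT + 2 * T * hTT
  have hTc : ∀ c : R →+* k, c T = 0 ∨ c T = 1 := by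
    intro c
    have := congrArg c hTT
    simp only [map_mul, map_add, map_sub, map_zero, map_pow, map_ofNat, map_intCast] at this
    have h : c T * (c T - 1) = 0 := by linear_combination this - (n : k) * h2
    rcases mul_eq_zero.1 h with h | h
    · exact Or.inl h
    · exact Or.inr (sub_eq_zero.1 h)
  have hYc : ∀ c : R →+* k, c T = 1 → c Y ^ 2 + c Y + 1 = 0 := by
    intro c hc
    have := congrArg c hYY
    simp only [map_mul, map_add, map_sub, map_zero, map_pow, map_intCast, hc, hnk] at this
    linear_combination this + c Y * h2
  obtain ⟨φ₀, -⟩ := H x hx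
  obtain ⟨φ₁, hφ₁⟩ := flip m A T hA hT H i hi φ₀
  obtain ⟨f, g, hf, hg⟩ : ∃ f g : R →+* O, ρ (f T) = 0 ∧ ρ (g T) = 1 := by
    rcases hTc (ρ.comp φ₀) with h | h
    · exact ⟨φ₀, φ₁, h, by rw [hφ₁, map_sub, map_one]; simpa using h⟩
    · exact ⟨φ₁, φ₀, by rw [hφ₁, map_sub, map_one]; simpa [sub_eq_zero] using h.symm, h⟩
  have hgY : ρ (g Y) ^ 2 + ρ (g Y) + 1 = 0 := hYc (ρ.comp g) hg
  have S := shift m A T Y hA hT hY H ρ hmk z hz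
  have hρz : ρ z ^ 2 + ρ z + 1 = 0 := by
    have := congrArg ρ hz
    simpa using this
  obtain ⟨f₁, a₁, b₁, d₁⟩ := S g 1 (by simp)
  obtain ⟨f₂, a₂, b₂, d₂⟩ := S f 1 (by simp)
  obtain ⟨f₃, a₃, b₃, d₃⟩ := S g (ρ (g Y)) (by linear_combination (ρ (g Y) - 1) * hgY)
  obtain ⟨f₄, a₄, b₄, d₄⟩ := S g (ρ (g Y) + 1) (by
    linear_combination (ρ (g Y) + 2) * hgY - h2)
  obtain ⟨f₅, a₅, b₅, d₅⟩ := S f (ρ z) (by linear_combination (ρ z - 1) * hρz)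
  refine ⟨ρ.comp f₁, ρ.comp f₂, ρ.comp f₃, ρ.comp f₄, ρ.comp f₅, ?_⟩
  simp only [RingHom.comp_apply, a₁, a₂, a₃, a₄, a₅, b₁, b₃, b₄, d₁, d₂, d₃, d₄, d₅]
  exact ⟨⟨hg, trivial, hgY⟩, ⟨hf, trivial⟩, ⟨hg, trivial, hgY⟩, ⟨hg, trivial, hgY⟩, ⟨hf, hρz⟩⟩

/-- A residue field containing a primitive cube root of unity does not have two elements. -/
theorem absNorm_ne_two {K : Type*} [Field K] [NumberField K] (P : Ideal (𝓞 K)) [P.IsMaximal]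
    (h2 : (2 : 𝓞 K) ∈ P) (u : 𝓞 K) (hu : u ^ 2 + u + 1 ∈ P) : Ideal.absNorm P ≠ 2 := by
  intro h
  rw [Ideal.absNorm_apply, Submodule.cardQuot_apply] at h
  let : Field (𝓞 K ⧸ P) := Ideal.Quotient.field P
  have : Finite (𝓞 K ⧸ P) := Nat.finite_of_card_ne_zero (by rw [h]; norm_num)
  let := Fintype.ofFinite (𝓞 K ⧸ P)
  have e := FiniteField.pow_card (Ideal.Quotient.mk P u)
  rw [← Nat.card_eq_fintype_card, h] at e
  have e1 := Ideal.Quotient.eq_zero_iff_mem.2 h2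
  have e2 := Ideal.Quotient.eq_zero_iff_mem.2 hu
  simp only [map_add, map_pow, map_one, map_ofNat] at e1 e2
  have : (1 : 𝓞 K ⧸ P) = 0 := by
    linear_combination e2 - e - (Ideal.Quotient.mk P u) * e1
  exact one_ne_zero this

/-- There is a residue field of characteristic two of the algebraic integers, with the needed
elements. -/
theorem exists_residue (m : ℤ) : ∃ M : Ideal (𝓞 (AlgebraicClosure ℚ)), M.IsMaximal ∧
    (2 : 𝓞 (AlgebraicClosure ℚ)) ∈ M ∧
    ∃ z i x : 𝓞 (AlgebraicClosure ℚ), z ^ 2 + z + 1 = 0 ∧ i ^ 2 = -1 ∧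
      x ^ 12 = (m : 𝓞 (AlgebraicClosure ℚ)) := by
  set L := AlgebraicClosure ℚ
  have : (Ideal.span {(2 : ℤ)}).IsMaximal :=
    PrincipalIdealRing.isMaximal_of_irreducible Int.prime_two.irreducible
  obtain ⟨M, hM, hM2⟩ := Ideal.exists_maximal_ideal_liesOver_of_isIntegral (S := 𝓞 L)
    (Ideal.span {(2 : ℤ)})
  refine ⟨M, hM, ?_, ?_⟩
  · have h : (2 : ℤ) ∈ Ideal.span {(2 : ℤ)} := Ideal.mem_span_singleton_self 2
    rw [hM2.over, Ideal.under_def, Ideal.mem_comap] at h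
    simpa using h
  · have inj : Function.Injective (algebraMap (𝓞 L) L) := FaithfulSMul.algebraMap_injective _ _
    obtain ⟨i, hi⟩ := IsAlgClosed.exists_pow_nat_eq (-1 : L) (n := 2) (by norm_num)
    obtain ⟨w, hw⟩ := IsAlgClosed.exists_pow_nat_eq (-3 : L) (n := 2) (by norm_num)
    obtain ⟨x, hx⟩ := IsAlgClosed.exists_pow_nat_eq (m : L) (n := 12) (by norm_num)
    obtain ⟨i', hi'⟩ := exists_int L 0 1 i (by simp only [map_zero, map_one]; linear_combination hi)
    have hz : ((-1 + w) / 2) ^ 2 + ((-1 + w) / 2) + 1 = 0 := by linear_combination hw / 4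
    obtain ⟨z', hz'⟩ := exists_int L 1 1 ((-1 + w) / 2) (by simp only [map_one]; linear_combination hz)
    have hxi : IsIntegral ℤ x := by
      refine IsIntegral.of_pow (n := 12) (by norm_num) ?_
      rw [hx]
      exact isIntegral_algebraMap (R := ℤ) (x := m)
    refine ⟨z', i', ⟨x, hxi⟩, ?_, ?_, ?_⟩
    · apply inj; simp only [map_mul, map_add, map_sub, map_neg, map_zero, map_one, map_pow, map_ofNat, map_intCast]; rw [hz', hz]
    · apply inj; simp only [map_mul, map_add, map_sub, map_neg, map_zero, map_one, map_pow, map_ofNat, map_intCast]; rw [hi', hi]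
    · apply inj; simp only [map_mul, map_add, map_sub, map_neg, map_zero, map_one, map_pow, map_ofNat, map_intCast]; exact hx

/-- Ramification. -/
theorem two_mem_sq {K : Type*} [Field K] [NumberField K] (P : Ideal (𝓞 K)) [P.IsPrime]
    (m : ℤ) (A T : 𝓞 K) (hA : A ^ 12 = (m : 𝓞 K)) (hT : 2 * T = 1 + A ^ 6)
    (h2 : (2 : 𝓞 K) ∈ P) (hm : Odd m) (hTP : T ∈ P) : (2 : 𝓞 K) ∈ P ^ 2 := by
  have hAP : A ∉ P := by
    intro h
    apply ‹P.IsPrime›.one_notMem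
    have h' : (1 : 𝓞 K) = 2 * T - A ^ 5 * A := by linear_combination -hT
    rw [h']
    exact P.sub_mem (P.mul_mem_left _ hTP) (P.mul_mem_left _ h)
  have h : A ^ 6 = 2 * T - 1 := by linear_combination -hT
  have hB : A ^ 3 - 1 ∈ P := by
    apply ‹P.IsPrime›.mem_of_pow_mem 2
    have : (A ^ 3 - 1) ^ 2 = 2 * (T - A ^ 3) := by linear_combination h
    rw [this]
    exact P.mul_mem_right _ h2
  have hmem : (T - A ^ 3) * 2 ∈ P ^ 2 := by
    have : (T - A ^ 3) * 2 = (A ^ 3 - 1) ^ 2 := by linear_combination -h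
    rw [this]
    exact Ideal.pow_mem_pow hB 2
  rcases Ideal.IsPrime.mul_mem_pow P hmem with h' | h'
  · exfalso
    apply hAP
    apply ‹P.IsPrime›.mem_of_pow_mem 3
    have := P.sub_mem hTP h'
    simpa using this
  · exact h'

end TwoNine

/-- If `m ≡ 9 (mod 16)` (with `m` squarefree, `m ∉ {0,1,-1}`, `K = ℚ(α)`, `α^12 = m`),
then `2 Z_K = 𝔭₁𝔭₂²𝔮₁𝔮₂𝔮₃²` with five pairwise distinct prime ideals, where `𝔭₁` has
residue degree `2` (absolute norm `4`), `𝔭₂` has residue degree `1` (absolute norm `2`),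
and `𝔮₁, 𝔮₂, 𝔮₃` have residue degree `2` (absolute norm `4`). -/
theorem factorization_two_of_nine_mod_sixteen (m : ℤ) (hsf : Squarefree m)
    (h0 : m ≠ 0) (h1 : m ≠ 1) (h2 : m ≠ -1)
    (K : Type*) [Field K] [NumberField K] (α : K)
    (hroot : α ^ 12 = (m : K))
    (hgen : IntermediateField.adjoin ℚ {α} = ⊤)
    (hmod : m ≡ 9 [ZMOD 16]) :
    ∃ p₁ p₂ q₁ q₂ q₃ : Ideal (𝓞 K),
      [p₁, p₂, q₁, q₂, q₃].Pairwise (· ≠ ·) ∧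
      p₁.IsPrime ∧ p₂.IsPrime ∧ q₁.IsPrime ∧ q₂.IsPrime ∧ q₃.IsPrime ∧
      Ideal.absNorm p₁ = 2 ^ 2 ∧ Ideal.absNorm p₂ = 2 ∧
      Ideal.absNorm q₁ = 2 ^ 2 ∧ Ideal.absNorm q₂ = 2 ^ 2 ∧ Ideal.absNorm q₃ = 2 ^ 2 ∧
      Ideal.span {(2 : 𝓞 K)} = p₁ * p₂ ^ 2 * q₁ * q₂ * q₃ ^ 2 := by
  have hirr := TwoNine.fin12 m hsf h0 h1 h2
  have hmin : X ^ 12 - C (m : ℚ) = minpoly ℚ α :=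
    minpoly.eq_of_irreducible_of_monic hirr (by simp [hroot])
      (monic_X_pow_sub_C _ (by norm_num))
  have hfin : Module.finrank ℚ K = 12 := by
    have := IntermediateField.adjoin.finrank (K := ℚ) (x := α) (Algebra.IsIntegral.isIntegral α)
    rw [← hmin, natDegree_X_pow_sub_C, hgen, IntermediateField.finrank_top'] at this
    exact this
  obtain ⟨n, hmn, hn⟩ : ∃ n : ℤ, m = 1 - 8 * n ∧ Odd n := by
    have h := hmod
    unfold Int.ModEq at h
    exact ⟨(1 - m) / 8, by omega, by rw [Int.odd_iff]; omega⟩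
  have hmodd : Odd m := by rw [Int.odd_iff]; omega
  obtain ⟨A, T, Y, hAα, hA, hT, hY⟩ := TwoNine.exists_elements m n hmn K α hroot
  obtain ⟨M, hM, hM2, z, i, x, hz, hi, hx⟩ := TwoNine.exists_residue m
  have H := TwoNine.exists_hom m hirr K (AlgebraicClosure ℚ) A (by rw [← hroot, ← hAα])
  have hk2 : (2 : 𝓞 (AlgebraicClosure ℚ) ⧸ M) = 0 := by
    have := Ideal.Quotient.eq_zero_iff_mem.2 hM2
    rwa [map_ofNat] at this
  obtain ⟨c₁, c₂, c₃, c₄, c₅, ⟨t₁, a₁, y₁⟩, ⟨t₂, a₂⟩, ⟨t₃, a₃, y₃⟩, ⟨t₄, a₄, y₄⟩, ⟨t₅, a₅⟩⟩ :=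
    TwoNine.exists_five m n hmn hn A T Y hA hT hY H (Ideal.Quotient.mk M) hk2 z i x hz hi hx
  have hn3 : (3 : 𝓞 (AlgebraicClosure ℚ) ⧸ M) ≠ 0 := by
    intro h
    exact one_ne_zero (α := 𝓞 (AlgebraicClosure ℚ) ⧸ M) (by linear_combination h - hk2)
  have hmem2 : ∀ c : 𝓞 K →+* (𝓞 (AlgebraicClosure ℚ) ⧸ M), (2 : 𝓞 K) ∈ RingHom.ker c := by
    intro c
    rw [RingHom.mem_ker, map_ofNat, hk2]
  have hprime : ∀ c : 𝓞 K →+* (𝓞 (AlgebraicClosure ℚ) ⧸ M), (RingHom.ker c).IsPrime :=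
    fun c => RingHom.ker_isPrime c
  have hmax : ∀ c : 𝓞 K →+* (𝓞 (AlgebraicClosure ℚ) ⧸ M), (RingHom.ker c).IsMaximal := by
    intro c
    refine (hprime c).isMaximal ?_
    intro h
    have := hmem2 c
    rw [h, Ideal.mem_bot] at this
    exact two_ne_zero this
  have hnorm : ∀ c : 𝓞 K →+* (𝓞 (AlgebraicClosure ℚ) ⧸ M),
      ∃ r : ℕ, 1 ≤ r ∧ Ideal.absNorm (RingHom.ker c) = 2 ^ r := by
    intro c
    have hle : Ideal.span {(2 : 𝓞 K)} ≤ RingHom.ker c := by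
      rw [Ideal.span_singleton_le_iff_mem]; exact hmem2 c
    have := Ideal.absNorm_dvd_absNorm_of_le hle
    rw [TwoNine.absNorm_two] at this
    obtain ⟨r, -, hr⟩ := (Nat.dvd_prime_pow Nat.prime_two).1 this
    refine ⟨r, ?_, hr⟩
    by_contra h
    have h0 : r = 0 := by omega
    rw [h0, pow_zero, Ideal.absNorm_eq_one_iff] at hr
    exact (hprime c).ne_top hr
  have hnorm2 : ∀ (c : 𝓞 K →+* (𝓞 (AlgebraicClosure ℚ) ⧸ M)) (u : 𝓞 K),
      c u ^ 2 + c u + 1 = 0 → ∃ r : ℕ, 2 ≤ r ∧ Ideal.absNorm (RingHom.ker c) = 2 ^ r := by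
    intro c u hu
    obtain ⟨r, hr, hr'⟩ := hnorm c
    refine ⟨r, ?_, hr'⟩
    by_contra h
    have h1 : r = 1 := by omega
    have := hmax c
    refine TwoNine.absNorm_ne_two (RingHom.ker c) (hmem2 c) u ?_ (by rw [hr', h1, pow_one])
    rw [RingHom.mem_ker]; simpa using hu
  obtain ⟨r₁, hr₁, e₁⟩ := hnorm2 c₁ Y y₁
  obtain ⟨r₂, hr₂, e₂⟩ := hnorm c₂
  obtain ⟨r₃, hr₃, e₃⟩ := hnorm2 c₃ Y y₃
  obtain ⟨r₄, hr₄, e₄⟩ := hnorm2 c₄ Y y₄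
  obtain ⟨r₅, hr₅, e₅⟩ := hnorm2 c₅ (A ^ 4) (by simpa using a₅)
  -- distinctness
  have hsep : ∀ (c d : 𝓞 K →+* (𝓞 (AlgebraicClosure ℚ) ⧸ M)) (u : 𝓞 K), c u = 0 → d u ≠ 0 →
      RingHom.ker c ≠ RingHom.ker d := by
    intro c d u hc hd h
    apply hd
    rw [← RingHom.mem_ker, ← h, RingHom.mem_ker, hc]
  have n12 : RingHom.ker c₁ ≠ RingHom.ker c₂ :=
    (hsep c₂ c₁ T t₂ (by rw [t₁]; exact one_ne_zero)).symm
  have n32 : RingHom.ker c₃ ≠ RingHom.ker c₂ :=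
    (hsep c₂ c₃ T t₂ (by rw [t₃]; exact one_ne_zero)).symm
  have n42 : RingHom.ker c₄ ≠ RingHom.ker c₂ :=
    (hsep c₂ c₄ T t₂ (by rw [t₄]; exact one_ne_zero)).symm
  have n15 : RingHom.ker c₁ ≠ RingHom.ker c₅ :=
    (hsep c₅ c₁ T t₅ (by rw [t₁]; exact one_ne_zero)).symm
  have n35 : RingHom.ker c₃ ≠ RingHom.ker c₅ :=
    (hsep c₅ c₃ T t₅ (by rw [t₃]; exact one_ne_zero)).symm
  have n45 : RingHom.ker c₄ ≠ RingHom.ker c₅ :=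
    (hsep c₅ c₄ T t₅ (by rw [t₄]; exact one_ne_zero)).symm
  have n34 : RingHom.ker c₃ ≠ RingHom.ker c₄ :=
    hsep c₃ c₄ (A ^ 4 - Y) (by simp [a₃]) (by simp [a₄])
  have n13 : RingHom.ker c₁ ≠ RingHom.ker c₃ := by
    refine hsep c₁ c₃ (A ^ 4 - 1) (by simp [a₁]) ?_
    intro h
    simp only [map_sub, map_pow, map_one, a₃] at h
    apply hn3
    linear_combination y₃ - (c₃ Y + 2) * h
  have n14 : RingHom.ker c₁ ≠ RingHom.ker c₄ := by
    refine hsep c₁ c₄ (A ^ 4 - 1) (by simp [a₁]) ?_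
    intro h
    simp only [map_sub, map_pow, map_one, a₄] at h
    apply one_ne_zero (α := 𝓞 (AlgebraicClosure ℚ) ⧸ M)
    linear_combination y₄ - (c₄ Y + 1) * h
  have n25 : RingHom.ker c₂ ≠ RingHom.ker c₅ := by
    refine hsep c₂ c₅ (A ^ 4 - 1) (by simp [a₂]) ?_
    intro h
    simp only [map_sub, map_pow, map_one] at h
    apply hn3
    linear_combination a₅ - (c₅ A ^ 4 + 2) * h
  -- divisibility
  have d : ∀ c : 𝓞 K →+* (𝓞 (AlgebraicClosure ℚ) ⧸ M),
      RingHom.ker c ∣ Ideal.span {(2 : 𝓞 K)} := by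
    intro c
    rw [Ideal.dvd_span_singleton]; exact hmem2 c
  have dd : ∀ c : 𝓞 K →+* (𝓞 (AlgebraicClosure ℚ) ⧸ M), c T = 0 →
      RingHom.ker c ^ 2 ∣ Ideal.span {(2 : 𝓞 K)} := by
    intro c hc
    rw [Ideal.dvd_span_singleton]
    have := hprime c
    exact TwoNine.two_mem_sq _ m A T hA hT (hmem2 c) hmodd hc
  have cop : ∀ c d : 𝓞 K →+* (𝓞 (AlgebraicClosure ℚ) ⧸ M), RingHom.ker c ≠ RingHom.ker d →
      IsCoprime (RingHom.ker c) (RingHom.ker d) := by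
    intro c d h
    have := hmax c
    have := hmax d
    exact Ideal.isCoprime_of_isMaximal h
  have hdvd : RingHom.ker c₁ * RingHom.ker c₂ ^ 2 * RingHom.ker c₃ * RingHom.ker c₄ *
      RingHom.ker c₅ ^ 2 ∣ Ideal.span {(2 : 𝓞 K)} := by
    refine IsCoprime.mul_dvd ?_ (IsCoprime.mul_dvd ?_ (IsCoprime.mul_dvd ?_
      (IsCoprime.mul_dvd ?_ (d c₁) (dd c₂ t₂)) (d c₃)) (d c₄)) (dd c₅ t₅)
    · exact IsCoprime.pow_right (((((cop _ _ n15)).mul_left ((cop _ _ n25).pow_left)).mul_left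
        (cop _ _ n35)).mul_left (cop _ _ n45))
    · exact ((cop _ _ n14).mul_left ((cop _ _ n42.symm).pow_left)).mul_left (cop _ _ n34)
    · exact (cop _ _ n13).mul_left ((cop _ _ n32.symm).pow_left)
    · exact (cop _ _ n12).pow_right
  obtain ⟨J, hJ⟩ := hdvd
  have hN := congrArg Ideal.absNorm hJ
  rw [TwoNine.absNorm_two, hfin] at hN
  simp only [map_mul, map_pow, e₁, e₂, e₃, e₄, e₅] at hN
  obtain ⟨j, -, hj⟩ := (Nat.dvd_prime_pow Nat.prime_two).1 (Dvd.intro_left _ hN.symm)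
  rw [hj] at hN
  have hexp : 12 = r₁ + r₂ * 2 + r₃ + r₄ + r₅ * 2 + j := by
    apply Nat.pow_right_injective (le_refl 2)
    simp only [pow_add, pow_mul]
    exact hN
  have s₁ : r₁ = 2 := by omega
  have s₂ : r₂ = 1 := by omega
  have s₃ : r₃ = 2 := by omega
  have s₄ : r₄ = 2 := by omega
  have s₅ : r₅ = 2 := by omega
  have s₆ : j = 0 := by omega
  rw [s₆, pow_zero, Ideal.absNorm_eq_one_iff] at hj
  rw [hj, Ideal.mul_top] at hJ
  subst s₁ s₂ s₃ s₄ s₅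
  refine ⟨RingHom.ker c₁, RingHom.ker c₂, RingHom.ker c₃, RingHom.ker c₄, RingHom.ker c₅, ?_,
    hprime _, hprime _, hprime _, hprime _, hprime _, e₁, by simpa using e₂, e₃, e₄, e₅, hJ⟩
  simp only [List.pairwise_cons, List.mem_cons, List.not_mem_nil, or_false, forall_eq_or_imp,
    forall_eq, false_imp_iff, implies_true, List.Pairwise.nil, and_true]
  exact ⟨⟨n12, n13, n14, n15⟩, ⟨n32.symm, n42.symm, n25⟩, ⟨n34, n35⟩, n45⟩
end

section
/- Let m be a squarefree rational integer with m ∉ {0, 1, -1}, α a complex root of the irreducible polynomial x^12 − m, K = ℚ(α), and Z_K the ring of integers of K. If m ≡ 5 (mod 8), then 2Z_K = 𝔭₁²𝔭₂²𝔭₃², where 𝔭₁, 𝔭₂, 𝔭₃ are three pairwise distinct prime ideals of Z_K, each with residue degree 2. -/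
open Polynomial NumberField

theorem idealsA {R : Type*} [CommRing R] (j : ℤ) (s θ : R)
    (hs : s^2 = 2*θ-1) (hθ : θ^2 = θ + 2*(j:R)+1) :
    Ideal.span {(2:R)} = Ideal.span {(2:R), s-1} ^ 2 := by
  rw [pow_two, Ideal.span_pair_mul_span_pair]
  apply le_antisymm
  · rw [Ideal.span_singleton_le_iff_mem]
    -- (s-1)^2 = 2(θ-s); θ(θ-1)=2j+1
    have : (2:R) = θ * ((s-1)*(s-1)) + θ * (2*(s-1)) - (j:R) * (2*2) := by
      linear_combination (-θ) * hs - 2 * hθ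
    have h : θ * ((s-1)*(s-1)) + θ * (2*(s-1)) - (j:R) * (2*2) ∈
        Ideal.span {(2:R)*2, 2*(s-1), (s-1)*2, (s-1)*(s-1)} := by
      refine Ideal.sub_mem _ (Ideal.add_mem _ ?_ ?_) ?_ <;>
      exact Ideal.mul_mem_left _ _ (Ideal.subset_span (by simp))
    rwa [← this] at h
  · rw [Ideal.span_le]
    rintro x (rfl | rfl | rfl | rfl) <;> simp only [SetLike.mem_coe, Ideal.mem_span_singleton]
    · exact ⟨2, rfl⟩
    · exact ⟨_, rfl⟩
    · exact ⟨s-1, by ring⟩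
    · exact ⟨θ - s, by linear_combination hs⟩

theorem idealsB {R : Type*} [CommRing R] (j : ℤ) (s θ b : R)
    (hθ : θ^2 = θ + 2*(j:R)+1) (hb : b^3 = 8*(j:R)+5) :
    Ideal.span {(2:R), s-1} = 
      Ideal.span {(2:R), s-1, b-1} * Ideal.span {(2:R), s-1, b-θ} * Ideal.span {(2:R), s-1, b-(θ+1)} ∧ 
      Ideal.span {(2:R), s-1, b-1} ⊔ Ideal.span {(2:R), s-1, b-θ} = ⊤ ∧ 
      Ideal.span {(2:R), s-1, b-1} ⊔ Ideal.span {(2:R), s-1, b-(θ+1)} = ⊤ ∧ 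
      Ideal.span {(2:R), s-1, b-θ} ⊔ Ideal.span {(2:R), s-1, b-(θ+1)} = ⊤ := by
  have key : ∀ t u v w : R, v * (t - u) + 2 * w = 1 → 
      Ideal.span {(2:R), s-1, b-t} ⊔ Ideal.span {(2:R), s-1, b-u} = ⊤ := by
    intro t u v w h
    rw [Ideal.eq_top_iff_one, ← h, show v * (t-u) + 2 * w = (-v) * (b-t) + (w*2 + v * (b-u)) by ring]
    exact Ideal.add_mem _ (Ideal.mem_sup_left (Ideal.mul_mem_left _ _ (Ideal.subset_span (by simp))))
      (Ideal.mem_sup_right (Ideal.add_mem _ (Ideal.mul_mem_left _ _ (Ideal.subset_span (by simp)))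
        (Ideal.mul_mem_left _ _ (Ideal.subset_span (by simp)))))
  have h12 := key 1 θ (-θ) (-j) (by linear_combination hθ)
  have h13 := key 1 (θ+1) (-(θ-1)) (-j) (by linear_combination hθ)
  have h23 := key θ (θ+1) (-1) 0 (by ring)
  refine ⟨?_, h12, h13, h23⟩
  apply le_antisymm
  · have hc : IsCoprime (Ideal.span {(2:R), s-1, b-1} * Ideal.span {(2:R), s-1, b-θ}) (Ideal.span {(2:R), s-1, b-(θ+1)}) := 
      IsCoprime.mul_left (Ideal.isCoprime_iff_sup_eq.2 h13) (Ideal.isCoprime_iff_sup_eq.2 h23)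
    rw [Ideal.mul_eq_inf_of_coprime (Ideal.isCoprime_iff_sup_eq.1 hc), Ideal.mul_eq_inf_of_coprime h12]
    refine le_inf (le_inf ?_ ?_) ?_ <;> 
    · apply Ideal.span_mono
      intro x hx
      simp at hx ⊢
      tauto
  · have e : ∀ t : R, Ideal.span {(2:R), s-1, b-t} = Ideal.span {(2:R), s-1} ⊔ Ideal.span {b-t} := by
      intro t
      rw [← Ideal.span_union]
      congr 1
      ext x; simp; tauto
    have g : ∀ P A B : Ideal R, (P ⊔ A) * (P ⊔ B) ≤ P ⊔ A * B := by
      intro P A B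
      rw [Ideal.sup_mul, Ideal.mul_sup, Ideal.mul_sup]
      exact sup_le (le_sup_of_le_left (sup_le Ideal.mul_le_left Ideal.mul_le_left))
        (sup_le (le_sup_of_le_left Ideal.mul_le_right) le_sup_right)
    rw [e, e, e]
    refine (Ideal.mul_mono_left (g _ _ _)).trans ((g _ _ _).trans (sup_le le_rfl ?_))
    rw [Ideal.span_singleton_mul_span_singleton, Ideal.span_singleton_mul_span_singleton,
      Ideal.span_singleton_le_iff_mem]
    have : (b-1)*(b-θ)*(b-(θ+1)) = (-b^2*(1+θ)+ b*(j+1+2*θ)+4*j+2 - θ - j) * 2 := by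
      linear_combination hb + (b-1) * hθ
    rw [this]
    exact Ideal.mul_mem_left _ _ (Ideal.subset_span (by simp))

theorem four_le_card {A : Type*} [CommRing A] [Nontrivial A] [Finite A] (τ : A)
    (h2 : (2:A) = 0) (h : τ^2 = τ + 1) : 4 ≤ Nat.card A := by
  have h10 : (1:A) ≠ 0 := one_ne_zero
  have ht0 : τ ≠ 0 := by
    rintro rfl
    apply h10; linear_combination -h
  have ht1 : τ ≠ 1 := by
    rintro rfl
    apply h10; linear_combination -h
  have ht2 : τ + 1 ≠ 0 := fun h3 => ht1 (by linear_combination h3 - h2)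
  have ht3 : τ + 1 ≠ 1 := fun h3 => ht0 (by linear_combination h3)
  have ht4 : τ + 1 ≠ τ := fun h3 => h10 (by linear_combination h3)
  have hinj : Function.Injective (![0, 1, τ, τ+1] : Fin 4 → A) := by
    intro i j hij
    fin_cases i <;> fin_cases j <;> first | rfl | (exfalso; simp at hij; done) | (exfalso; simp at hij; grind)
  have := Nat.card_le_card_of_injective _ hinj
  simpa using this

theorem four_le_absNorm {K : Type*} [Field K] [NumberField K] (j : ℤ) (θ : 𝓞 K)
    (hθ : θ^2 = θ + 2*(j:𝓞 K)+1) (I : Ideal (𝓞 K)) (hI : I ≠ ⊤) (h2 : (2:𝓞 K) ∈ I) :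
    4 ≤ Ideal.absNorm I := by
  have h2' : (2 : 𝓞 K ⧸ I) = 0 := by
    have := Ideal.Quotient.eq_zero_iff_mem.2 h2
    rwa [map_ofNat] at this
  have : Nontrivial (𝓞 K ⧸ I) := Ideal.Quotient.nontrivial_iff.2 hI
  have hb : I ≠ ⊥ := by
    rintro rfl
    simp at h2
  have : Finite (𝓞 K ⧸ I) := Ideal.finiteQuotientOfFreeOfNeBot I hb
  rw [Ideal.absNorm_apply, Submodule.cardQuot_apply]
  refine four_le_card (Ideal.Quotient.mk I θ) h2' ?_
  rw [← map_pow, hθ]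
  rw [map_add, map_add, map_mul, map_ofNat, h2', map_one, zero_mul, add_zero]

theorem isPrime_of_norm {K : Type*} [Field K] [NumberField K] (j : ℤ) (θ : 𝓞 K)
    (hθ : θ^2 = θ + 2*(j:𝓞 K)+1) (I : Ideal (𝓞 K)) (hI : I ≠ ⊤) (h2 : (2:𝓞 K) ∈ I)
    (hn : Ideal.absNorm I = 2^2) : I.IsPrime := by
  obtain ⟨M, hM, hIM⟩ := Ideal.exists_le_maximal I hI
  have h4 := four_le_absNorm j θ hθ M hM.ne_top (hIM h2)
  obtain ⟨J, hJ⟩ := Ideal.dvd_iff_le.2 hIM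
  have h5 := congrArg Ideal.absNorm hJ
  rw [map_mul, hn] at h5
  have h6 : Ideal.absNorm J = 1 := by
    rcases Nat.lt_or_ge (Ideal.absNorm J) 2 with h | h
    · interval_cases Ideal.absNorm J <;> omega
    · nlinarith
  rw [Ideal.absNorm_eq_one_iff] at h6
  rw [h6, Ideal.mul_top] at hJ
  rw [hJ]; exact hM.isPrime

theorem irred (m : ℤ) (hsf : Squarefree m) (h1 : m ≠ 1) (h2 : m ≠ -1) :
    Irreducible (X ^ 12 - C (m:ℚ) : ℚ[X]) := by
  obtain ⟨p, hp, hpm⟩ := Int.exists_prime_and_dvd (n := m) (by omega)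
  have hmon : (X ^ 12 - C m : ℤ[X]).Monic := monic_X_pow_sub_C m (by norm_num)
  have hdeg : (X ^ 12 - C m : ℤ[X]).degree = 12 := degree_X_pow_sub_C (by norm_num) m
  have : Irreducible (X ^ 12 - C m : ℤ[X]) := by
    refine irreducible_of_eisenstein_criterion (P := Ideal.span {p})
      ((Ideal.span_singleton_prime hp.ne_zero).2 hp) ?_ ?_ ?_ ?_ hmon.isPrimitive
    · rw [hmon.leadingCoeff, Ideal.mem_span_singleton]
      exact hp.not_dvd_one
    · intro n hn
      rw [hdeg] at hn
      have hn : n < 12 := by exact_mod_cast hn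
      rw [Ideal.mem_span_singleton, coeff_sub, coeff_X_pow, if_neg (by omega), coeff_C]
      split_ifs <;> simp [hpm]
    · rw [hdeg]; norm_num
    · rw [Ideal.span_singleton_pow, Ideal.mem_span_singleton]
      simp only [coeff_sub, coeff_X_pow, coeff_C]
      intro h
      simp at h
      rw [pow_two] at h
      exact hp.not_isUnit (hsf p h)
  rw [hmon.irreducible_iff_irreducible_map_fraction_map (K := ℚ)] at this
  simpa using this

universe u

theorem exists_homs (m j : ℤ) (hm : m = 8 * j + 5)
    (hirr : Irreducible (X ^ 12 - C (m:ℚ) : ℚ[X]))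
    (K : Type u) [Field K] [NumberField K] (s θ b : 𝓞 K) (α : K)
    (hroot : α ^ 12 = (m : K)) (hs : (s:K) = α^3) (hb : (b:K) = α^4)
    (hθ : 2 * (θ:K) = 1 + α^6)
    (hθ2 : θ^2 = θ + 2*(j:𝓞 K)+1) :
    ∃ (F : Type u) (_ : Field F) (τ : F), (2:F) = 0 ∧ τ^2 = τ+1 ∧
      ∀ t : F, t^3 = 1 → ∃ ψ : 𝓞 K →+* F, ψ s = 1 ∧ ψ θ = τ ∧ ψ b = t := by
  let L := AlgebraicClosure K
  have hZmax : (Ideal.span {(2:ℤ)}).IsMaximal := 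
    PrincipalIdealRing.isMaximal_of_irreducible Int.prime_two.irreducible
  obtain ⟨Q, hQ, hQ2⟩ := Ideal.exists_maximal_ideal_liesOver_of_isIntegral 
    (S := 𝓞 L) (Ideal.span {(2:ℤ)})
  let _ : Field (𝓞 L ⧸ Q) := Ideal.Quotient.field Q
  have h2Q : (2 : 𝓞 L) ∈ Q := by
    have : (2:ℤ) ∈ Ideal.comap (algebraMap ℤ (𝓞 L)) Q := by
      rw [← Ideal.under_def, ← hQ2.over]; exact Ideal.mem_span_singleton_self _
    simpa using this
  have h2 : (2 : 𝓞 L ⧸ Q) = 0 := by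
    have := Ideal.Quotient.eq_zero_iff_mem.2 h2Q
    rwa [map_ofNat] at this
  have : Algebra.IsAlgebraic ℚ L := Algebra.IsAlgebraic.trans ℚ K L
  have : IsAlgClosure ℚ L := ⟨inferInstance, inferInstance⟩
  have : Normal ℚ L := IsAlgClosure.normal ℚ L
  -- the image of `α` in the algebraic closure
  have hαint : IsIntegral ℤ (algebraMap K L α) := by
    apply IsIntegral.of_pow (n := 12) (by norm_num)
    rw [← map_pow, hroot, map_intCast]
    exact isIntegral_algebraMap (R := ℤ) (x := m)
  let a : 𝓞 L := ⟨algebraMap K L α, hαint⟩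
  have ha : (a : L) = algebraMap K L α := rfl
  have ha12L : (a : L)^12 = (m : L) := by
    rw [ha, ← map_pow, hroot, map_intCast]
  have ha12 : a^12 = (m : 𝓞 L) := by
    apply RingOfIntegers.ext
    push_cast
    exact ha12L
  -- a primitive cube root of unity
  obtain ⟨r, hr⟩ := IsAlgClosed.exists_pow_nat_eq (-3 : L) (n := 2) (by norm_num)
  have hζL : ((r-1)/2)^2 + (r-1)/2 + 1 = (0:L) := by
    have hL : CharZero L := charZero_of_injective_algebraMap (algebraMap K L).injective
    linear_combination hr / 4
  have hζint : IsIntegral ℤ ((r-1)/2) := by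
    apply IsIntegral.of_pow (n := 3) (by norm_num)
    have : ((r-1)/2)^3 = 1 := by linear_combination ((r-1)/2 - 1) * hζL
    rw [this]; exact isIntegral_one
  let ζ : 𝓞 L := ⟨(r-1)/2, hζint⟩
  have hζ : ζ^2 + ζ + 1 = 0 := by
    apply RingOfIntegers.ext
    push_cast
    exact hζL
  have hζ3 : ζ^3 = 1 := by linear_combination (ζ - 1) * hζ
  let q := Ideal.Quotient.mk Q
  have hqa : (q a)^3 = 1 := by
    have h : (q a)^12 = 1 := by
      rw [← map_pow, ha12, hm, map_intCast]
      push_cast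
      linear_combination (4 * (j : 𝓞 L ⧸ Q) + 2) * h2
    have h4 : ((q a)^3 - 1)^4 = 0 := by
      linear_combination h + (- 2 * (q a)^9 + 3 * (q a)^6 - 2 * (q a)^3 + 1) * h2
    exact sub_eq_zero.1 (pow_eq_zero_iff (by norm_num) |>.1 h4)
  have hqζ : (q ζ)^2 + q ζ + 1 = 0 := by
    rw [← map_pow, ← map_add, ← map_one q, ← map_add, hζ, map_zero]
  let ι : 𝓞 K →+* 𝓞 L := RingOfIntegers.mapRingHom (algebraMap K L)
  refine ⟨𝓞 L ⧸ Q, inferInstance, q (ι θ), h2, ?_, ?_⟩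
  · rw [← map_pow, ← map_pow, hθ2]
    simp only [map_add, map_mul, map_one, map_ofNat, map_intCast]
    linear_combination (j : 𝓞 L ⧸ Q) * h2
  intro t ht
  obtain ⟨w, hw3, hw⟩ : ∃ w : 𝓞 L, w^3 = 1 ∧ q w = t * (q a)^2 := by
    have hu : (t * (q a)^2 - 1) * ((t * (q a)^2 - q ζ) * (t * (q a)^2 - (q ζ)^2)) = 0 := by
      have h3 : (t * (q a)^2)^3 = 1 := by
        rw [mul_pow, ht, ← pow_mul, mul_comm 2 3, pow_mul, hqa]; simp
      generalize t * (q a)^2 = u at h3 ⊢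
      linear_combination h3 + (u - 1) * (q ζ - 1 - u) * hqζ
    rcases mul_eq_zero.1 hu with h | h
    · exact ⟨1, by simp, by rw [map_one]; exact (sub_eq_zero.1 h).symm⟩
    rcases mul_eq_zero.1 h with h | h
    · exact ⟨ζ, hζ3, (sub_eq_zero.1 h).symm⟩
    · exact ⟨ζ^2, by rw [← pow_mul, mul_comm, pow_mul, hζ3, one_pow],
        by rw [map_pow]; exact (sub_eq_zero.1 h).symm⟩
  have hwa : q (w * a) = t := by
    rw [map_mul, hw]
    linear_combination t * hqa
  have hw3L : (w : L)^3 = 1 := by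
    have := congrArg (fun x : 𝓞 L => (x : L)) hw3
    simpa using this
  have hmin : ∀ x : L, x^12 = (m : L) → X ^ 12 - C (m:ℚ) = minpoly ℚ x := by
    intro x hx
    apply minpoly.eq_of_irreducible_of_monic hirr
    · simp [hx]
    · exact monic_X_pow_sub_C _ (by norm_num)
  have hconj : IsConjRoot ℚ ((w : L) * a) (a : L) := by
    rw [IsConjRoot, ← hmin _ ha12L, ← hmin]
    rw [mul_pow, ha12L, show (12:ℕ) = 3 * 4 from rfl, pow_mul, hw3L]; simp
  obtain ⟨σ, hσ⟩ := isConjRoot_iff_exists_algEquiv.1 hconj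
  have hσ' : σ (algebraMap K L α) = (w : L) * a := hσ
  let κ : 𝓞 K →+* 𝓞 L := RingOfIntegers.mapRingHom ((σ : L →+* L).comp (algebraMap K L))
  have hκ : ∀ x : 𝓞 K, (κ x : L) = σ (algebraMap K L (x : K)) := fun x => rfl
  have hκs : κ s = (w * a)^3 := by
    apply RingOfIntegers.ext
    rw [hκ, hs, map_pow, map_pow, hσ']
    push_cast
    rfl
  have hκb : κ b = (w * a)^4 := by
    apply RingOfIntegers.ext
    rw [hκ, hb, map_pow, map_pow, hσ']
    push_cast
    rfl
  have hκθ : κ θ = ι θ := by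
    apply RingOfIntegers.ext
    have e1 : 2 * (κ θ : L) = 1 + ((w:L) * a)^6 := by
      rw [hκ, ← hσ', ← map_pow, ← map_pow, ← map_one σ, ← map_one (algebraMap K L), ← map_add,
        ← map_add, ← hθ, map_mul, map_mul, map_ofNat, map_ofNat]
    have e2 : 2 * (ι θ : L) = 1 + (a:L)^6 := by
      change 2 * algebraMap K L θ = 1 + (algebraMap K L α)^6
      rw [← map_pow, ← map_one (algebraMap K L), ← map_add, ← hθ, map_mul, map_ofNat]
    have e3 : ((w:L) * a)^6 = (a:L)^6 := by
      rw [mul_pow, show (6:ℕ) = 3 * 2 from rfl, pow_mul (w:L), hw3L]; simp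
    apply mul_left_cancel₀ (two_ne_zero (α := L))
    rw [e1, e2, e3]
  refine ⟨q.comp κ, ?_, ?_, ?_⟩
  · rw [RingHom.comp_apply, hκs, map_pow, hwa, ht]
  · rw [RingHom.comp_apply, hκθ]
  · rw [RingHom.comp_apply, hκb, map_pow, hwa]
    linear_combination t * ht

/-- If `m ≡ 5 (mod 8)` (with `m` squarefree, `m ∉ {0,1,-1}`, `K = ℚ(α)`, `α^12 = m`),
then `2 Z_K = 𝔭₁²𝔭₂²𝔭₃²` with three pairwise distinct prime ideals, each of residue
degree `2` (absolute norm `4`). -/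
theorem factorization_two_of_five_mod_eight (m : ℤ) (hsf : Squarefree m)
    (h0 : m ≠ 0) (h1 : m ≠ 1) (h2 : m ≠ -1)
    (K : Type*) [Field K] [NumberField K] (α : K)
    (hroot : α ^ 12 = (m : K))
    (hgen : IntermediateField.adjoin ℚ {α} = ⊤)
    (hmod : m ≡ 5 [ZMOD 8]) :
    ∃ p₁ p₂ p₃ : Ideal (𝓞 K),
      p₁ ≠ p₂ ∧ p₁ ≠ p₃ ∧ p₂ ≠ p₃ ∧
      p₁.IsPrime ∧ p₂.IsPrime ∧ p₃.IsPrime ∧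
      Ideal.absNorm p₁ = 2 ^ 2 ∧ Ideal.absNorm p₂ = 2 ^ 2 ∧ Ideal.absNorm p₃ = 2 ^ 2 ∧
      Ideal.span {(2 : 𝓞 K)} = p₁ ^ 2 * p₂ ^ 2 * p₃ ^ 2 := by
  obtain ⟨j, hj⟩ : ∃ j : ℤ, m = 8 * j + 5 := by
    have := hmod
    unfold Int.ModEq at this
    exact ⟨m / 8, by omega⟩
  have hirr := irred m hsf h1 h2
  have hmK : (m : K) = 8 * j + 5 := by rw [hj]; push_cast; ring
  have hαint : IsIntegral ℤ α := by
    apply IsIntegral.of_pow (n := 12) (by norm_num)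
    rw [hroot]
    exact isIntegral_algebraMap (R := ℤ) (x := m)
  have hθK : ((1 + α^6)/2)^2 = (1 + α^6)/2 + 2 * (j:K) + 1 := by
    field_simp
    linear_combination hroot + hmK
  have hθint : IsIntegral ℤ ((1 + α^6)/2) := by
    refine ⟨X^2 - X - C (2 * j + 1), by monicity!, ?_⟩
    rw [eval₂_sub, eval₂_sub, eval₂_pow, eval₂_X, eval₂_C, hθK]
    simp only [algebraMap_int_eq, eq_intCast]
    push_cast
    ring
  let s : 𝓞 K := ⟨α^3, hαint.pow 3⟩
  let b : 𝓞 K := ⟨α^4, hαint.pow 4⟩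
  let θ : 𝓞 K := ⟨(1 + α^6)/2, hθint⟩
  have hs : (s : K) = α^3 := rfl
  have hb : (b : K) = α^4 := rfl
  have hθ : (θ : K) = (1 + α^6)/2 := rfl
  have hθ2 : θ^2 = θ + 2 * (j : 𝓞 K) + 1 := by
    apply RingOfIntegers.ext
    simp only [map_add, map_mul, map_pow, map_one, map_ofNat, map_intCast, hθ]
    exact hθK
  have hs2 : s^2 = 2 * θ - 1 := by
    apply RingOfIntegers.ext
    simp only [map_sub, map_mul, map_pow, map_one, map_ofNat, hθ, hs]
    ring
  have hb3 : b^3 = 8 * (j : 𝓞 K) + 5 := by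
    apply RingOfIntegers.ext
    simp only [map_add, map_mul, map_pow, map_ofNat, map_intCast, hb]
    linear_combination hroot + hmK
  have hA := idealsA j s θ hs2 hθ2
  obtain ⟨hB, h12, h13, h23⟩ := idealsB j s θ b hθ2 hb3
  obtain ⟨F, _, τ, hF2, hτ, hψ⟩ := exists_homs m j hj hirr K s θ b α hroot hs hb
    (by rw [hθ]; ring) hθ2
  have key : ∀ (x : 𝓞 K) (t : F), t^3 = 1 → (∀ ψ : 𝓞 K →+* F, ψ θ = τ → ψ x = t) →
      Ideal.span {(2:𝓞 K), s-1, b-x} ≠ ⊤ := by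
    intro x t ht hx htop
    obtain ⟨ψ, hψs, hψθ, hψb⟩ := hψ t ht
    have hle : Ideal.span {(2:𝓞 K), s-1, b-x} ≤ RingHom.ker ψ := by
      rw [Ideal.span_le]
      rintro y (rfl | rfl | rfl)
      · rw [SetLike.mem_coe, RingHom.mem_ker, map_ofNat, hF2]
      · simp [RingHom.mem_ker, hψs]
      · simp [RingHom.mem_ker, hψb, hx ψ hψθ]
    exact RingHom.ker_ne_top ψ (top_le_iff.1 (htop ▸ hle))
  have p1 := key 1 1 (by simp) (fun ψ _ => map_one ψ)
  have p2 := key θ τ (by linear_combination (τ + 1) * hτ + τ * hF2) (fun ψ h => h)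
  have p3 := key (θ+1) (τ+1)
    (by linear_combination (τ + 4) * hτ + (4 * τ + 2) * hF2) (fun ψ h => by simp [h])
  set I₁ := Ideal.span {(2:𝓞 K), s-1, b-1} with hI₁
  set I₂ := Ideal.span {(2:𝓞 K), s-1, b-θ} with hI₂
  set I₃ := Ideal.span {(2:𝓞 K), s-1, b-(θ+1)} with hI₃
  have m1 : (2:𝓞 K) ∈ I₁ := Ideal.subset_span (by simp)
  have m2 : (2:𝓞 K) ∈ I₂ := Ideal.subset_span (by simp)
  have m3 : (2:𝓞 K) ∈ I₃ := Ideal.subset_span (by simp)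
  have n1 := four_le_absNorm j θ hθ2 I₁ p1 m1
  have n2 := four_le_absNorm j θ hθ2 I₂ p2 m2
  have n3 := four_le_absNorm j θ hθ2 I₃ p3 m3
  have hfac : Ideal.span {(2 : 𝓞 K)} = I₁ ^ 2 * I₂ ^ 2 * I₃ ^ 2 := by
    rw [hA, hB, mul_pow, mul_pow]
  have hrank : Module.finrank ℚ K = 12 := by
    have hαQ : IsIntegral ℚ α := Algebra.IsIntegral.isIntegral α
    have h := IntermediateField.adjoin.finrank hαQ
    rw [hgen, IntermediateField.finrank_top'] at h
    rw [h, ← minpoly.eq_of_irreducible_of_monic hirr (x := α) (by simp [hroot])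
      (monic_X_pow_sub_C _ (by norm_num))]
    exact natDegree_X_pow_sub_C
  have hnorm : Ideal.absNorm (Ideal.span {(2 : 𝓞 K)}) = 2 ^ 12 := by
    rw [Ideal.absNorm_span_singleton,
      show (2 : 𝓞 K) = algebraMap ℤ (𝓞 K) 2 from (map_ofNat _ 2).symm, Algebra.norm_algebraMap,
      RingOfIntegers.rank, hrank]
    rfl
  rw [hfac] at hnorm
  simp only [map_mul, map_pow] at hnorm
  have hprod : Ideal.absNorm I₁ * Ideal.absNorm I₂ * Ideal.absNorm I₃ = 64 := by
    have : (Ideal.absNorm I₁ * Ideal.absNorm I₂ * Ideal.absNorm I₃)^2 = 64^2 := by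
      rw [mul_pow, mul_pow, hnorm]; norm_num
    exact (Nat.pow_left_injective (n := 2) (by norm_num)) this
  have aux : ∀ x y z : ℕ, 4 ≤ x → 4 ≤ y → 4 ≤ z → x * y * z = 64 → x = 2 ^ 2 := by
    intro x y z hx hy hz h
    have : 4 * 4 ≤ y * z := Nat.mul_le_mul hy hz
    nlinarith
  have e1 := aux _ _ _ n1 n2 n3 hprod
  have e2 := aux _ _ _ n2 n1 n3 (by rw [← hprod]; ring)
  have e3 := aux _ _ _ n3 n1 n2 (by rw [← hprod]; ring)
  refine ⟨I₁, I₂, I₃, ?_, ?_, ?_, isPrime_of_norm j θ hθ2 I₁ p1 m1 e1,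
    isPrime_of_norm j θ hθ2 I₂ p2 m2 e2, isPrime_of_norm j θ hθ2 I₃ p3 m3 e3, e1, e2, e3, hfac⟩
  · intro h; rw [h, sup_idem] at h12; exact p2 h12
  · intro h; rw [h, sup_idem] at h13; exact p3 h13
  · intro h; rw [h, sup_idem] at h23; exact p3 h23
end

section
/- Let m be a squarefree rational integer with m ∉ {0, 1, -1}, α a complex root of the irreducible polynomial x^12 − m, K = ℚ(α), and Z_K the ring of integers of K. If m ≡ 1 (mod 9), then 3Z_K = 𝔭₁𝔭₂²𝔮₁𝔮₂²𝔯₁𝔯₂², where 𝔭₁, 𝔭₂, 𝔮₁, 𝔮₂, 𝔯₁, 𝔯₂ are six pairwise distinct prime ideals of Z_K, with residue degrees f(𝔭₁) = f(𝔭₂) = f(𝔮₁) = f(𝔮₂) = 1 and f(𝔯₁) = f(𝔯₂) = 2. -/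
open Polynomial NumberField

/-- Relations of the order `ℤ[α, θ]` are killed by evaluation in characteristic three. -/
lemma aux_rel {S F : Type*} [CommRing S] [IsDomain S] [CharZero S] [Field F] [CharP F 3]
    (m k : ℤ) (hk : m = 1 + 9 * k) (a t : S) (ht3 : 3 * t = a ^ 8 + a ^ 4 + 1)
    (hmin : ∀ p : ℤ[X], aeval a p = 0 → (X ^ 12 - C m : ℤ[X]) ∣ p)
    (z : F) (hz : z ^ 4 = 1) (p q : ℤ[X]) (h : aeval a p + aeval a q * t = 0) :
    aeval z p = 0 ∧ aeval z q = 0 := by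
  have h3F : (3 : F) = 0 := by exact_mod_cast CharP.cast_eq_zero F 3
  have e1 : aeval a (C 3 * p + q * (X ^ 8 + X ^ 4 + 1)) = 0 := by
    simp only [map_add, map_mul, map_pow, aeval_X, aeval_C, map_one]
    rw [← ht3]
    simp only [algebraMap_int_eq, eq_intCast, Int.cast_ofNat]
    linear_combination 3 * h
  obtain ⟨s, hs⟩ := hmin _ e1
  have e2 : (C 3 : ℤ[X]) * (p + C (3 * k) * s) =
      (X ^ 8 + X ^ 4 + 1) * ((X ^ 4 - 1) * s - q) := by
    subst hk
    simp only [map_add, map_mul, map_one] at hs ⊢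
    have : (C 9 : ℤ[X]) = C 3 * C 3 := by rw [← C_mul]; norm_num
    rw [this] at hs
    linear_combination hs
  have hp3 : Prime (C 3 : ℤ[X]) := prime_C_iff.2 Int.prime_three
  have e3 : (C 3 : ℤ[X]) ∣ (X ^ 4 - 1) * s - q := by
    rcases hp3.dvd_or_dvd (Dvd.intro _ e2) with h | h
    · exfalso
      have := (C_dvd_iff_dvd_coeff _ _).1 h 0
      simp [coeff_one, coeff_X_pow] at this
    · exact h
  obtain ⟨w, hw⟩ := e3
  rw [hw] at e2
  have e4 : p + C (3 * k) * s = (X ^ 8 + X ^ 4 + 1) * w := by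
    apply mul_left_cancel₀ hp3.ne_zero
    rw [e2]; ring
  have f1 := congrArg (aeval z) e4
  have f2 := congrArg (aeval z) hw
  have hz8 : z ^ 8 = 1 := by linear_combination (z ^ 4 + 1) * hz
  have a3 : aeval z (C 3 : ℤ[X]) = 0 := by
    rw [aeval_C]; simpa using h3F
  simp only [map_add, map_sub, map_mul, map_pow, aeval_X, map_one, hz, hz8, a3] at f1 f2
  constructor
  · linear_combination f1 + aeval z w * h3F
  · linear_combination - f2

/-- Lying over for an arbitrary ring homomorphism into an integral extension of `ℤ`. -/
lemma aux_lying {A S : Type*} [CommRing A] [CommRing S] [Algebra.IsIntegral ℤ S]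
    (φ : A →+* S) (P : Ideal A) (hP : P.IsPrime) (hle : ∀ g, φ g = 0 → g ∈ P) :
    ∃ Q : Ideal S, Q.IsPrime ∧ ∀ g, φ g ∈ Q ↔ g ∈ P := by
  let _ : Algebra A S := φ.toAlgebra
  have : Algebra.IsIntegral A S := by
    constructor
    intro s
    obtain ⟨p, hp, hp0⟩ := Algebra.IsIntegral.isIntegral (R := ℤ) s
    refine ⟨p.map (Int.castRingHom A), hp.map _, ?_⟩
    rw [eval₂_map, ← hp0]
    congr 1
    exact RingHom.ext_int _ _
  obtain ⟨Q, -, hQ, hQc⟩ := Ideal.exists_ideal_over_prime_of_isIntegral P (⊥ : Ideal S)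
    (fun g hg => hle g hg)
  refine ⟨Q, hQ, fun g => ?_⟩
  rw [← hQc]; rfl

lemma aux_quad {R : Type*} [CommRing R] [Nontrivial R] (c : R) :
    (X ^ 2 - (X + C c) : R[X]).Monic ∧ (X ^ 2 - (X + C c) : R[X]).natDegree = 2 := by
  constructor
  · monicity!
  · compute_degree!

/-- Existence of a prime with prescribed reductions of `α` and `θ`. -/
lemma aux_prime {S F : Type*} [CommRing S] [IsDomain S] [CharZero S] [Algebra.IsIntegral ℤ S]
    [Field F] [CharP F 3]
    (m k : ℤ) (hk : m = 1 + 9 * k) (a t : S) (ht3 : 3 * t = a ^ 8 + a ^ 4 + 1)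
    (ht : t ^ 2 = t + k * (a ^ 4 + 2))
    (hmin : ∀ p : ℤ[X], aeval a p = 0 → (X ^ 12 - C m : ℤ[X]) ∣ p)
    (z b : F) (hz : z ^ 4 = 1) (hb : b ^ 2 = b) :
    ∃ Q : Ideal S, Q.IsPrime ∧ (3 : S) ∈ Q ∧
      (∀ p : ℤ[X], aeval a p ∈ Q ↔ aeval z p = 0) ∧
      (∀ n : ℤ, t - n ∈ Q ↔ b = n) := by
  have h3F : (3 : F) = 0 := by exact_mod_cast CharP.cast_eq_zero F 3
  let φ : ℤ[X][X] →+* S := eval₂RingHom (aeval a : ℤ[X] →ₐ[ℤ] S).toRingHom t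
  let χ : ℤ[X][X] →+* F := eval₂RingHom (aeval z : ℤ[X] →ₐ[ℤ] F).toRingHom b
  have φX : φ X = t := by simp [φ]
  have φC : ∀ p, φ (C p) = aeval a p := by intro p; simp [φ]
  have χX : χ X = b := by simp [χ]
  have χC : ∀ p, χ (C p) = aeval z p := by intro p; simp [χ]
  have hle : ∀ G, φ G = 0 → G ∈ RingHom.ker χ := by
    intro G hG
    rw [RingHom.mem_ker]
    obtain ⟨g, hg⟩ : ∃ g : ℤ[X][X], g = X ^ 2 - (X + C (C k * (X ^ 4 + 2))) := ⟨_, rfl⟩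
    obtain ⟨hgm, hgd⟩ := aux_quad (C k * (X ^ 4 + 2) : ℤ[X])
    rw [← hg] at hgm hgd
    have φg : φ g = 0 := by
      simp only [hg, map_sub, map_pow, φX, φC, map_mul, map_add, aeval_X, aeval_C, map_ofNat]
      simp only [algebraMap_int_eq, eq_intCast]
      linear_combination ht
    have χg : χ g = 0 := by
      simp only [hg, map_sub, map_pow, χX, χC, map_mul, map_add, aeval_X, aeval_C, map_ofNat, hz]
      simp only [algebraMap_int_eq, eq_intCast]
      linear_combination hb - k * h3F
    have hdec := modByMonic_add_div G g
    have hdeg : (G %ₘ g).natDegree ≤ 1 := by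
      have := natDegree_modByMonic_lt G hgm (by
        intro h; rw [h] at hgd; simp at hgd)
      omega
    have hlin := eq_X_add_C_of_natDegree_le_one hdeg
    rw [hlin] at hdec
    set p := (G %ₘ g).coeff 0
    set q := (G %ₘ g).coeff 1
    rw [← hdec] at hG ⊢
    simp only [map_add, map_mul, φX, φC, χX, χC, φg, χg, zero_mul, add_zero] at hG ⊢
    obtain ⟨u, v⟩ := aux_rel m k hk a t ht3 hmin z hz p q (by rw [← hG]; ring)
    rw [u, v]; ring
  obtain ⟨Q, hQ, key⟩ := aux_lying φ (RingHom.ker χ) (RingHom.ker_isPrime χ) hle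
  simp only [RingHom.mem_ker] at key
  refine ⟨Q, hQ, ?_, ?_, ?_⟩
  · have := (key 3).2 (by simp only [map_ofNat]; exact h3F)
    simpa only [map_ofNat] using this
  · intro p
    rw [← φC, key, χC]
  · intro n
    have := key (X - C (C n))
    simp only [map_sub, φX, φC, χX, χC, eq_intCast, map_intCast] at this
    rw [this, sub_eq_zero]

lemma aux_irr (m : ℤ) (hsf : Squarefree m) (h1 : m ≠ 1) (h2 : m ≠ -1) :
    Irreducible (X ^ 12 - C m : ℤ[X]) := by
  have hnu : ¬ IsUnit m := by rw [Int.isUnit_iff]; tauto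
  have h0 : m ≠ 0 := hsf.ne_zero
  obtain ⟨p, hp, hpm⟩ := WfDvdMonoid.exists_irreducible_factor hnu h0
  have hdeg : (X ^ 12 - C m : ℤ[X]).natDegree = 12 := natDegree_X_pow_sub_C
  have hmon : (X ^ 12 - C m : ℤ[X]).Monic := monic_X_pow_sub_C m (by norm_num)
  refine IsEisensteinAt.irreducible (𝓟 := Ideal.span {p}) ?_ ?_ hmon.isPrimitive (by omega)
  · refine ⟨?_, ?_, ?_⟩
    · rw [hmon.leadingCoeff, Ideal.mem_span_singleton]
      exact fun h => hp.not_isUnit (isUnit_of_dvd_one h)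
    · intro n hn
      rw [hdeg] at hn
      rw [Ideal.mem_span_singleton, coeff_sub, coeff_X_pow, coeff_C, if_neg (by omega)]
      split_ifs
      · simpa using hpm
      · simp
    · rw [Ideal.span_singleton_pow, Ideal.mem_span_singleton, coeff_sub, coeff_X_pow, coeff_C]
      simp only [if_true]
      intro h
      exact hp.not_isUnit (hsf p (by rw [← sq]; simpa using h))
  · exact (Ideal.span_singleton_prime hp.ne_zero).2 hp.prime

lemma aux_sq {S : Type*} [CommRing S] (Q : Ideal S) [Q.IsMaximal] (a t : S)
    (h3 : (3 : S) ∈ Q) (ha : a ^ 4 - 1 ∈ Q) (htQ : t ∈ Q) (ht3 : 3 * t = a ^ 8 + a ^ 4 + 1) :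
    (3 : S) ∈ Q ^ 2 := by
  have hn : t - a ^ 4 ∉ Q := by
    intro h
    apply (Ideal.ne_top_iff_one Q).1 (Ideal.IsMaximal.ne_top inferInstance)
    have := Q.sub_mem (Q.sub_mem htQ h) ha
    convert this using 1; ring
  have hco : IsCoprime (Ideal.span {t - a ^ 4}) (Q ^ 2) := by
    apply IsCoprime.pow_right
    rw [Ideal.isCoprime_iff_sup_eq, sup_comm]
    apply (Ideal.isMaximal_def.1 ‹Q.IsMaximal›).2
    refine lt_of_le_of_ne le_sup_left fun h => hn ?_
    rw [h]
    exact Ideal.mem_sup_right (Ideal.mem_span_singleton_self _)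
  rw [Ideal.isCoprime_iff_exists] at hco
  obtain ⟨u, hu, v, hv, huv⟩ := hco
  obtain ⟨c, rfl⟩ := Ideal.mem_span_singleton.1 hu
  have hsq : (a ^ 4 - 1) ^ 2 ∈ Q ^ 2 := Ideal.pow_mem_pow ha 2
  have : (3 : S) = c * (a ^ 4 - 1) ^ 2 + 3 * v := by
    linear_combination c * ht3 - 3 * huv
  rw [this]
  exact Ideal.add_mem _ (Ideal.mul_mem_left _ _ hsq) (Ideal.mul_mem_left _ _ hv)

lemma aux_card {S : Type*} [CommRing S] (Q : Ideal S) [Q.IsMaximal] (a : S)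
    (h3 : (3 : S) ∈ Q) (ha : a ^ 2 + 1 ∈ Q) : Nat.card (S ⧸ Q) ≠ 3 := by
  intro hc
  let := Ideal.Quotient.field Q
  have : Finite (S ⧸ Q) := Nat.finite_of_card_ne_zero (by omega)
  let := Fintype.ofFinite (S ⧸ Q)
  have h := FiniteField.pow_card (Ideal.Quotient.mk Q a)
  rw [← Nat.card_eq_fintype_card, hc] at h
  have h3' : (3 : S ⧸ Q) = 0 := by
    have := Ideal.Quotient.eq_zero_iff_mem.2 h3
    simpa only [map_ofNat] using this
  have ha' : (Ideal.Quotient.mk Q a) ^ 2 + 1 = 0 := by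
    have := Ideal.Quotient.eq_zero_iff_mem.2 ha
    simpa only [map_add, map_pow, map_one] using this
  set y := Ideal.Quotient.mk Q a
  have : (1 : S ⧸ Q) = 0 := by
    linear_combination h3' - y * h + (y ^ 2 - 2) * ha'
  exact one_ne_zero this

/-- A prime containing `3` has norm a positive power of three. -/
lemma aux_norm {K : Type*} [Field K] [NumberField K] (hN : Ideal.absNorm (Ideal.span {(3 : 𝓞 K)}) = 3 ^ 12)
    (Q : Ideal (𝓞 K)) (hQ : Q.IsPrime) (h3 : (3 : 𝓞 K) ∈ Q) :
    ∃ j : ℕ, 1 ≤ j ∧ Ideal.absNorm Q = 3 ^ j := by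
  have hd := Ideal.absNorm_dvd_absNorm_of_le ((Ideal.span_singleton_le_iff_mem Q).2 h3)
  rw [hN, Nat.dvd_prime_pow Nat.prime_three] at hd
  obtain ⟨j, -, hj⟩ := hd
  refine ⟨j, ?_, hj⟩
  rcases Nat.eq_zero_or_pos j with rfl | h
  · exact absurd (Ideal.absNorm_eq_one_iff.1 (by simpa using hj)) hQ.ne_top
  · exact h

lemma aux_six {R : Type*} [CommSemiring R] (a b c d e f x : R)
    (ab : IsCoprime a b) (ac : IsCoprime a c) (ad : IsCoprime a d) (ae : IsCoprime a e)
    (af : IsCoprime a f) (bc : IsCoprime b c) (bd : IsCoprime b d) (be : IsCoprime b e)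
    (bf : IsCoprime b f) (cd : IsCoprime c d) (ce : IsCoprime c e) (cf : IsCoprime c f)
    (de : IsCoprime d e) (df : IsCoprime d f) (ef : IsCoprime e f)
    (ha : a ∣ x) (hb : b ∣ x) (hc : c ∣ x) (hd : d ∣ x) (he : e ∣ x) (hf : f ∣ x) :
    a * b * c * d * e * f ∣ x := by
  have h2 := ab.mul_dvd ha hb
  have h3 := (ac.mul_left bc).mul_dvd h2 hc
  have h4 := ((ad.mul_left bd).mul_left cd).mul_dvd h3 hd
  have h5 := (((ae.mul_left be).mul_left ce).mul_left de).mul_dvd h4 he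
  exact ((((af.mul_left bf).mul_left cf).mul_left df).mul_left ef).mul_dvd h5 hf

/-- If `m ≡ 1 (mod 9)` (with `m` squarefree, `m ∉ {0,1,-1}`, `K = ℚ(α)`, `α^12 = m`),
then `3 Z_K = 𝔭₁𝔭₂²𝔮₁𝔮₂²𝔯₁𝔯₂²` with six pairwise distinct prime ideals, where
`𝔭₁, 𝔭₂, 𝔮₁, 𝔮₂` have residue degree `1` (absolute norm `3`) and `𝔯₁, 𝔯₂` have residue
degree `2` (absolute norm `9`). -/
theorem factorization_three_of_one_mod_nine (m : ℤ) (hsf : Squarefree m)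
    (h0 : m ≠ 0) (h1 : m ≠ 1) (h2 : m ≠ -1)
    (K : Type*) [Field K] [NumberField K] (α : K)
    (hroot : α ^ 12 = (m : K))
    (hgen : IntermediateField.adjoin ℚ {α} = ⊤)
    (hmod : m ≡ 1 [ZMOD 9]) :
    ∃ p₁ p₂ q₁ q₂ r₁ r₂ : Ideal (𝓞 K),
      [p₁, p₂, q₁, q₂, r₁, r₂].Pairwise (· ≠ ·) ∧
      p₁.IsPrime ∧ p₂.IsPrime ∧ q₁.IsPrime ∧ q₂.IsPrime ∧ r₁.IsPrime ∧ r₂.IsPrime ∧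
      Ideal.absNorm p₁ = 3 ∧ Ideal.absNorm p₂ = 3 ∧
      Ideal.absNorm q₁ = 3 ∧ Ideal.absNorm q₂ = 3 ∧
      Ideal.absNorm r₁ = 3 ^ 2 ∧ Ideal.absNorm r₂ = 3 ^ 2 ∧
      Ideal.span {(3 : 𝓞 K)} = p₁ * p₂ ^ 2 * q₁ * q₂ ^ 2 * r₁ * r₂ ^ 2 := by
  have hK : IsIntegral ℤ α := ⟨X ^ 12 - C m, monic_X_pow_sub_C m (by norm_num), by
    rw [eval₂_sub, eval₂_pow, eval₂_X, eval₂_C, hroot]; simp⟩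
  have hirr := aux_irr m hsf h1 h2
  have hmon : (X ^ 12 - C m : ℤ[X]).Monic := monic_X_pow_sub_C m (by norm_num)
  have hirrQ := (hmon.irreducible_iff_irreducible_map_fraction_map (K := ℚ)).1 hirr
  have hmpQ : (X ^ 12 - C m : ℤ[X]).map (algebraMap ℤ ℚ) = minpoly ℚ α := by
    refine minpoly.eq_of_irreducible_of_monic hirrQ ?_ (hmon.map _)
    rw [aeval_map_algebraMap]
    simp [hroot]
  have hmpZ : minpoly ℤ α = X ^ 12 - C m := by
    rw [minpoly.isIntegrallyClosed_eq_field_fractions' ℚ hK] at hmpQ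
    exact (map_injective _ (algebraMap ℤ ℚ).injective_int hmpQ).symm
  have hrank : Module.finrank ℚ K = 12 := by
    rw [← IntermediateField.finrank_top', ← hgen,
      IntermediateField.adjoin.finrank hK.tower_top, ← hmpQ, hmon.natDegree_map]
    exact natDegree_X_pow_sub_C
  have hN : Ideal.absNorm (Ideal.span {(3 : 𝓞 K)}) = 3 ^ 12 := by
    rw [Ideal.absNorm_span_singleton]
    have : (3 : 𝓞 K) = algebraMap ℤ (𝓞 K) 3 := by simp
    rw [this, Algebra.norm_algebraMap, RingOfIntegers.rank, hrank]
    norm_num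
  obtain ⟨k, hk⟩ : ∃ k : ℤ, m = 1 + 9 * k := by
    obtain ⟨k, hk⟩ := hmod.symm.dvd
    exact ⟨k, by omega⟩
  obtain ⟨a, ha⟩ : ∃ a : 𝓞 K, algebraMap (𝓞 K) K a = α := ⟨⟨α, hK⟩, rfl⟩
  have hinj : Function.Injective (algebraMap (𝓞 K) K) := RingOfIntegers.coe_injective
  have hmin : ∀ p : ℤ[X], aeval a p = 0 → (X ^ 12 - C m : ℤ[X]) ∣ p := by
    intro p hp
    rw [← hmpZ]
    apply minpoly.isIntegrallyClosed_dvd hK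
    rw [← ha, aeval_algebraMap_apply, hp, map_zero]
  have hroot' : α ^ 12 = 1 + 9 * (k : K) := by rw [hroot, hk]; push_cast; ring
  have hθ : IsIntegral (𝓞 K) ((α ^ 8 + α ^ 4 + 1) / 3) := by
    refine ⟨X ^ 2 - (X + C (k * (a ^ 4 + 2))), (aux_quad _).1, ?_⟩
    rw [eval₂_sub, eval₂_add, eval₂_pow, eval₂_X, eval₂_C]
    simp only [map_mul, map_add, map_pow, ha, map_ofNat, map_intCast]
    field_simp
    linear_combination (α ^ 4 + 2) * hroot'
  obtain ⟨t, ht⟩ := IsIntegrallyClosed.isIntegral_iff.1 hθ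
  have ht3 : 3 * t = a ^ 8 + a ^ 4 + 1 := by
    apply hinj
    simp only [map_mul, map_add, map_pow, map_ofNat, map_one, ha, ht]
    field_simp
  have ht2 : t ^ 2 = t + k * (a ^ 4 + 2) := by
    apply hinj
    simp only [map_mul, map_add, map_pow, map_ofNat, map_intCast, ha, ht]
    field_simp
    linear_combination (α ^ 4 + 2) * hroot'
  have h3ne : (3 : 𝓞 K) ≠ 0 := by norm_num
  -- the primes
  let F := AlgebraicClosure (ZMod 3)
  have : CharP F 3 := inferInstance
  have h3F : (3 : F) = 0 := by exact_mod_cast CharP.cast_eq_zero F 3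
  have h2F : (2 : F) ≠ 0 := by
    intro h; apply one_ne_zero (α := F); linear_combination h3F - h
  obtain ⟨i, hi⟩ : ∃ i : F, i ^ 2 = -1 := IsAlgClosed.exists_pow_nat_eq _ (by norm_num)
  have P := fun z b => aux_prime (F := F) m k hk a t ht3 ht2 hmin z b
  have hi4 : i ^ 4 = 1 := by linear_combination (i ^ 2 - 1) * hi
  obtain ⟨p₁, p1p, p13, p1a, p1t⟩ := P 1 1 (by norm_num) (by norm_num)
  obtain ⟨p₂, p2p, p23, p2a, p2t⟩ := P 1 0 (by norm_num) (by norm_num)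
  obtain ⟨q₁, q1p, q13, q1a, q1t⟩ := P (-1) 1 (by norm_num) (by norm_num)
  obtain ⟨q₂, q2p, q23, q2a, q2t⟩ := P (-1) 0 (by norm_num) (by norm_num)
  obtain ⟨r₁, r1p, r13, r1a, r1t⟩ := P i 1 hi4 (by norm_num)
  obtain ⟨r₂, r2p, r23, r2a, r2t⟩ := P i 0 hi4 (by norm_num)
  have hmax : ∀ Q : Ideal (𝓞 K), Q.IsPrime → (3 : 𝓞 K) ∈ Q → Q.IsMaximal := by
    intro Q hQ h3
    refine hQ.isMaximal ?_
    rintro rfl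
    exact h3ne (by simpa using h3)
  have p1m := hmax _ p1p p13
  have p2m := hmax _ p2p p23
  have q1m := hmax _ q1p q13
  have q2m := hmax _ q2p q23
  have r1m := hmax _ r1p r13
  have r2m := hmax _ r2p r23
  -- distinctness
  have dt : ∀ Q Q' : Ideal (𝓞 K), (∀ n : ℤ, t - n ∈ Q ↔ (1 : F) = n) →
      (∀ n : ℤ, t - n ∈ Q' ↔ (0 : F) = n) → Q ≠ Q' := by
    rintro Q _ h h' rfl
    have := (h' 1).1 ((h 1).2 (by simp))
    simp at this
  have da : ∀ (z w : F) (Q Q' : Ideal (𝓞 K)), (∀ p : ℤ[X], aeval a p ∈ Q ↔ aeval z p = 0) →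
      (∀ p : ℤ[X], aeval a p ∈ Q' ↔ aeval w p = 0) →
      (∃ p : ℤ[X], aeval z p = 0 ∧ aeval w p ≠ 0) → Q ≠ Q' := by
    rintro z w Q _ h h' ⟨p, hp, hp'⟩ rfl
    exact hp' ((h' p).1 ((h p).2 hp))
  have s1 : ∃ p : ℤ[X], aeval (1 : F) p = 0 ∧ aeval (-1 : F) p ≠ 0 := by
    refine ⟨X - 1, by simp, ?_⟩
    simp only [map_sub, aeval_X, map_one]
    intro h; apply h2F; linear_combination - h
  have s2 : ∃ p : ℤ[X], aeval (1 : F) p = 0 ∧ aeval i p ≠ 0 := by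
    refine ⟨X ^ 2 - 1, by simp, ?_⟩
    simp only [map_sub, aeval_X, map_one, map_pow, hi]
    intro h; apply h2F; linear_combination - h
  have s3 : ∃ p : ℤ[X], aeval (-1 : F) p = 0 ∧ aeval i p ≠ 0 := by
    refine ⟨X ^ 2 - 1, by simp, ?_⟩
    simp only [map_sub, aeval_X, map_one, map_pow, hi]
    intro h; apply h2F; linear_combination - h
  have n12 := dt _ _ p1t p2t
  have n13 := da _ _ _ _ p1a q1a s1
  have n14 := da _ _ _ _ p1a q2a s1
  have n15 := da _ _ _ _ p1a r1a s2
  have n16 := da _ _ _ _ p1a r2a s2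
  have n23 := da _ _ _ _ p2a q1a s1
  have n24 := da _ _ _ _ p2a q2a s1
  have n25 := da _ _ _ _ p2a r1a s2
  have n26 := da _ _ _ _ p2a r2a s2
  have n34 := dt _ _ q1t q2t
  have n35 := da _ _ _ _ q1a r1a s3
  have n36 := da _ _ _ _ q1a r2a s3
  have n45 := da _ _ _ _ q2a r1a s3
  have n46 := da _ _ _ _ q2a r2a s3
  have n56 := dt _ _ r1t r2t
  -- squares
  have hsq : ∀ (z : F) (Q : Ideal (𝓞 K)), Q.IsMaximal → (3 : 𝓞 K) ∈ Q → z ^ 4 = 1 →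
      (∀ p : ℤ[X], aeval a p ∈ Q ↔ aeval z p = 0) →
      (∀ n : ℤ, t - n ∈ Q ↔ (0 : F) = n) → Q ^ 2 ∣ Ideal.span {(3 : 𝓞 K)} := by
    intro z Q hQ h3 hz hza htb
    rw [Ideal.dvd_span_singleton]
    refine aux_sq Q a t h3 ?_ ?_ ht3
    · have := (hza (X ^ 4 - 1)).2 (by simp [hz])
      simpa using this
    · have := (htb 0).2 (by simp)
      simpa using this
  have hprod : p₁ * p₂ ^ 2 * q₁ * q₂ ^ 2 * r₁ * r₂ ^ 2 ∣ Ideal.span {(3 : 𝓞 K)} := by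
    have co : ∀ {I J : Ideal (𝓞 K)}, I.IsMaximal → J.IsMaximal → I ≠ J → IsCoprime I J := by
      intro I J hI hJ h
      exact Ideal.isCoprime_of_isMaximal h
    apply aux_six
    · exact (co p1m p2m n12).pow_right
    · exact co p1m q1m n13
    · exact (co p1m q2m n14).pow_right
    · exact co p1m r1m n15
    · exact (co p1m r2m n16).pow_right
    · exact (co p2m q1m n23).pow_left
    · exact (co p2m q2m n24).pow
    · exact (co p2m r1m n25).pow_left
    · exact (co p2m r2m n26).pow
    · exact (co q1m q2m n34).pow_right
    · exact co q1m r1m n35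
    · exact (co q1m r2m n36).pow_right
    · exact (co q2m r1m n45).pow_left
    · exact (co q2m r2m n46).pow
    · exact (co r1m r2m n56).pow_right
    · exact Ideal.dvd_span_singleton.2 p13
    · exact hsq _ _ p2m p23 (by norm_num) p2a p2t
    · exact Ideal.dvd_span_singleton.2 q13
    · exact hsq _ _ q2m q23 (by norm_num) q2a q2t
    · exact Ideal.dvd_span_singleton.2 r13
    · exact hsq _ _ r2m r23 hi4 r2a r2t
  -- norms
  have hr : ∀ (Q : Ideal (𝓞 K)), Q.IsMaximal → (3 : 𝓞 K) ∈ Q →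
      (∀ p : ℤ[X], aeval a p ∈ Q ↔ aeval i p = 0) → Ideal.absNorm Q ≠ 3 := by
    intro Q hQ h3 hza
    rw [Ideal.absNorm_apply, Submodule.cardQuot_apply]
    refine aux_card Q a h3 ?_
    have := (hza (X ^ 2 + 1)).2 (by simp [hi])
    simpa using this
  have hr1 := hr _ r1m r13 r1a
  have hr2 := hr _ r2m r23 r2a
  obtain ⟨j1, hj1, e1⟩ := aux_norm hN p₁ p1p p13
  obtain ⟨j2, hj2, e2⟩ := aux_norm hN p₂ p2p p23
  obtain ⟨j3, hj3, e3⟩ := aux_norm hN q₁ q1p q13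
  obtain ⟨j4, hj4, e4⟩ := aux_norm hN q₂ q2p q23
  obtain ⟨j5, hj5, e5⟩ := aux_norm hN r₁ r1p r13
  obtain ⟨j6, hj6, e6⟩ := aux_norm hN r₂ r2p r23
  have hj5' : j5 ≠ 1 := by rintro rfl; exact hr1 (by simpa using e5)
  have hj6' : j6 ≠ 1 := by rintro rfl; exact hr2 (by simpa using e6)
  obtain ⟨J, hJ⟩ := hprod
  have hNJ := congrArg Ideal.absNorm hJ
  rw [hN] at hNJ
  simp only [map_mul, map_pow, e1, e2, e3, e4, e5, e6, ← pow_mul, ← pow_add] at hNJ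
  have hle : j1 + j2 * 2 + j3 + j4 * 2 + j5 + j6 * 2 ≤ 12 := by
    rw [← Nat.pow_dvd_pow_iff_le_right (x := 3) (by norm_num)]
    exact Dvd.intro _ hNJ.symm
  obtain rfl : j1 = 1 := by omega
  obtain rfl : j2 = 1 := by omega
  obtain rfl : j3 = 1 := by omega
  obtain rfl : j4 = 1 := by omega
  obtain rfl : j5 = 2 := by omega
  obtain rfl : j6 = 2 := by omega
  have hJ1 : Ideal.absNorm J = 1 := by omega
  rw [Ideal.absNorm_eq_one_iff] at hJ1
  rw [hJ1, Ideal.mul_top] at hJ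
  refine ⟨p₁, p₂, q₁, q₂, r₁, r₂, ?_, p1p, p2p, q1p, q2p, r1p, r2p, by simpa using e1,
    by simpa using e2, by simpa using e3, by simpa using e4, e5, e6, hJ⟩
  simp only [List.pairwise_cons, List.mem_cons, List.not_mem_nil, or_false, forall_eq_or_imp,
    forall_eq, List.Pairwise.nil, and_true, false_imp_iff, implies_true]
  exact ⟨⟨n12, n13, n14, n15, n16⟩, ⟨n23, n24, n25, n26⟩, ⟨n34, n35, n36⟩, ⟨n45, n46⟩, n56⟩
end
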